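/- Let A be a basic artin algebra of finite global dimension, e an idempotent of A, Γ := (1-e)A(1-e), and assume the Yoneda ring Y(e) has finite global dimension. Then the Cartan determinants of A and Γ coincide, cd(A) = cd(Γ), and Γ has finite global dimension. In particular, if the Cartan determinant conjecture holds for Γ (that is, cd(Γ) = 1 whenever gl.dim Γ < ∞), then cd(A) = 1. -/

import Mathlib

set_option linter.unusedVariables false
set_option maxHeartbeats 1000000

/-! Common setup: corner rings, the simple module `S_e`, Ext-algebras (Yoneda rings),
semiperfect and basic rings, finite global dimension. -/

open CategoryTheory CategoryTheory.Abelian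
open scoped DirectSum

noncomputable section

/-- Smallness of Ext groups for module categories. -/
instance hasExtModuleCat (R : Type u) [Ring R] : HasExt.{u + 1} (ModuleCat.{u} R) :=
  letI := HasDerivedCategory.standard (ModuleCat.{u} R)
  hasExt_of_hasDerivedCategory _

/-! ### Corner rings `eAe` -/

/-- The corner ring `eAe = {x : A | e * x = x ∧ x * e = x}` of an idempotent `e : A`. -/
def CornerRing {A : Type*} [Ring A] (e : A) (_ : IsIdempotentElem e) : Type _ :=
  {x : A // e * x = x ∧ x * e = x}

namespace CornerRing

variable {A : Type*} [Ring A] {e : A} {he : IsIdempotentElem e}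

instance : Zero (CornerRing e he) := ⟨⟨0, by simp, by simp⟩⟩
instance : One (CornerRing e he) := ⟨⟨e, he, he⟩⟩
instance : Add (CornerRing e he) :=
  ⟨fun x y => ⟨x.1 + y.1, by rw [mul_add, x.2.1, y.2.1], by rw [add_mul, x.2.2, y.2.2]⟩⟩
instance : Neg (CornerRing e he) :=
  ⟨fun x => ⟨-x.1, by rw [mul_neg, x.2.1], by rw [neg_mul, x.2.2]⟩⟩
instance : Mul (CornerRing e he) :=
  ⟨fun x y => ⟨x.1 * y.1, by rw [← mul_assoc, x.2.1], by rw [mul_assoc, y.2.2]⟩⟩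

instance instRing : Ring (CornerRing e he) where
  add_assoc x y z := Subtype.ext (add_assoc _ _ _)
  zero_add x := Subtype.ext (zero_add _)
  add_zero x := Subtype.ext (add_zero _)
  add_comm x y := Subtype.ext (add_comm _ _)
  neg_add_cancel x := Subtype.ext (neg_add_cancel _)
  mul_assoc x y z := Subtype.ext (mul_assoc _ _ _)
  one_mul x := Subtype.ext x.2.1
  mul_one x := Subtype.ext x.2.2
  left_distrib x y z := Subtype.ext (left_distrib _ _ _)
  right_distrib x y z := Subtype.ext (right_distrib _ _ _)
  zero_mul x := Subtype.ext (zero_mul _)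
  mul_zero x := Subtype.ext (mul_zero _)
  nsmul := nsmulRec
  zsmul := zsmulRec

end CornerRing

/-! ### The semisimple module `S_e = eA / e rad A` -/

/-- The Jacobson radical of the ring `A`, as a set. -/
def ringRadical (A : Type*) [Ring A] : Set A :=
  ((⊥ : TwoSidedIdeal A).jacobson : Set A)

/-- The right ideal `eA`, as a right `A`-module (i.e. an `Aᵐᵒᵖ`-module). -/
def rightIdeal (A : Type*) [Ring A] (e : A) : Submodule Aᵐᵒᵖ A :=
  Submodule.span Aᵐᵒᵖ {e}

/-- The right submodule `e (rad A)` of `A`. -/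
def eRad (A : Type*) [Ring A] (e : A) : Submodule Aᵐᵒᵖ A :=
  Submodule.span Aᵐᵒᵖ ((e * ·) '' ringRadical A)

/-- The semisimple right `A`-module `S_e = eA / e rad A` associated with an idempotent `e`. -/
def SeModule (A : Type*) [Ring A] (e : A) : Type _ :=
  rightIdeal A e ⧸ (eRad A e).comap (rightIdeal A e).subtype

instance (A : Type*) [Ring A] (e : A) : AddCommGroup (SeModule A e) :=
  inferInstanceAs (AddCommGroup (rightIdeal A e ⧸ (eRad A e).comap (rightIdeal A e).subtype))

instance (A : Type*) [Ring A] (e : A) : Module Aᵐᵒᵖ (SeModule A e) :=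
  inferInstanceAs (Module Aᵐᵒᵖ (rightIdeal A e ⧸ (eRad A e).comap (rightIdeal A e).subtype))

/-- `S_e` as an object of the category of right `A`-modules. -/
def Se (A : Type) [Ring A] (e : A) : ModuleCat Aᵐᵒᵖ :=
  ModuleCat.of Aᵐᵒᵖ (SeModule A e)

/-! ### The Ext-algebra (Yoneda ring) of an object of an abelian category -/

namespace ExtYoneda

universe w v u
variable {C : Type u} [Category.{v} C] [Abelian C] [HasExt.{w} C]

lemma comp_heq {X Y Z : C} {a b c : ℕ} (h : a + b = c) (α : Ext X Y a) (β : Ext Y Z b) :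
    HEq (α.comp β rfl) (α.comp β h) := by subst h; rfl

variable (X : C)

def gmul : GradedMonoid.GMul (fun i : ℕ => Ext X X i) where
  mul {i j} α β := α.comp β rfl

def gone : GradedMonoid.GOne (fun i : ℕ => Ext X X i) where
  one := Ext.mk₀ (𝟙 X)

def gmonoid : GradedMonoid.GMonoid (fun i : ℕ => Ext X X i) :=
  letI := gmul X
  letI := gone X
  { one_mul := fun a => by
      obtain ⟨i, α⟩ := a
      exact Sigma.ext (zero_add i)
        ((comp_heq (zero_add i) _ _).trans (heq_of_eq (Ext.mk₀_id_comp α)))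
    mul_one := fun a => by
      obtain ⟨i, α⟩ := a
      exact Sigma.ext (add_zero i)
        ((comp_heq (add_zero i) _ _).trans (heq_of_eq (Ext.comp_mk₀_id α)))
    mul_assoc := fun a b c => by
      obtain ⟨i, α⟩ := a
      obtain ⟨j, β⟩ := b
      obtain ⟨k, γ⟩ := c
      refine Sigma.ext (add_assoc i j k) ?_
      refine (heq_of_eq (Ext.comp_assoc α β γ rfl rfl rfl)).trans ?_
      exact (comp_heq (h := (add_assoc i j k).symm ▸ rfl) _ _).symm }

/-- The graded ring structure on `fun i => Ext X X i` given by the Yoneda product. -/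
def gring : DirectSum.GRing (fun i : ℕ => Ext X X i) :=
  letI := gmonoid X
  { __ := gmonoid X
    mul_zero := fun {i j} α => Ext.comp_zero α _ _ _ rfl
    zero_mul := fun {i j} β => Ext.zero_comp _ _ β _ rfl
    mul_add := fun {_ _} α β γ => Ext.comp_add _ _ _ rfl
    add_mul := fun {_ _} α β γ => Ext.add_comp _ _ _ rfl
    natCast := fun n => n • Ext.mk₀ (𝟙 X)
    natCast_zero := zero_smul _ _
    natCast_succ := fun n => succ_nsmul _ _
    intCast := fun z => z • Ext.mk₀ (𝟙 X)
    intCast_ofNat := fun n => natCast_zsmul _ _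
    intCast_negSucc_ofNat := fun n => negSucc_zsmul _ _ }

end ExtYoneda

/-- The Yoneda (Ext-) ring `⨁ i, Ext X X i` of an object `X` of an abelian category,
with multiplication induced by the Yoneda product. -/
def ExtRing {C : Type u} [Category.{v} C] [Abelian C] [HasExt.{w} C] (X : C) : Type w :=
  ⨁ i : ℕ, Ext X X i

instance {C : Type u} [Category.{v} C] [Abelian C] [HasExt.{w} C] (X : C) :
    Ring (ExtRing X) :=
  letI := ExtYoneda.gring X
  inferInstanceAs (Ring (⨁ i : ℕ, Ext X X i))

/-- The Yoneda ring `Y(e) = Ext_A^*(S_e, S_e)` of an idempotent `e` of the ring `A`. -/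
def YonedaRing (A : Type) [Ring A] (e : A) : Type 1 :=
  ExtRing (Se A e)

instance (A : Type) [Ring A] (e : A) : Ring (YonedaRing A e) :=
  inferInstanceAs (Ring (ExtRing (Se A e)))

/-! ### Homological and ring-theoretic conditions -/

/-- A ring `R` has finite (right) global dimension if there is a uniform bound `n` such that
`Ext^i(M, N)` vanishes for all right `R`-modules `M`, `N` and all `i > n`. -/
def HasFiniteGlobalDimension (R : Type u) [Ring R] : Prop :=
  ∃ n : ℕ, ∀ (M N : ModuleCat.{u} Rᵐᵒᵖ) (i : ℕ), n < i → Subsingleton (Ext M N i)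

/-- A ring is Artinian on both sides. -/
def IsTwoSidedArtinian (R : Type u) [Ring R] : Prop :=
  IsArtinianRing R ∧ IsArtinianRing Rᵐᵒᵖ

/-- A ring is Noetherian on both sides. -/
def IsTwoSidedNoetherian (R : Type u) [Ring R] : Prop :=
  IsNoetherianRing R ∧ IsNoetherianRing Rᵐᵒᵖ

/-- A ring is semiperfect iff `1` decomposes as a finite sum of pairwise orthogonal
idempotents each of whose corner rings is local. -/
def IsSemiperfectRing (A : Type*) [Ring A] : Prop :=
  ∃ (n : ℕ) (f : Fin n → A) (hf : ∀ i, IsIdempotentElem (f i)),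
    (∀ i j, i ≠ j → f i * f j = 0) ∧ (∑ i, f i = 1) ∧
      ∀ i, IsLocalRing (CornerRing (f i) (hf i))

/-- An idempotent is primitive if it is nonzero and cannot be written as the sum of two
nonzero orthogonal idempotents. -/
def IsPrimitiveIdempotent {A : Type*} [Ring A] (e : A) : Prop :=
  IsIdempotentElem e ∧ e ≠ 0 ∧
    ∀ f g : A, IsIdempotentElem f → IsIdempotentElem g → f * g = 0 → g * f = 0 →
      f + g = e → f = 0 ∨ g = 0

/-- A ring is basic if `1` decomposes as a finite sum of pairwise orthogonal primitive
idempotents whose associated indecomposable projective right modules are pairwise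
non-isomorphic. -/
def IsBasicRing (A : Type*) [Ring A] : Prop :=
  ∃ (n : ℕ) (f : Fin n → A),
    (∀ i, IsPrimitiveIdempotent (f i)) ∧ (∀ i j, i ≠ j → f i * f j = 0) ∧ (∑ i, f i = 1) ∧
      ∀ i j, i ≠ j → IsEmpty ((rightIdeal A (f i)) ≃ₗ[Aᵐᵒᵖ] (rightIdeal A (f j)))

end
/-! ### Cartan matrices of basic artin algebras -/

/-- The additive group `fAg = {x : A | f * x = x ∧ x * g = x}` for idempotents `f, g`;
for a complete set of primitive orthogonal idempotents, `e_j A e_i ≅ Hom_A(e_i A, e_j A)`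
and its length over `e_i A e_i` is the `(i,j)` entry of the Cartan matrix. -/
def CornerPiece {A : Type*} [Ring A] (f g : A) : Type _ :=
  {x : A // f * x = x ∧ x * g = x}

namespace CornerPiece

variable {A : Type*} [Ring A] {f g : A}

instance : Zero (CornerPiece f g) := ⟨⟨0, by simp, by simp⟩⟩
instance : Add (CornerPiece f g) :=
  ⟨fun x y => ⟨x.1 + y.1, by rw [mul_add, x.2.1, y.2.1], by rw [add_mul, x.2.2, y.2.2]⟩⟩
instance : Neg (CornerPiece f g) :=
  ⟨fun x => ⟨-x.1, by rw [mul_neg, x.2.1], by rw [neg_mul, x.2.2]⟩⟩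

instance : AddCommGroup (CornerPiece f g) where
  add_assoc x y z := Subtype.ext (add_assoc _ _ _)
  zero_add x := Subtype.ext (zero_add _)
  add_zero x := Subtype.ext (add_zero _)
  add_comm x y := Subtype.ext (add_comm _ _)
  neg_add_cancel x := Subtype.ext (neg_add_cancel _)
  nsmul := nsmulRec
  zsmul := zsmulRec

variable {hg : IsIdempotentElem g}

/-- `fAg` is a right module over the corner ring `gAg`, i.e. a left module over its
opposite ring. -/
instance : SMul (CornerRing g hg)ᵐᵒᵖ (CornerPiece f g) :=
  ⟨fun c x => ⟨x.1 * (MulOpposite.unop c).1,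
    by rw [← mul_assoc, x.2.1],
    by rw [mul_assoc, (MulOpposite.unop c).2.2]⟩⟩

instance : Module (CornerRing g hg)ᵐᵒᵖ (CornerPiece f g) where
  one_smul x := Subtype.ext x.2.2
  mul_smul c d x := Subtype.ext (by
    change x.1 * ((MulOpposite.unop d).1 * (MulOpposite.unop c).1)
      = x.1 * (MulOpposite.unop d).1 * (MulOpposite.unop c).1
    rw [mul_assoc])
  smul_zero c := Subtype.ext (zero_mul _)
  smul_add c x y := Subtype.ext (add_mul _ _ _)
  add_smul c d x := Subtype.ext (mul_add _ _ _)
  zero_smul x := Subtype.ext (mul_zero _)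

end CornerPiece

/-- `C` is a Cartan matrix of the ring `A` with respect to the complete family `f` of
pairwise orthogonal primitive idempotents if the `(i,j)` entry of `C` is the length of
`f j • A • f i` as a right module over the corner ring `f i • A • f i`. -/
def IsCartanMatrix (A : Type*) [Ring A] {n : ℕ} (f : Fin n → A)
    (hf : ∀ i, IsIdempotentElem (f i)) (C : Matrix (Fin n) (Fin n) ℤ) : Prop :=
  ∀ i j, ∃ s : CompositionSeries
      (Submodule (CornerRing (f i) (hf i))ᵐᵒᵖ (CornerPiece (f j) (f i))),
    s.head = ⊥ ∧ s.last = ⊤ ∧ (s.length : ℤ) = C i j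
set_option linter.unusedVariables false
set_option linter.unusedSectionVars false
set_option maxHeartbeats 1000000
open CategoryTheory CategoryTheory.Abelian
open scoped DirectSum

noncomputable section
namespace CDR
open CategoryTheory.Limits DerivedCategory

universe w v u

section GradedHom
variable {C : Type u} [Category.{v} C] [Abelian C] [HasExt.{w} C] [HasDerivedCategory.{w} C]

/-- The stalk complex of an object, in the derived category. -/
abbrev stk (X : C) : DerivedCategory C := (singleFunctor C 0).obj X

/-- The total graded Hom from `M` to the stalk complex of `S`. -/
def VMod (M : DerivedCategory C) (S : C) : Type w :=
  ⨁ k : ℤ, ShiftedHom M (stk S) k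

instance (M : DerivedCategory C) (S : C) : AddCommGroup (VMod M S) :=
  inferInstanceAs (AddCommGroup (⨁ k : ℤ, ShiftedHom M (stk S) k))

variable {S : C} {M M' : DerivedCategory C}

/-- Homogeneous elements. -/
def vof (k : ℤ) : ShiftedHom M (stk S) k →+ VMod M S := DirectSum.of _ k

/-- Homogeneous elements of the Ext-ring. -/
def yof (j : ℕ) : Ext S S j →+ ExtRing S := DirectSum.of (fun i : ℕ => Ext S S i) j

lemma yof_mul (i j : ℕ) (a : Ext S S i) (b : Ext S S j) :
    yof i a * yof j b = yof (i + j) (a.comp b rfl) :=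
  letI := ExtYoneda.gring S
  DirectSum.of_mul_of (A := fun i : ℕ => Ext S S i) a b

lemma yof_one : (1 : ExtRing S) = yof 0 (Ext.mk₀ (𝟙 S)) := rfl

lemma vof_comp_eq {k : ℤ} {j : ℕ} {c c' : ℤ} (x : ShiftedHom M (stk S) k) (a : Ext S S j)
    (h : (j : ℤ) + k = c) (h' : (j : ℤ) + k = c') :
    (vof c (x.comp a.hom h) : VMod M S) = vof c' (x.comp a.hom h') := by
  subst h; subst h'; rfl

lemma vof_cast {k k' : ℤ} (h : k = k') (x : ShiftedHom M (stk S) k) :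
    (vof k x : VMod M S) = vof k' (h ▸ x) := by
  subst h; rfl

/-- auxiliary for the action -/
def act1 {k : ℤ} (x : ShiftedHom M (stk S) k) : ExtRing S →+ VMod M S :=
  DirectSum.toAddMonoid (β := fun i : ℕ => Ext S S i) (fun j =>
    { toFun := fun a => vof ((j : ℤ) + k) (x.comp a.hom rfl)
      map_zero' := by rw [Ext.zero_hom, ShiftedHom.comp_zero, map_zero]
      map_add' := fun a b => by rw [Ext.add_hom, ShiftedHom.comp_add, map_add] })

lemma act1_yof {k : ℤ} (x : ShiftedHom M (stk S) k) (j : ℕ) (a : Ext S S j) :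
    act1 x (yof j a) = vof ((j : ℤ) + k) (x.comp a.hom rfl) := by
  exact DirectSum.toAddMonoid_of (β := fun i : ℕ => Ext S S i) _ j a

lemma yhom_ext {G : Type*} [AddCommGroup G] {f g : ExtRing S →+ G}
    (h : ∀ j (a : Ext S S j), f (yof j a) = g (yof j a)) : f = g :=
  DirectSum.addHom_ext (β := fun i : ℕ => Ext S S i) h

lemma vhom_ext {G : Type*} [AddCommGroup G] {f g : VMod M S →+ G}
    (h : ∀ j (a : ShiftedHom M (stk S) j), f (vof j a) = g (vof j a)) : f = g :=
  DirectSum.addHom_ext (β := fun k : ℤ => ShiftedHom M (stk S) k) h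

/-- The right action of the Ext-ring as a biadditive map. -/
def act : VMod M S →+ ExtRing S →+ VMod M S :=
  DirectSum.toAddMonoid (β := fun k : ℤ => ShiftedHom M (stk S) k) (fun k =>
    { toFun := fun x => act1 x
      map_zero' := by
        apply yhom_ext; intro j a
        rw [act1_yof, ShiftedHom.zero_comp, map_zero]; rfl
      map_add' := fun x y => by
        apply yhom_ext; intro j a
        rw [AddMonoidHom.add_apply]
        simp only [act1_yof, ShiftedHom.add_comp, map_add] })

lemma act_of {k : ℤ} (x : ShiftedHom M (stk S) k) (j : ℕ) (a : Ext S S j) :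
    act (vof k x) (yof j a) = vof ((j : ℤ) + k) (x.comp a.hom rfl) := by
  rw [← act1_yof]
  exact DFunLike.congr_fun
    (DirectSum.toAddMonoid_of (β := fun k : ℤ => ShiftedHom M (stk S) k) _ k x) (yof j a)

lemma act_one (x : VMod M S) : act x 1 = x := by
  have : (AddMonoidHom.flip act (1 : ExtRing S)) = AddMonoidHom.id (VMod M S) := by
    apply vhom_ext; intro k x
    rw [AddMonoidHom.flip_apply, yof_one, act_of, AddMonoidHom.id_apply]
    rw [vof_comp_eq x _ rfl (show ((0 : ℕ) : ℤ) + k = k by simp), Ext.mk₀_hom]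
    rw [CategoryTheory.Functor.map_id, ShiftedHom.comp_mk₀_id]
  exact DFunLike.congr_fun this x

lemma act_mul (x : VMod M S) (a b : ExtRing S) : act x (a * b) = act (act x a) b := by
  have h1 : ∀ (k : ℤ) (x : ShiftedHom M (stk S) k) (a b : ExtRing S),
      act (vof k x) (a * b) = act (act (vof k x) a) b := by
    intro k x a b
    have : (AddMonoidHom.compr₂ (AddMonoidHom.mul) (act (vof k x))) =
        (act.comp (act (vof k x)) : ExtRing S →+ ExtRing S →+ VMod M S) := by
      apply yhom_ext; intro i a
      apply yhom_ext; intro j b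
      change act (vof k x) (yof i a * yof j b) = act (act (vof k x) (yof i a)) (yof j b)
      rw [yof_mul, act_of, act_of, act_of, Ext.comp_hom]
      have h := ShiftedHom.comp_assoc x a.hom b.hom (rfl : (i : ℤ) + k = _)
        (show (j : ℤ) + i = ((i + j : ℕ) : ℤ) by push_cast; ring)
        (show (j : ℤ) + i + k = ((i + j : ℕ) : ℤ) + k by push_cast; ring)
      rw [← h]
      exact (vof_comp_eq _ _ _ _)
    exact DFunLike.congr_fun (DFunLike.congr_fun this a) b
  have : (AddMonoidHom.flip act (a * b)) = ((AddMonoidHom.flip act b).comp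
      (AddMonoidHom.flip act a) : VMod M S →+ VMod M S) := by
    apply vhom_ext; intro k x
    exact h1 k x a b
  exact DFunLike.congr_fun this x

instance : Module (ExtRing S)ᵐᵒᵖ (VMod M S) where
  smul r x := act x r.unop
  one_smul x := act_one x
  mul_smul a b x := act_mul x b.unop a.unop
  smul_zero a := by change act 0 _ = 0; simp
  smul_add a x y := by change act (x + y) _ = act x _ + act y _; simp
  add_smul a b x := by change act x (a + b).unop = act x _ + act x _; simp
  zero_smul x := by change act x 0 = 0; simp

lemma smul_def (r : (ExtRing S)ᵐᵒᵖ) (x : VMod M S) : r • x = act x r.unop := rfl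

/-- Functoriality. -/
def vmapAdd (φ : M ⟶ M') : VMod M' S →+ VMod M S :=
  DirectSum.toAddMonoid (β := fun k : ℤ => ShiftedHom M' (stk S) k) (fun k =>
    { toFun := fun x => vof k (φ ≫ x)
      map_zero' := by simp
      map_add' := fun x y => by simp })

lemma vmapAdd_of (φ : M ⟶ M') (k : ℤ) (x : ShiftedHom M' (stk S) k) :
    vmapAdd φ (vof k x) = vof k (φ ≫ x) := by
  exact DirectSum.toAddMonoid_of (β := fun k : ℤ => ShiftedHom M' (stk S) k) _ k x

/-- Functoriality, linear version. -/
def vmap (φ : M ⟶ M') : VMod M' S →ₗ[(ExtRing S)ᵐᵒᵖ] VMod M S where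
  toFun := vmapAdd φ
  map_add' := map_add _
  map_smul' r x := by
    induction r using MulOpposite.rec' with | _ r => ?_
    change vmapAdd φ (act x r) = act (vmapAdd φ x) r
    have : (AddMonoidHom.compr₂ act (vmapAdd φ)) =
        (act.comp (vmapAdd φ) : VMod M' S →+ ExtRing S →+ VMod M S) := by
      apply vhom_ext; intro k x
      apply yhom_ext; intro i a
      change vmapAdd φ (act (vof k x) (yof i a)) = act (vmapAdd φ (vof k x)) (yof i a)
      rw [act_of, vmapAdd_of, vmapAdd_of, act_of]
      simp [ShiftedHom.comp]
    exact DFunLike.congr_fun (DFunLike.congr_fun this x) r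

lemma vmap_of (φ : M ⟶ M') (k : ℤ) (x : ShiftedHom M' (stk S) k) :
    vmap φ (vof k x) = vof k (φ ≫ x) := vmapAdd_of φ k x

lemma vmod_induction {p : VMod M S → Prop} (x : VMod M S) (h0 : p 0)
    (hof : ∀ k y, p (vof k y)) (hadd : ∀ x y, p x → p y → p (x + y)) : p x :=
  DirectSum.induction_on (β := fun k : ℤ => ShiftedHom M (stk S) k) x h0 hof hadd

lemma extring_induction {p : ExtRing S → Prop} (x : ExtRing S) (h0 : p 0)
    (hof : ∀ k y, p (yof k y)) (hadd : ∀ x y, p x → p y → p (x + y)) : p x :=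
  DirectSum.induction_on (β := fun k : ℕ => Ext S S k) x h0 hof hadd

/-- homogeneous component -/
def vcomp (k : ℤ) : VMod M S →+ ShiftedHom M (stk S) k :=
  DFinsupp.evalAddMonoidHom k

lemma vcomp_of_same (k : ℤ) (x : ShiftedHom M (stk S) k) : vcomp k (vof k x) = x :=
  DirectSum.of_eq_same (β := fun k : ℤ => ShiftedHom M (stk S) k) k x

lemma vcomp_of_ne {k l : ℤ} (h : l ≠ k) (x : ShiftedHom M (stk S) l) : vcomp k (vof l x) = 0 :=
  DirectSum.of_eq_of_ne (β := fun k : ℤ => ShiftedHom M (stk S) k) l k x (Ne.symm h)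

lemma vmod_ext {x y : VMod M S} (h : ∀ k, vcomp k x = vcomp k y) : x = y :=
  DFinsupp.ext h

lemma vcomp_vmap (φ : M ⟶ M') (k : ℤ) (x : VMod M' S) :
    vcomp k (vmap φ x) = φ ≫ vcomp k x := by
  induction x using vmod_induction with
  | h0 => simp
  | hadd x y hx hy => simp [hx, hy]
  | hof l y =>
    rw [vmap_of]
    by_cases h : l = k
    · subst h; rw [vcomp_of_same, vcomp_of_same]
    · rw [vcomp_of_ne h, vcomp_of_ne h]; simp

lemma vof_injective (k : ℤ) : Function.Injective (vof k : ShiftedHom M (stk S) k →+ VMod M S) :=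
  fun x y h => by rw [← vcomp_of_same k x, h, vcomp_of_same]

lemma vsum_mem {P : AddSubgroup (VMod M S)} (x : VMod M S) (h : ∀ k, vof k (vcomp k x) ∈ P) :
    x ∈ P := by
  classical
  rw [← DirectSum.sum_support_of (β := fun k : ℤ => ShiftedHom M (stk S) k) x]
  exact P.sum_mem (fun k _ => h k)

end GradedHom
end CDR
end

noncomputable section
namespace CDR
open CategoryTheory.Limits DerivedCategory

universe w v u

/-- A ring as a right module over itself. -/
def opSelfEquiv (B : Type*) [Ring B] : Bᵐᵒᵖ ≃ₗ[Bᵐᵒᵖ] B where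
  toFun := MulOpposite.unop
  invFun := MulOpposite.op
  left_inv _ := rfl
  right_inv _ := rfl
  map_add' _ _ := rfl
  map_smul' _ _ := rfl

section Cells
variable {C : Type u} [Category.{v} C] [Abelian C] [HasExt.{w} C] [HasDerivedCategory.{w} C]

/-- shifted stalk -/
abbrev sstk (X : C) (k : ℤ) : DerivedCategory C := (stk X)⟦k⟧

/-- morphism between shifted stalks -/
abbrev smap {X Y : C} (f : X ⟶ Y) (k : ℤ) : sstk X k ⟶ sstk Y k :=
  ((singleFunctor C 0).map f)⟦k⟧'

lemma sstk_isLE (X : C) (a : ℤ) : TStructure.t.IsLE (sstk X a) (-a) :=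
  TStructure.t.isLE_shift (stk X) 0 a (-a) (by lia)

lemma sstk_isGE (X : C) (a : ℤ) : TStructure.t.IsGE (sstk X a) (-a) :=
  TStructure.t.isGE_shift (stk X) 0 a (-a) (by lia)

lemma sstk_hom_neg {X Y : C} {a b : ℤ} (h : b < a) (f : sstk X a ⟶ sstk Y b) : f = 0 := by
  have := sstk_isLE X a
  have := sstk_isGE Y b
  exact TStructure.t.zero f (-a) (-b) (by lia)

lemma smap_surj {X Y : C} {a : ℤ} (z : sstk X a ⟶ sstk Y a) : ∃ u : X ⟶ Y, z = smap u a := by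
  obtain ⟨z', hz⟩ := (shiftFunctor (DerivedCategory C) a).map_surjective z
  obtain ⟨u, hu⟩ := (singleFunctor C 0).map_surjective z'
  exact ⟨u, by rw [← hz, ← hu]⟩

lemma shift_factor {X Y : C} {a b : ℤ} {j : ℕ} (h : (j : ℤ) + a = b) (z : sstk X a ⟶ sstk Y b) :
    ∃ e : Ext X Y j, z = e.hom⟦a⟧' ≫
      (shiftFunctorAdd' (DerivedCategory C) (j : ℤ) a b h).inv.app _ := by
  obtain ⟨z', hz⟩ := (shiftFunctor (DerivedCategory C) a).map_surjective
    (z ≫ (shiftFunctorAdd' (DerivedCategory C) (j : ℤ) a b h).hom.app _)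
  obtain ⟨e, he⟩ := Ext.homEquiv.surjective z'
  refine ⟨e, ?_⟩
  change e.hom = z' at he
  rw [he, hz]
  simp

lemma comp_sstk_eq {S : C} {M : DerivedCategory C} {a b : ℤ} {j : ℕ} (h : (j : ℤ) + a = b)
    (q : M ⟶ sstk S a) (z : sstk S a ⟶ sstk S b) :
    ∃ e : Ext S S j, (vof b (q ≫ z) : VMod M S) = act (vof a q) (yof j e) := by
  obtain ⟨e, rfl⟩ := shift_factor h z
  refine ⟨e, ?_⟩
  rw [act_of]
  exact vof_comp_eq q e h rfl

variable (S : C)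

/-- the comparison map from the free module -/
def freeMap (a : ℤ) : ExtRing S →ₗ[(ExtRing S)ᵐᵒᵖ] VMod (sstk S a) S where
  toFun y := act (vof a (𝟙 _)) y
  map_add' := map_add _
  map_smul' r y := by
    change act _ (y * r.unop) = act (act _ y) r.unop
    rw [act_mul]

lemma freeMap_surj (a : ℤ) : Function.Surjective (freeMap S a) := by
  intro x
  induction x using vmod_induction with
  | h0 => exact ⟨0, map_zero _⟩
  | hadd x y hx hy =>
    obtain ⟨x', rfl⟩ := hx
    obtain ⟨y', rfl⟩ := hy
    exact ⟨x' + y', map_add _ _ _⟩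
  | hof k z =>
    by_cases hk : k < a
    · exact ⟨0, by rw [map_zero, sstk_hom_neg hk z]; exact (map_zero _).symm⟩
    · obtain ⟨j, hj⟩ := Int.eq_ofNat_of_zero_le (show 0 ≤ k - a by lia)
      obtain ⟨e, he⟩ := comp_sstk_eq (M := sstk S a) (show (j : ℤ) + a = k by lia) (𝟙 _) z
      refine ⟨yof j e, ?_⟩
      rw [Category.id_comp] at he
      exact he.symm

/-- component of Ext ring -/
def ycomp (j : ℕ) : ExtRing S →+ Ext S S j := DFinsupp.evalAddMonoidHom j

lemma freeMap_comp (a : ℤ) (y : ExtRing S) (j : ℕ) :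
    vcomp ((j : ℤ) + a) (freeMap S a y) =
      ShiftedHom.comp (𝟙 (sstk S a) : ShiftedHom (sstk S a) (stk S) a) (ycomp S j y).hom rfl := by
  induction y using extring_induction with
  | h0 => simp [Ext.zero_hom]
  | hadd x y hx hy => rw [map_add, map_add, map_add, hx, hy, Ext.add_hom, ShiftedHom.comp_add]
  | hof k z =>
    change vcomp _ (act (vof a (𝟙 (sstk S a))) (yof k z)) = _
    rw [act_of]
    by_cases h : k = j
    · subst h
      rw [vcomp_of_same]
      congr 2
      exact (DirectSum.of_eq_same (β := fun k : ℕ => Ext S S k) k z).symm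
    · rw [vcomp_of_ne (by lia)]
      have : ycomp S j (yof k z) = 0 :=
        DirectSum.of_eq_of_ne (β := fun k : ℕ => Ext S S k) k j z (Ne.symm h)
      rw [this, Ext.zero_hom, ShiftedHom.comp_zero]

lemma freeMap_inj (a : ℤ) : Function.Injective (freeMap S a) := by
  rw [injective_iff_map_eq_zero]
  intro y hy
  apply DFinsupp.ext
  intro j
  have h := freeMap_comp S a y j
  rw [hy, map_zero] at h
  have h2 : (ycomp S j y).hom⟦a⟧' = 0 := by
    unfold ShiftedHom.comp at h
    rw [Category.id_comp] at h
    have h3 := h.symm =≫ (shiftFunctorAdd' (DerivedCategory C) (j : ℤ) a _ rfl).hom.app _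
    simpa using h3
  have h3 : (ycomp S j y).hom = 0 := by
    apply (shiftFunctor (DerivedCategory C) a).map_injective
    rw [h2]; simp
  apply Ext.homEquiv.injective
  change (ycomp S j y).hom = (0 : Ext S S j).hom
  rw [h3, Ext.zero_hom]

lemma vmod_sstk_projective (a : ℤ) : Module.Projective (ExtRing S)ᵐᵒᵖ (VMod (sstk S a) S) := by
  have : Module.Projective (ExtRing S)ᵐᵒᵖ (ExtRing S) :=
    Module.Projective.of_equiv (opSelfEquiv (ExtRing S))
  exact Module.Projective.of_equiv (LinearEquiv.ofBijective (freeMap S a)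
    ⟨freeMap_inj S a, freeMap_surj S a⟩)

end Cells
end CDR
end

noncomputable section
namespace CDR
open CategoryTheory.Limits DerivedCategory

universe w v u

section Cover
variable {C : Type u} [Category.{v} C] [Abelian C] [HasExt.{w} C] [HasDerivedCategory.{w} C]

/-- A decomposition of a semisimple object `S` into simple pieces `T i`. -/
structure SSDec (S : C) (ι : Type) [Fintype ι] where
  T : ι → C
  inc : ∀ i, T i ⟶ S
  proj : ∀ i, S ⟶ T i
  inc_proj : ∀ i, inc i ≫ proj i = 𝟙 _
  sum_proj_inc : ∑ i, proj i ≫ inc i = 𝟙 S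
  split : ∀ i (u : T i ⟶ S), u ≠ 0 → ∃ z : S ⟶ T i, u ≫ z = 𝟙 _

variable {S : C} {ι : Type} [Fintype ι] (D : SSDec S ι)

/-- A cell. -/
abbrev cell (p : ι × ℕ) : DerivedCategory C := sstk (D.T p.1) (p.2 : ℤ)

lemma cell_eq_id (p : ι × ℕ) : 𝟙 (cell D p) = smap (D.inc p.1) _ ≫ smap (D.proj p.1) _ := by
  rw [← Functor.map_comp, ← Functor.map_comp, D.inc_proj]; simp

/-- `M` has a cover by cells indexed by `α`. -/
def Covers (M : DerivedCategory C) {α : Type} [Fintype α] (c : α → ι × ℕ)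
    (v : ∀ a, M ⟶ cell D (c a)) : Prop :=
  ∀ (k : ℤ) (x : M ⟶ sstk S k), ∃ y : ∀ a, cell D (c a) ⟶ sstk S k, x = ∑ a, v a ≫ y a

lemma cover_minimal {M : DerivedCategory C} {α : Type} [Fintype α] {c : α → ι × ℕ}
    {v : ∀ a, M ⟶ cell D (c a)} (hv : Covers D M c v)
    (hmin : ∀ (β : Type) [Fintype β] (c' : β → ι × ℕ) (v' : ∀ b, M ⟶ cell D (c' b)),
      Covers D M c' v' → Fintype.card α ≤ Fintype.card β)
    {k : ℤ} (y : ∀ a, cell D (c a) ⟶ sstk S k) (hy : ∑ a, v a ≫ y a = 0) (b : α)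
    (hb : ((c b).2 : ℤ) = k) : y b = 0 := by
  classical
  by_contra hne
  have h : ∃ z : sstk S k ⟶ cell D (c b), y b ≫ z = 𝟙 _ := by
    clear hy
    subst hb
    obtain ⟨u, hu⟩ := smap_surj (y b)
    have hu0 : u ≠ 0 := by
      rintro rfl
      apply hne; rw [hu]
      exact (congrArg _ (Functor.map_zero _ _ _)).trans (Functor.map_zero _ _ _)
    obtain ⟨z, hz⟩ := D.split _ u hu0
    refine ⟨smap z _, ?_⟩
    rw [hu, ← Functor.map_comp, ← Functor.map_comp, hz]; simp
  obtain ⟨z, hz⟩ := h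
  have hcard := hmin {a // a ≠ b} (fun a => c a.1) (fun a => v a.1) ?_
  · have : Fintype.card {a // a ≠ b} < Fintype.card α :=
      Fintype.card_subtype_lt (x := b) (by simp)
    lia
  · intro l x
    obtain ⟨w, hw⟩ := hv l x
    have e1 : v b = - ∑ a : {a // a ≠ b}, v a.1 ≫ y a.1 ≫ z := by
      have := hy =≫ z
      rw [zero_comp, Preadditive.sum_comp,
        ← Fintype.sum_subtype_add_sum_subtype (fun a => a ≠ b)] at this
      have h2 : ∑ i : {x // ¬ x ≠ b}, (v i.1 ≫ y i.1) ≫ z = v b := by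
        rw [Fintype.sum_eq_single (⟨b, by simp⟩ : {x // ¬ x ≠ b})]
        · simp [hz]
        · rintro ⟨a, ha⟩ hab
          exact absurd (Subtype.ext (by simpa using ha)) hab
      rw [h2, add_comm] at this
      rw [eq_neg_of_add_eq_zero_left this]
      simp
    refine ⟨fun a => w a.1 - y a.1 ≫ z ≫ w b, ?_⟩
    rw [hw, ← Fintype.sum_subtype_add_sum_subtype (fun a => a ≠ b)]
    have h2 : ∑ i : {x // ¬ x ≠ b}, (v i.1 ≫ w i.1) = v b ≫ w b := by
      rw [Fintype.sum_eq_single (⟨b, by simp⟩ : {x // ¬ x ≠ b})]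
      rintro ⟨a, ha⟩ hab
      exact absurd (Subtype.ext (by simpa using ha)) hab
    rw [h2, e1]
    simp only [Preadditive.comp_sub, Finset.sum_sub_distrib, Preadditive.neg_comp,
      Preadditive.sum_comp, Category.assoc]
    abel

/-- the direct sum of cells -/
abbrev cellSum {α : Type} [Fintype α] (c : α → ι × ℕ) : DerivedCategory C :=
  ⨁ (fun a => cell D (c a))

lemma vmap_id (M : DerivedCategory C) : (vmap (𝟙 M) : VMod M S →ₗ[(ExtRing S)ᵐᵒᵖ] _) = LinearMap.id := by
  ext x
  apply vmod_ext; intro k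
  rw [vcomp_vmap]; simp

lemma vmap_comp {M N P : DerivedCategory C} (f : M ⟶ N) (g : N ⟶ P) :
    (vmap (f ≫ g) : VMod P S →ₗ[(ExtRing S)ᵐᵒᵖ] _) = vmap f ∘ₗ vmap g := by
  ext x
  apply vmod_ext; intro k
  rw [LinearMap.comp_apply, vcomp_vmap, vcomp_vmap, vcomp_vmap]; simp

lemma vmap_sum {M N : DerivedCategory C} {α : Type} [Fintype α] (f : α → (M ⟶ N)) :
    (vmap (∑ a, f a) : VMod N S →ₗ[(ExtRing S)ᵐᵒᵖ] _) = ∑ a, vmap (f a) := by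
  ext x
  apply vmod_ext; intro k
  rw [LinearMap.sum_apply, map_sum, vcomp_vmap, Preadditive.sum_comp]
  simp [vcomp_vmap]

lemma cell_projective (p : ι × ℕ) : Module.Projective (ExtRing S)ᵐᵒᵖ (VMod (cell D p) S) := by
  have := vmod_sstk_projective S (p.2 : ℤ)
  refine Module.Projective.of_split (vmap (smap (D.proj p.1) (p.2 : ℤ)))
    (vmap (smap (D.inc p.1) (p.2 : ℤ))) ?_
  rw [← vmap_comp, ← cell_eq_id, vmap_id]

lemma cellSum_projective {α : Type} [Fintype α] (c : α → ι × ℕ) :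
    Module.Projective (ExtRing S)ᵐᵒᵖ (VMod (cellSum D c) S) := by
  classical
  have : ∀ a, Module.Projective (ExtRing S)ᵐᵒᵖ (VMod (cell D (c a)) S) :=
    fun a => cell_projective D _
  refine Module.Projective.of_split (M := Π₀ a, VMod (cell D (c a)) S)
    (∑ a, (DFinsupp.lsingle a) ∘ₗ (vmap (biproduct.ι (fun a => cell D (c a)) a)))
    (DFinsupp.lsum ℕ (fun a => vmap (biproduct.π (fun a => cell D (c a)) a))) ?_
  rw [← vmap_id (cellSum D c), ← biproduct.total, vmap_sum]
  ext x
  simp [vmap_comp]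

end Cover
end CDR
end

noncomputable section
namespace CDR
open CategoryTheory.Limits DerivedCategory

universe w v u

section Tri
open Pretriangulated
variable {T : Type*} [Category T] [HasZeroObject T] [HasShift T ℤ] [Preadditive T]
  [∀ n : ℤ, (shiftFunctor T n).Additive] [Pretriangulated T]
variable {M X N : T} {v : M ⟶ X} {w : X ⟶ N} {δ : N ⟶ M⟦(1 : ℤ)⟧}
  (hT : Triangle.mk v w δ ∈ distinguishedTriangles (C := T))

lemma tri_comp12 (hT : Triangle.mk v w δ ∈ distinguishedTriangles (C := T)) : v ≫ w = 0 :=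
  comp_distTriang_mor_zero₁₂ _ hT

lemma tri_comp23 (hT : Triangle.mk v w δ ∈ distinguishedTriangles (C := T)) : w ≫ δ = 0 :=
  comp_distTriang_mor_zero₂₃ _ hT

lemma tri_comp31 (hT : Triangle.mk v w δ ∈ distinguishedTriangles (C := T)) :
    δ ≫ v⟦(1 : ℤ)⟧' = 0 :=
  comp_distTriang_mor_zero₃₁ _ hT

lemma tri_yo2 (hT : Triangle.mk v w δ ∈ distinguishedTriangles (C := T)) {Z : T} (f : X ⟶ Z)
    (hf : v ≫ f = 0) : ∃ g : N ⟶ Z, f = w ≫ g :=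
  Triangle.yoneda_exact₂ _ hT f hf

lemma tri_yo3 (hT : Triangle.mk v w δ ∈ distinguishedTriangles (C := T)) {Z : T} (f : N ⟶ Z)
    (hf : w ≫ f = 0) : ∃ g : M⟦(1 : ℤ)⟧ ⟶ Z, f = δ ≫ g :=
  Triangle.yoneda_exact₃ _ hT f hf

lemma tri_yo1 (hT : Triangle.mk v w δ ∈ distinguishedTriangles (C := T)) {Z : T}
    (f : M⟦(1 : ℤ)⟧ ⟶ Z)
    (hf : δ ≫ f = 0) : ∃ g : X⟦(1 : ℤ)⟧ ⟶ Z, f = v⟦(1 : ℤ)⟧' ≫ g := by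
  obtain ⟨g, hg⟩ := Triangle.yoneda_exact₃ _ (rot_of_distTriang _ hT) f hf
  refine ⟨-g, ?_⟩
  rw [hg]
  exact (Preadditive.neg_comp _ _).trans (Preadditive.comp_neg _ _).symm

lemma tri_co2 (hT : Triangle.mk v w δ ∈ distinguishedTriangles (C := T)) {Z : T} (f : Z ⟶ X)
    (hf : f ≫ w = 0) : ∃ g : Z ⟶ M, f = g ≫ v :=
  Triangle.coyoneda_exact₂ _ hT f hf

lemma tri_co3 (hT : Triangle.mk v w δ ∈ distinguishedTriangles (C := T)) {Z : T} (f : Z ⟶ N)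
    (hf : f ≫ δ = 0) : ∃ g : Z ⟶ X, f = g ≫ w :=
  Triangle.coyoneda_exact₃ _ hT f hf

end Tri

section Tower
variable {C : Type u} [Category.{v} C] [Abelian C] [HasExt.{w} C] [HasDerivedCategory.{w} C]
variable {S : C} {ι : Type} [Fintype ι] (D : SSDec S ι)
variable (R : Type) [CommRing R] [Linear R C]

/-- finiteness condition -/
structure FinH (S : C) (M : DerivedCategory C) : Prop where
  fin : ∀ k : ℤ, Module.Finite R (M ⟶ sstk S k)
  neg : ∀ k : ℤ, k < 0 → ∀ x : M ⟶ sstk S k, x = 0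
  bdd : ∃ B : ℕ, ∀ k : ℤ, (B : ℤ) ≤ k → ∀ x : M ⟶ sstk S k, x = 0

lemma exists_cover {M : DerivedCategory C} (hM : FinH R S M) :
    ∃ (α : Type) (_ : Fintype α) (c : α → ι × ℕ) (v : ∀ a, M ⟶ cell D (c a)), Covers D M c v := by
  classical
  obtain ⟨B, hB⟩ := hM.bdd
  have hfin := fun k : ℤ => (hM.fin k).exists_fin
  choose n s hs using hfin
  refine ⟨(Σ k : Fin B, Fin (n k)) × ι, inferInstance, fun a => (a.2, a.1.1), fun a =>
    s _ a.1.2 ≫ smap (D.proj a.2) _, ?_⟩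
  intro k x
  by_cases h0 : k < 0
  · exact ⟨0, by rw [hM.neg k h0 x]; simp⟩
  by_cases h1 : (B : ℤ) ≤ k
  · exact ⟨0, by rw [hB k h1 x]; simp⟩
  obtain ⟨j, rfl⟩ := Int.eq_ofNat_of_zero_le (not_lt.1 h0)
  have hj : j < B := by lia
  have hx : x ∈ Submodule.span R (Set.range (s j)) := by rw [hs]; trivial
  obtain ⟨r, hr⟩ := (Submodule.mem_span_range_iff_exists_fun R).1 hx
  refine ⟨fun a => if h : (a.1.1 : ℕ) = j then
    (if h' : (h ▸ a.1.2 : Fin (n j)) = (h ▸ a.1.2 : Fin (n j)) then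
      r (h ▸ a.1.2) • smap (D.inc a.2) _ ≫ eqToHom (by simp only [h]) else 0) else 0, ?_⟩
  rw [Fintype.sum_prod_type, Fintype.sum_sigma, Fintype.sum_eq_single (⟨j, hj⟩ : Fin B)]
  · rw [← hr]
    refine Finset.sum_congr rfl (fun t _ => ?_)
    have e := congrArg (fun f => (smap f (j : ℤ))) D.sum_proj_inc
    have e' : ∑ i, smap (D.proj i) (j : ℤ) ≫ smap (D.inc i) (j : ℤ) = 𝟙 _ := by
      simp only [smap, Functor.map_sum, Functor.map_comp] at e
      rw [e, CategoryTheory.Functor.map_id, CategoryTheory.Functor.map_id]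
    simp only [dite_true, eqToHom_refl, Category.comp_id, Linear.comp_smul, ← Finset.smul_sum,
      Category.assoc, ← Preadditive.comp_sum]
    rw [e', Category.comp_id]
  · rintro ⟨k, hk⟩ hne
    have : k ≠ j := fun h => hne (Fin.ext h)
    simp [this]

lemma exists_minimal_cover {M : DerivedCategory C} (hM : FinH R S M) :
    ∃ (α : Type) (_ : Fintype α) (c : α → ι × ℕ) (v : ∀ a, M ⟶ cell D (c a)), Covers D M c v ∧
    (∀ (β : Type) [Fintype β] (c' : β → ι × ℕ) (v' : ∀ b, M ⟶ cell D (c' b)),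
      Covers D M c' v' → Fintype.card α ≤ Fintype.card β) := by
  classical
  have hex : ∃ n : ℕ, ∃ (α : Type) (_ : Fintype α) (c : α → ι × ℕ) (v : ∀ a, M ⟶ cell D (c a)),
      Covers D M c v ∧ Fintype.card α = n := by
    obtain ⟨α, i, c, v, h⟩ := exists_cover D R hM
    exact ⟨_, α, i, c, v, h, rfl⟩
  obtain ⟨α, i, c, v, h, hn⟩ := Nat.find_spec hex
  refine ⟨α, i, c, v, h, ?_⟩
  intro β iβ c' v' h'
  rw [hn]
  exact Nat.find_min' hex ⟨β, iβ, c', v', h', rfl⟩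

variable {M M' : DerivedCategory C} {α : Type} [Fintype α] {c : α → ι × ℕ}
  {v : M ⟶ cellSum D c} {w : cellSum D c ⟶ M'} {δ : M' ⟶ M⟦(1 : ℤ)⟧}

/-- `v` induces surjections on Hom to shifts of `S`. -/
def SurjS (S : C) {M X : DerivedCategory C} (v : M ⟶ X) : Prop :=
  ∀ (k : ℤ) (x : M ⟶ sstk S k), ∃ y : X ⟶ sstk S k, x = v ≫ y

lemma surjS_shift {X : DerivedCategory C} {v : M ⟶ X} (hv : SurjS S v) (k : ℤ)
    (x : M⟦(1 : ℤ)⟧ ⟶ sstk S k) : ∃ y : X⟦(1 : ℤ)⟧ ⟶ sstk S k, x = v⟦(1:ℤ)⟧' ≫ y := by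
  obtain ⟨x', hx'⟩ := (shiftFunctor (DerivedCategory C) (1 : ℤ)).map_surjective
    (x ≫ (shiftFunctorAdd' (DerivedCategory C) (k - 1) 1 k (by lia)).hom.app _)
  obtain ⟨y, hy⟩ := hv _ x'
  refine ⟨y⟦(1 : ℤ)⟧' ≫ (shiftFunctorAdd' (DerivedCategory C) (k - 1) 1 k (by lia)).inv.app _, ?_⟩
  rw [← Functor.map_comp_assoc, ← hy, hx']
  simp

lemma w_cancel {X : DerivedCategory C} {v : M ⟶ X} {w : X ⟶ M'}
    (hT : Pretriangulated.Triangle.mk v w δ ∈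
      Pretriangulated.distinguishedTriangles (C := DerivedCategory C))
    (hv : SurjS S v) (k : ℤ) (x : M' ⟶ sstk S k) (hx : w ≫ x = 0) : x = 0 := by
  obtain ⟨y, rfl⟩ := tri_yo3 hT x hx
  obtain ⟨z, rfl⟩ := surjS_shift hv k y
  have := tri_comp31 hT
  rw [reassoc_of% this, zero_comp]

lemma vses {X : DerivedCategory C} {v : M ⟶ X} {w : X ⟶ M'}
    (hT : Pretriangulated.Triangle.mk v w δ ∈
      Pretriangulated.distinguishedTriangles (C := DerivedCategory C))
    (hv : SurjS S v) :
    Function.Injective (vmap w : VMod M' S →ₗ[(ExtRing S)ᵐᵒᵖ] VMod X S) ∧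
    Function.Surjective (vmap v : VMod X S →ₗ[(ExtRing S)ᵐᵒᵖ] VMod M S) ∧
    Function.Exact (vmap w : VMod M' S →ₗ[(ExtRing S)ᵐᵒᵖ] VMod X S)
      (vmap v : VMod X S →ₗ[(ExtRing S)ᵐᵒᵖ] VMod M S) := by
  refine ⟨?_, ?_, ?_⟩
  · rw [injective_iff_map_eq_zero]
    intro x hx
    apply vmod_ext; intro k
    rw [map_zero]
    apply w_cancel hT hv
    rw [← vcomp_vmap, hx, map_zero]
  · intro x
    induction x using vmod_induction with
    | h0 => exact ⟨0, map_zero _⟩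
    | hadd x y hx hy =>
      obtain ⟨x', rfl⟩ := hx
      obtain ⟨y', rfl⟩ := hy
      exact ⟨x' + y', map_add _ _ _⟩
    | hof k z =>
      obtain ⟨y, rfl⟩ := hv k z
      exact ⟨vof k y, vmap_of _ _ _⟩
  · intro x
    constructor
    · intro hx
      change x ∈ (LinearMap.range (vmap w : VMod M' S →ₗ[(ExtRing S)ᵐᵒᵖ] VMod X S)).toAddSubgroup
      apply vsum_mem
      intro k
      have h0 : v ≫ vcomp k x = 0 := by rw [← vcomp_vmap, hx, map_zero]
      obtain ⟨y, hy⟩ := tri_yo2 hT (vcomp k x) h0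
      exact ⟨vof k y, by rw [vmap_of, hy]⟩
    · rintro ⟨y, rfl⟩
      rw [← LinearMap.comp_apply, ← vmap_comp]
      have : v ≫ w = 0 := tri_comp12 hT
      rw [this]
      apply vmod_ext; intro k
      rw [vcomp_vmap]; simp

end Tower
end CDR
end

noncomputable section
namespace CDR
open CategoryTheory.Limits DerivedCategory

universe w v u

section Tower2
variable {C : Type u} [Category.{v} C] [Abelian C] [HasExt.{w} C] [HasDerivedCategory.{w} C]
variable {S : C} {ι : Type} [Fintype ι] (D : SSDec S ι)

/-- span of products with elements of degree at least `m` -/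
def actGE {X : DerivedCategory C} (K : Set (VMod X S)) (m : ℕ) : AddSubgroup (VMod X S) :=
  AddSubgroup.closure {y | ∃ x ∈ K, ∃ (j : ℕ) (a : Ext S S j), m ≤ j ∧ y = act x (yof j a)}

lemma actGE_zero_of_nilp {X : DerivedCategory C} (K : Submodule (ExtRing S)ᵐᵒᵖ (VMod X S))
    (h1 : ∀ x ∈ K, x ∈ actGE (K : Set (VMod X S)) 1) (n : ℕ)
    (hvan : ∀ j : ℕ, n < j → ∀ a : Ext S S j, a = 0) (x : VMod X S) (hx : x ∈ K) : x = 0 := by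
  have hm : ∀ m : ℕ, ∀ x ∈ K, x ∈ actGE (K : Set (VMod X S)) (m + 1) := by
    intro m
    induction m with
    | zero => exact h1
    | succ m ih =>
      intro x hx
      replace hx := ih x hx
      induction hx using AddSubgroup.closure_induction with
      | zero => exact AddSubgroup.zero_mem _
      | add x y _ _ hx hy => exact AddSubgroup.add_mem _ hx hy
      | neg x _ hx => exact AddSubgroup.neg_mem _ hx
      | mem y hy =>
        obtain ⟨z, hz, j, a, hj, rfl⟩ := hy
        have hz1 := h1 z hz
        clear hz
        induction hz1 using AddSubgroup.closure_induction with
        | zero => rw [map_zero]; exact AddSubgroup.zero_mem _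
        | add x y _ _ hx hy => rw [map_add]; exact AddSubgroup.add_mem _ hx hy
        | neg x _ hx => rw [map_neg]; exact AddSubgroup.neg_mem _ hx
        | mem y hy =>
          obtain ⟨z, hz, l, b, hl, rfl⟩ := hy
          rw [← act_mul, yof_mul]
          exact AddSubgroup.subset_closure ⟨z, hz, _, _, by lia, rfl⟩
  replace hx := hm n x hx
  induction hx using AddSubgroup.closure_induction with
  | zero => rfl
  | add x y _ _ hx hy => rw [hx, hy, add_zero]
  | neg x _ hx => rw [hx, neg_zero]
  | mem y hy =>
    obtain ⟨z, hz, l, b, hl, rfl⟩ := hy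
    rw [hvan l (by lia) b, map_zero, map_zero]

lemma projective_kernel_zero {M M' : DerivedCategory C} {α : Type} [Fintype α] {c : α → ι × ℕ}
    {v : M ⟶ cellSum D c} {w : cellSum D c ⟶ M'} {δ : M' ⟶ M⟦(1 : ℤ)⟧}
    (hT : Pretriangulated.Triangle.mk v w δ ∈
      Pretriangulated.distinguishedTriangles (C := DerivedCategory C))
    (hv : SurjS S v)
    (hmin : ∀ (k : ℤ) (y : cellSum D c ⟶ sstk S k), v ≫ y = 0 → ∀ b, ((c b).2 : ℤ) = k →
      biproduct.ι _ b ≫ y = 0)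
    (n : ℕ) (hvan : ∀ j : ℕ, n < j → ∀ a : Ext S S j, a = 0)
    (hproj : Module.Projective (ExtRing S)ᵐᵒᵖ (VMod M S)) (x : VMod M' S) : x = 0 := by
  classical
  obtain ⟨hinj, hsurj, hex⟩ := vses hT hv
  obtain ⟨s, hs⟩ := Module.projective_lifting_property (vmap v) (LinearMap.id) hsurj
  let K := LinearMap.ker (vmap v : VMod (cellSum D c) S →ₗ[(ExtRing S)ᵐᵒᵖ] VMod M S)
  let t : VMod (cellSum D c) S →ₗ[(ExtRing S)ᵐᵒᵖ] VMod (cellSum D c) S :=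
    LinearMap.id - s ∘ₗ vmap v
  have htK : ∀ z, t z ∈ K := by
    intro z
    have := LinearMap.congr_fun hs (vmap v z)
    simp only [LinearMap.comp_apply, LinearMap.id_apply] at this
    simp [t, K, this]
  have htid : ∀ z ∈ K, t z = z := by
    intro z hz
    have : vmap v z = 0 := hz
    simp [t, this]
  have hQ : ∀ z ∈ K, z ∈ actGE (Set.univ : Set (VMod (cellSum D c) S)) 1 := by
    intro z hz
    apply vsum_mem
    intro k
    have h0 : v ≫ vcomp k z = 0 := by
      rw [← vcomp_vmap, show vmap v z = 0 from hz, map_zero]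
    have hm := hmin k (vcomp k z) h0
    have e : vcomp k z = ∑ b, biproduct.π (fun a => cell D (c a)) b ≫
        (biproduct.ι (fun a => cell D (c a)) b ≫ vcomp k z) := by
      simp only [← Category.assoc]
      rw [← Preadditive.sum_comp, biproduct.total, Category.id_comp]
    rw [e, map_sum]
    refine AddSubgroup.sum_mem _ (fun b _ => ?_)
    rcases lt_trichotomy k ((c b).2 : ℤ) with h | h | h
    · rw [sstk_hom_neg h (biproduct.ι (fun a => cell D (c a)) b ≫ vcomp k z), comp_zero, map_zero]
      exact AddSubgroup.zero_mem _
    · rw [hm b h.symm, comp_zero, map_zero]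
      exact AddSubgroup.zero_mem _
    · obtain ⟨j, hj⟩ := Int.eq_ofNat_of_zero_le (show 0 ≤ k - (c b).2 by lia)
      obtain ⟨e', he'⟩ := comp_sstk_eq (M := cellSum D c) (show (j : ℤ) + (c b).2 = k by lia)
        (biproduct.π (fun a => cell D (c a)) b ≫ smap (D.inc (c b).1) _)
        (smap (D.proj (c b).1) _ ≫ biproduct.ι (fun a => cell D (c a)) b ≫ vcomp k z)
      have e2 := cell_eq_id D (c b)
      rw [Category.assoc, ← Category.assoc (smap (D.inc (c b).1) _), ← e2, Category.id_comp] at he'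
      rw [he']
      exact AddSubgroup.subset_closure ⟨_, trivial, j, e', by lia, rfl⟩
  have hK1 : ∀ z ∈ K, z ∈ actGE (K : Set (VMod (cellSum D c) S)) 1 := by
    intro z hz
    rw [← htid z hz]
    replace hz := hQ z hz
    induction hz using AddSubgroup.closure_induction with
    | zero => rw [map_zero]; exact AddSubgroup.zero_mem _
    | add x y _ _ hx hy => rw [map_add]; exact AddSubgroup.add_mem _ hx hy
    | neg x _ hx => rw [map_neg]; exact AddSubgroup.neg_mem _ hx
    | mem y hy =>
      obtain ⟨z, -, j, a, hj, rfl⟩ := hy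
      have : t (act z (yof j a)) = act (t z) (yof j a) :=
        t.map_smul (MulOpposite.op (yof j a)) z
      rw [this]
      exact AddSubgroup.subset_closure ⟨_, htK z, j, a, hj, rfl⟩
  have hK0 := actGE_zero_of_nilp K hK1 n hvan
  apply hinj
  rw [map_zero]
  apply hK0
  exact (hex _).2 ⟨x, rfl⟩

variable (R : Type) [CommRing R] [Linear R C]

lemma finite_shift (X Y : C) (a b : ℤ)
    (h : ∀ k : ℤ, Module.Finite R (stk X ⟶ sstk Y k)) : Module.Finite R (sstk X a ⟶ sstk Y b) := by
  let φ : (stk X ⟶ sstk Y (b - a)) →ₗ[R] (sstk X a ⟶ sstk Y b) :=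
    { toFun := fun f => f⟦a⟧' ≫ (shiftFunctorAdd' (DerivedCategory C) (b - a) a b (by lia)).inv.app _
      map_add' := by intro f g; simp
      map_smul' := by intro r f; simp [Functor.map_smul] }
  have := h (b - a)
  refine Module.Finite.of_surjective φ ?_
  intro z
  obtain ⟨z', hz⟩ := (shiftFunctor (DerivedCategory C) a).map_surjective
    (z ≫ (shiftFunctorAdd' (DerivedCategory C) (b - a) a b (by lia)).hom.app _)
  refine ⟨z', ?_⟩
  change z'⟦a⟧' ≫ _ = z
  rw [hz]; simp

lemma cell_bdd (n : ℕ) (hvan : ∀ j : ℕ, n < j → ∀ a : Ext S S j, a = 0) (p : ι × ℕ) (k : ℤ)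
    (hk : n + p.2 < k) (x : cell D p ⟶ sstk S k) : x = 0 := by
  obtain ⟨j, hj⟩ := Int.eq_ofNat_of_zero_le (show 0 ≤ k - p.2 by lia)
  obtain ⟨e, he⟩ := shift_factor (show (j : ℤ) + p.2 = k by lia) (smap (D.proj p.1) _ ≫ x)
  have : x = smap (D.inc p.1) _ ≫ smap (D.proj p.1) _ ≫ x := by
    rw [← Category.assoc, ← cell_eq_id, Category.id_comp]
  rw [this, he, hvan j (by lia) e, Ext.zero_hom]
  simp

lemma cellSum_finH (n : ℕ) (hvan : ∀ j : ℕ, n < j → ∀ a : Ext S S j, a = 0)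
    (hfin : ∀ i k, Module.Finite R (stk (D.T i) ⟶ sstk S k))
    {α : Type} [Fintype α] (c : α → ι × ℕ) : FinH R S (cellSum D c) := by
  classical
  refine ⟨fun k => ?_, fun k hk x => ?_, ?_⟩
  · have := fun a => finite_shift R (D.T (c a).1) S (c a).2 k (hfin _)
    let ψ : (∀ a, cell D (c a) ⟶ sstk S k) →ₗ[R] (cellSum D c ⟶ sstk S k) :=
      { toFun := fun f => biproduct.desc f
        map_add' := by intro f g; ext; simp
        map_smul' := by intro r f; ext; simp }
    refine Module.Finite.of_surjective ψ (fun f =>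
      ⟨fun a => biproduct.ι (fun a => cell D (c a)) a ≫ f, ?_⟩)
    change biproduct.desc (fun a => biproduct.ι (fun a => cell D (c a)) a ≫ f) = f
    ext; simp
  · apply biproduct.hom_ext'
    intro a
    rw [comp_zero]
    exact sstk_hom_neg (by lia) _
  · refine ⟨∑ a, (c a).2 + n + 1, fun k hk x => ?_⟩
    apply biproduct.hom_ext'
    intro a
    rw [comp_zero]
    apply cell_bdd D n hvan
    have := Finset.single_le_sum (f := fun a => (c a).2) (fun i _ => Nat.zero_le _)
      (Finset.mem_univ a)
    have h2 : ((c a).2 : ℤ) ≤ ((∑ a, (c a).2 : ℕ) : ℤ) := by exact_mod_cast this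
    push_cast at hk h2
    lia

/-- The tower lemma. -/
theorem tower [IsNoetherianRing R] (n : ℕ) (hvan : ∀ j : ℕ, n < j → ∀ a : Ext S S j, a = 0)
    (hfin : ∀ i k, Module.Finite R (stk (D.T i) ⟶ sstk S k))
    (P : DerivedCategory C → Prop)
    (hzero : ∀ N : DerivedCategory C, (∀ (k : ℤ) (x : N ⟶ sstk S k), x = 0) → P N)
    (hstep : ∀ (M M' : DerivedCategory C) {α : Type} [Fintype α] (c : α → ι × ℕ)
      (v : M ⟶ cellSum D c) (w : cellSum D c ⟶ M') (δ : M' ⟶ M⟦(1 : ℤ)⟧),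
      Pretriangulated.Triangle.mk v w δ ∈
        Pretriangulated.distinguishedTriangles (C := DerivedCategory C) →
      SurjS S v → FinH R S M → FinH R S M' → P M' → P M)
    (d : ℕ) : ∀ (M : DerivedCategory C), FinH R S M →
      HasProjectiveDimensionLT (ModuleCat.of (ExtRing S)ᵐᵒᵖ (VMod M S)) d → P M := by
  classical
  induction d with
  | zero =>
    intro M hM hd
    apply hzero
    intro k x
    have hz := isZero_of_hasProjectiveDimensionLT_zero
      (ModuleCat.of (ExtRing S)ᵐᵒᵖ (VMod M S))
    have := ModuleCat.subsingleton_of_isZero hz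
    exact vof_injective k (Subsingleton.elim (α := VMod M S) _ _)
  | succ d ih =>
    intro M hM hd
    obtain ⟨α, _, c, v0, hv0, hmin⟩ := exists_minimal_cover D R hM
    let v : M ⟶ cellSum D c := biproduct.lift v0
    obtain ⟨M', w, δ, hT⟩ := Pretriangulated.distinguished_cocone_triangle v
    have hv : SurjS S v := by
      intro k x
      obtain ⟨y, rfl⟩ := hv0 k x
      exact ⟨biproduct.desc y, by simp [v, biproduct.lift_desc]⟩
    have hmin' : ∀ (k : ℤ) (y : cellSum D c ⟶ sstk S k), v ≫ y = 0 → ∀ b, ((c b).2 : ℤ) = k →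
        biproduct.ι _ b ≫ y = 0 := by
      intro k y hy b hb
      refine cover_minimal D hv0 hmin (fun a => biproduct.ι (fun a => cell D (c a)) a ≫ y) ?_ b hb
      rw [← hy]
      have : y = biproduct.desc (fun a => biproduct.ι (fun a => cell D (c a)) a ≫ y) := by
        ext; simp
      conv_rhs => rw [this]
      simp [v, biproduct.lift_desc]
    have hX := cellSum_finH D R n hvan hfin c
    have hM' : FinH R S M' := by
      refine ⟨fun k => ?_, fun k hk x => ?_, ?_⟩
      · have := hX.fin k
        let φ : (M' ⟶ sstk S k) →ₗ[R] (cellSum D c ⟶ sstk S k) :=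
          { toFun := fun f => w ≫ f
            map_add' := by intro f g; simp
            map_smul' := by intro r f; simp }
        refine Module.Finite.of_injective φ ?_
        rw [injective_iff_map_eq_zero]
        intro x hx
        exact w_cancel hT hv k x hx
      · exact w_cancel hT hv k x (hX.neg k hk _)
      · obtain ⟨B, hB⟩ := hX.bdd
        exact ⟨B, fun k hk x => w_cancel hT hv k x (hB k hk _)⟩
    refine hstep M M' c v w δ hT hv hM hM' ?_
    cases d with
    | zero =>
      have hp : Module.Projective (ExtRing S)ᵐᵒᵖ (VMod M S) := by
        rw [IsProjective.iff_projective]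
        exact projective_iff_hasProjectiveDimensionLT_one.2 hd
      apply hzero
      intro k x
      apply vof_injective k
      rw [map_zero]
      exact projective_kernel_zero D hT hv hmin' n hvan hp _
    | succ d =>
      apply ih M' hM'
      obtain ⟨hinj, hsurj, hex⟩ := vses hT hv
      have hXp := cellSum_projective D c
      rw [IsProjective.iff_projective] at hXp
      let T : ShortComplex (ModuleCat (ExtRing S)ᵐᵒᵖ) :=
        ShortComplex.mk (ModuleCat.ofHom (vmap w : VMod M' S →ₗ[(ExtRing S)ᵐᵒᵖ] _))
          (ModuleCat.ofHom (vmap v : _ →ₗ[(ExtRing S)ᵐᵒᵖ] VMod M S)) (by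
            ext x; exact (hex _).2 ⟨x, rfl⟩)
      have hTs : T.ShortExact :=
        { exact := (ShortComplex.ShortExact.moduleCat_exact_iff_function_exact T).2 hex
          mono_f := (ModuleCat.mono_iff_injective _).2 hinj
          epi_g := (ModuleCat.epi_iff_surjective _).2 hsurj }
      exact (hTs.hasProjectiveDimensionLT_X₃_iff d hXp).1 hd

end Tower2
end CDR
end

noncomputable section
namespace CDR
open CategoryTheory.Limits DerivedCategory

universe w v u w' v' u'

section ProjVan
variable {C : Type u} [Category.{v} C] [Abelian C] [HasExt.{w} C] [HasDerivedCategory.{w} C]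

lemma proj_van_zero (P : C) [Projective P] (Z : DerivedCategory C) (n : ℤ)
    (hZ : TStructure.t.IsLE Z n) (h : n < 0) (f : stk P ⟶ Z) : f = 0 := by
  obtain ⟨K, hK, ⟨e⟩⟩ := Z.exists_iso_Q_obj_of_isLE n
  let L := (HomologicalComplex.single C (ComplexShape.up ℤ) 0).obj P
  have : ∀ i : ℤ, Projective (L.X i) := by
    intro i
    by_cases hi : i = 0
    · subst hi
      exact Projective.of_iso (HomologicalComplex.singleObjXSelf (ComplexShape.up ℤ) 0 P).symm
        inferInstance
    · have := HomologicalComplex.isZero_single_obj_X (ComplexShape.up ℤ) 0 P i hi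
      exact Projective.of_iso this.isoZero.symm inferInstance
  have : CochainComplex.IsStrictlyLE L 0 := by
    rw [CochainComplex.isStrictlyLE_iff]
    intro i hi
    exact HomologicalComplex.isZero_single_obj_X (ComplexShape.up ℤ) 0 P i (by lia)
  have := CochainComplex.isKProjective_of_projective L 0
  let e' := (singleFunctorIsoCompQ C 0).app P
  have key : ∀ g : Q.obj L ⟶ Q.obj K, g = 0 := by
    intro g
    obtain ⟨g', hg'⟩ := (CochainComplex.IsKProjective.Qh_map_bijective L
      ((HomotopyCategory.quotient _ _).obj K)).surjective
      ((quotientCompQhIso C).hom.app L ≫ g ≫ (quotientCompQhIso C).inv.app K)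
    obtain ⟨c, rfl⟩ := (HomotopyCategory.quotient _ _).map_surjective g'
    have hc : c = 0 := by
      apply HomologicalComplex.Hom.ext
      funext i
      by_cases hi : i = 0
      · subst hi
        exact (CochainComplex.isZero_of_isStrictlyLE K n 0 (by lia)).eq_of_tgt _ _
      · exact (HomologicalComplex.isZero_single_obj_X (ComplexShape.up ℤ) 0 P i hi).eq_of_src _ _
    subst hc
    rw [CategoryTheory.Functor.map_zero, CategoryTheory.Functor.map_zero] at hg'
    rw [← cancel_mono ((quotientCompQhIso C).inv.app K),
      ← cancel_epi ((quotientCompQhIso C).hom.app L), ← hg']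
    simp
  have := key (e'.inv ≫ f ≫ e.hom)
  rw [← cancel_epi e'.inv, ← cancel_mono e.hom, Category.assoc, comp_zero, zero_comp]
  exact this

lemma proj_van (P : C) [Projective P] (a : ℤ) (Z : DerivedCategory C) (n : ℤ)
    (hZ : TStructure.t.IsLE Z n) (h : n < -a) (f : sstk P a ⟶ Z) : f = 0 := by
  apply (shiftFunctor (DerivedCategory C) (-a)).map_injective
  rw [CategoryTheory.Functor.map_zero]
  have := TStructure.t.isLE_shift Z n (-a) (n + a) (by lia)
  have := proj_van_zero P _ (n + a) this (by lia)
    ((shiftFunctorCompIsoId (DerivedCategory C) a (-a) (by lia)).inv.app (stk P) ≫ f⟦-a⟧')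
  rw [← cancel_epi ((shiftFunctorCompIsoId (DerivedCategory C) a (-a) (by lia)).inv.app (stk P)),
    this, comp_zero]

/-- Precomposition with an epimorphism of stalks is injective on maps to coconnective objects. -/
lemma epi_cancel {P H : C} (p : P ⟶ H) [Epi p] (a : ℤ) (Y : DerivedCategory C)
    (hY : TStructure.t.IsGE Y (-a)) (x : sstk H a ⟶ Y) (hx : smap p a ≫ x = 0) : x = 0 := by
  let Sh : ShortComplex C := ShortComplex.mk (kernel.ι p) p (kernel.condition p)
  have hS : Sh.ShortExact :=
    { exact := ShortComplex.exact_of_f_is_kernel _ (kernelIsKernel p) }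
  have hd := Pretriangulated.Triangle.shift_distinguished _ hS.singleTriangle_distinguished a
  obtain ⟨g, hg⟩ := Pretriangulated.Triangle.yoneda_exact₃ _ hd x (by
    change (a.negOnePow • (smap p a)) ≫ x = 0
    rw [Units.smul_def, Preadditive.zsmul_comp, hx, smul_zero])
  have h1 := sstk_isLE (kernel p) a
  have h2 := TStructure.t.isLE_shift (sstk (kernel p) a) (-a) 1 (-a - 1) (by lia)
  have : g = 0 := TStructure.t.zero (X := (sstk (kernel p) a)⟦(1 : ℤ)⟧) g (-a - 1) (-a) (by lia)
  rw [hg, this]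
  exact comp_zero

end ProjVan

section Step
variable {C : Type u} [Category.{v} C] [Abelian C] [HasExt.{w} C] [HasDerivedCategory.{w} C]
variable {S : C}

/-- orthogonality to `S` -/
def Orth (S : C) (N : DerivedCategory C) : Prop := ∀ (k : ℤ) (x : N ⟶ sstk S k), x = 0

lemma Orth.of_iso {N N' : DerivedCategory C} (e : N ≅ N') (h : Orth S N) : Orth S N' := by
  intro k x
  have := h k (e.hom ≫ x)
  rw [← cancel_epi e.hom, this, comp_zero]

/-- shift of shifted stalk -/
def sstkShift (X : C) (a b c : ℤ) (h : a + b = c) : (sstk X a)⟦b⟧ ≅ sstk X c :=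
  ((shiftFunctorAdd' (DerivedCategory C) a b c h).app (stk X)).symm

lemma proj_orth (P : C) [Projective P] (hP : ∀ f : P ⟶ S, f = 0) (a : ℤ) : Orth S (sstk P a) := by
  intro k x
  rcases lt_trichotomy k a with h | h | h
  · exact sstk_hom_neg h x
  · subst h
    obtain ⟨u, rfl⟩ := smap_surj x
    rw [hP u]
    simp [smap]
  · exact proj_van P a _ (-k) (sstk_isLE S k) (by lia) x

/-- stalk description of heart objects -/
lemma exists_sstk (B : DerivedCategory C) (m : ℤ) (h1 : TStructure.t.IsGE B m)
    (h2 : TStructure.t.IsLE B m) : ∃ H : C, Nonempty (B ≅ sstk H (-m)) := by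
  have h3 := TStructure.t.isGE_shift B m m 0 (by lia)
  have h4 := TStructure.t.isLE_shift B m m 0 (by lia)
  obtain ⟨H, ⟨e⟩⟩ := exists_iso_singleFunctor_obj_of_isGE_of_isLE (B⟦m⟧) 0
  exact ⟨H, ⟨(shiftFunctorCompIsoId (DerivedCategory C) m (-m) (by lia)).symm.app B ≪≫
    (shiftFunctor (DerivedCategory C) (-m)).mapIso e⟩⟩

lemma orth_step (N : DerivedCategory C) (m : ℤ) (hN : TStructure.t.IsLE N m) (hO : Orth S N)
    (p1 : C → Prop)
    (h1 : ∀ H : C, (∀ f : H ⟶ S, f = 0) → ∃ (P : C) (p : P ⟶ H), Epi p ∧ Projective P ∧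
      (∀ f : P ⟶ S, f = 0) ∧ p1 P) :
    ∃ (P : C) (N' : DerivedCategory C) (q : sstk P (-m) ⟶ N) (w : N ⟶ N')
      (δ : N' ⟶ (sstk P (-m))⟦(1 : ℤ)⟧),
      Pretriangulated.Triangle.mk q w δ ∈
        Pretriangulated.distinguishedTriangles (C := DerivedCategory C) ∧
      Projective P ∧ p1 P ∧ TStructure.t.IsLE N' (m - 1) ∧ Orth S N' := by
  obtain ⟨A, B, hA, hB, f, g, d, hT⟩ := TStructure.t.exists_triangle N (m - 1) m (by lia)
  have hA' : TStructure.t.IsLE A (m - 1) := ⟨hA⟩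
  have hB' : TStructure.t.IsGE B m := ⟨hB⟩
  have hA1 : TStructure.t.IsLE (A⟦(1 : ℤ)⟧) (m - 2) := TStructure.t.isLE_shift A (m - 1) 1 _ (by lia)
  have hBle : TStructure.t.IsLE B m :=
    TStructure.t.isLE₂ _ (Pretriangulated.rot_of_distTriang _ hT) m hN
      (TStructure.t.isLE_of_le (A⟦(1 : ℤ)⟧) (m - 2) m (by lia))
  obtain ⟨H, ⟨e⟩⟩ := exists_sstk B m hB' hBle
  have hHS : ∀ u : H ⟶ S, u = 0 := by
    intro u
    have h0 : g ≫ e.hom ≫ smap u (-m) = 0 := hO _ _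
    obtain ⟨y, hy⟩ := tri_yo3 hT _ h0
    have hy0 : y = 0 := by
      have := sstk_isGE S (-m)
      exact TStructure.t.zero (X := A⟦(1 : ℤ)⟧) y (m - 2) (- -m) (by lia)
    rw [hy0, comp_zero] at hy
    have h3 : smap u (-m) = 0 := by
      rw [← cancel_epi e.hom, hy, comp_zero]
    apply (singleFunctor C 0).map_injective
    apply (shiftFunctor (DerivedCategory C) (-m)).map_injective
    rw [CategoryTheory.Functor.map_zero, CategoryTheory.Functor.map_zero]
    exact h3
  obtain ⟨P, p, hp, hP, hPS, hp1⟩ := h1 H hHS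
  obtain ⟨q, hq⟩ := tri_co3 hT (smap p (-m) ≫ e.inv)
    (proj_van P (-m) _ (m - 2) hA1 (by lia) _)
  obtain ⟨N', w, δ, hT'⟩ := Pretriangulated.distinguished_cocone_triangle q
  have hP1 : Orth S ((sstk P (-m))⟦(1 : ℤ)⟧) :=
    (proj_orth P hPS (-m + 1)).of_iso (sstkShift P (-m) 1 _ rfl).symm
  have hPle := sstk_isLE P (-m)
  have hPle1 : TStructure.t.IsLE ((sstk P (-m))⟦(1 : ℤ)⟧) (m - 1) :=
    TStructure.t.isLE_shift (sstk P (-m)) (- -m) 1 _ (by lia)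
  refine ⟨P, N', q, w, δ, hT', hP, hp1, ?_, ?_⟩
  · rw [TStructure.t.isLE_iff_orthogonal (m - 1) m (by lia)]
    intro Y φ hY
    have h2 : f ≫ w ≫ φ = 0 := TStructure.t.zero _ (m - 1) m (by lia)
    obtain ⟨y, hy⟩ := tri_yo2 hT _ h2
    have h3 : e.inv ≫ y = 0 := by
      apply epi_cancel p (-m) Y (by simpa using hY)
      have := tri_comp12 hT'
      rw [← Category.assoc, hq, Category.assoc, ← hy, ← Category.assoc, this, zero_comp]
    have h4 : y = 0 := by rw [← cancel_epi e.inv, h3, comp_zero]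
    rw [h4, comp_zero] at hy
    obtain ⟨z, hz⟩ := tri_yo3 hT' _ hy
    rw [hz, TStructure.t.zero z (m - 1) m (by lia), comp_zero]
  · intro k x
    obtain ⟨z, hz⟩ := tri_yo3 hT' x (hO k _)
    rw [hz, hP1 k z, comp_zero]

end Step
end CDR
end

noncomputable section
namespace CDR
open CategoryTheory.Limits DerivedCategory

universe w v u w' v' u'

section FF
variable {C : Type u} [Category.{v} C] [Abelian C] [HasExt.{w} C] [HasDerivedCategory.{w} C]
variable {C' : Type u'} [Category.{v'} C'] [Abelian C'] [HasExt.{w'} C'] [HasDerivedCategory.{w'} C']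
variable (F : C ⥤ C') [F.Additive] [PreservesFiniteLimits F] [PreservesFiniteColimits F]

/-- image of a stalk -/
def fdIso (X : C) (k : ℤ) : F.mapDerivedCategory.obj (sstk X k) ≅ sstk (F.obj X) k :=
  (F.mapDerivedCategory.commShiftIso k).app (stk X) ≪≫
    (shiftFunctor (DerivedCategory C') k).mapIso ((F.mapDerivedCategorySingleFunctor 0).app X)

lemma fdIso_nat {X Y : C} (f : X ⟶ Y) (k : ℤ) :
    F.mapDerivedCategory.map (smap f k) ≫ (fdIso F Y k).hom =
      (fdIso F X k).hom ≫ smap (F.map f) k := by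
  have h1 := (F.mapDerivedCategory.commShiftIso k).hom.naturality ((singleFunctor C 0).map f)
  have h2 := (F.mapDerivedCategorySingleFunctor 0).hom.naturality f
  dsimp at h1 h2
  dsimp [fdIso, smap]
  rw [reassoc_of% h1, Category.assoc, ← CategoryTheory.Functor.map_comp,
    ← CategoryTheory.Functor.map_comp, h2]

lemma fd_isLE (N : DerivedCategory C) (m : ℤ) (hN : TStructure.t.IsLE N m) :
    TStructure.t.IsLE (F.mapDerivedCategory.obj N) m := by
  obtain ⟨K, hK, ⟨e⟩⟩ := N.exists_iso_Q_obj_of_isLE m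
  have : CochainComplex.IsStrictlyLE ((F.mapHomologicalComplex (ComplexShape.up ℤ)).obj K) m := by
    rw [CochainComplex.isStrictlyLE_iff]
    intro i hi
    exact F.map_isZero (CochainComplex.isZero_of_isStrictlyLE K m i (by lia))
  exact ⟨_, F.mapDerivedCategory.mapIso e ≪≫ F.mapDerivedCategoryFactors.app K, this⟩

/-- fully faithful on maps to stalks -/
def QGood (P : DerivedCategory C) : Prop :=
  ∀ (X : C) (k : ℤ), Function.Bijective
    (fun f : P ⟶ sstk X k => F.mapDerivedCategory.map f)

lemma QGood.of_iso {P P' : DerivedCategory C} (e : P ≅ P') (h : QGood F P) : QGood F P' := by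
  intro X k
  refine ⟨fun x y hxy => ?_, fun φ => ?_⟩
  · rw [← cancel_epi e.hom]
    apply (h X k).1
    simp only [CategoryTheory.Functor.map_comp] at hxy ⊢
    rw [hxy]
  · obtain ⟨x, hx⟩ := (h X k).2 (F.mapDerivedCategory.map e.hom ≫ φ)
    refine ⟨e.inv ≫ x, ?_⟩
    simp only [CategoryTheory.Functor.map_comp] at hx ⊢
    rw [hx, ← Category.assoc, ← CategoryTheory.Functor.map_comp, e.inv_hom_id,
      CategoryTheory.Functor.map_id, Category.id_comp]

lemma qgood_proj (P : C) [Projective P] (hFP : Projective (F.obj P))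
    (hb : ∀ X : C, Function.Bijective (fun f : P ⟶ X => F.map f)) (a : ℤ) :
    QGood F (sstk P a) := by
  intro X k
  have hz : ∀ (h : k ≠ a), (∀ x : sstk P a ⟶ sstk X k, x = 0) ∧
      (∀ φ : F.mapDerivedCategory.obj (sstk P a) ⟶ F.mapDerivedCategory.obj (sstk X k), φ = 0) := by
    intro h
    have key2 : (∀ x : sstk (F.obj P) a ⟶ sstk (F.obj X) k, x = 0) := by
      intro x
      rcases lt_or_gt_of_ne h with h | h
      · exact sstk_hom_neg h x
      · exact proj_van _ a _ (-k) (sstk_isLE _ k) (by lia) x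
    constructor
    · intro x
      rcases lt_or_gt_of_ne h with h | h
      · exact sstk_hom_neg h x
      · exact proj_van _ a _ (-k) (sstk_isLE _ k) (by lia) x
    · intro φ
      have := key2 ((fdIso F P a).inv ≫ φ ≫ (fdIso F X k).hom)
      rw [← cancel_epi (fdIso F P a).inv, ← cancel_mono (fdIso F X k).hom, Category.assoc, this,
        comp_zero, zero_comp]
  by_cases h : k = a
  · subst h
    refine ⟨fun x y hxy => ?_, fun φ => ?_⟩
    · obtain ⟨u, rfl⟩ := smap_surj x
      obtain ⟨u', rfl⟩ := smap_surj y
      have h1 := fdIso_nat F u k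
      have h2 := fdIso_nat F u' k
      dsimp only at hxy
      rw [hxy, h2, cancel_epi] at h1
      have h3 := (singleFunctor C' 0).map_injective
        ((shiftFunctor (DerivedCategory C') k).map_injective h1)
      rw [(hb X).1 h3]
    · obtain ⟨u, hu⟩ := smap_surj ((fdIso F P k).inv ≫ φ ≫ (fdIso F X k).hom)
      obtain ⟨u', rfl⟩ := (hb X).2 u
      refine ⟨smap u' k, ?_⟩
      dsimp only at hu ⊢
      rw [← cancel_mono (fdIso F X k).hom, fdIso_nat, ← hu]
      simp
  · refine ⟨fun x y _ => by rw [(hz h).1 x, (hz h).1 y], fun φ => ⟨0, ?_⟩⟩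
    rw [(hz h).2 φ]
    simp

/-- hypothesis on covers -/
def CoverHyp (S : C) : Prop :=
  ∀ H : C, (∀ f : H ⟶ S, f = 0) → ∃ (P : C) (p : P ⟶ H), Epi p ∧ Projective P ∧
      (∀ f : P ⟶ S, f = 0) ∧ (Projective (F.obj P) ∧
        ∀ X : C, Function.Bijective (fun f : P ⟶ X => F.map f))

variable {F} {S : C} 

lemma fd_tri {M X N : DerivedCategory C} {v : M ⟶ X} {w : X ⟶ N} {δ : N ⟶ M⟦(1 : ℤ)⟧}
    (hT : Pretriangulated.Triangle.mk v w δ ∈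
      Pretriangulated.distinguishedTriangles (C := DerivedCategory C)) :
    Pretriangulated.Triangle.mk (F.mapDerivedCategory.map v) (F.mapDerivedCategory.map w)
      (F.mapDerivedCategory.map δ ≫ (F.mapDerivedCategory.commShiftIso (1 : ℤ)).hom.app M) ∈
      Pretriangulated.distinguishedTriangles (C := DerivedCategory C') :=
  F.mapDerivedCategory.map_distinguished _ hT

lemma fd_inj (hF : CoverHyp F S) (j : ℕ) : ∀ (m k : ℤ), m + k < j → ∀ (N : DerivedCategory C),
    TStructure.t.IsLE N m → Orth S N → ∀ (X : C) (x : N ⟶ sstk X k),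
    F.mapDerivedCategory.map x = 0 → x = 0 := by
  induction j with
  | zero =>
    intro m k h N hN hO X x _
    have := sstk_isGE X k
    exact TStructure.t.zero x m (-k) (by push_cast at h; lia)
  | succ j ih =>
    intro m k h N hN hO X x hx
    obtain ⟨P, N', q, w, δ, hT, hP, ⟨hp1, hp2⟩, hN', hO'⟩ := orth_step N m hN hO _ hF
    have hg := qgood_proj F P hp1 hp2 (-m)
    have hg1 : QGood F ((sstk P (-m))⟦(1 : ℤ)⟧) :=
      (qgood_proj F P hp1 hp2 (-m + 1)).of_iso F (sstkShift P (-m) 1 _ rfl).symm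
    have h1 : q ≫ x = 0 := by
      apply (hg X k).1
      simp [hx]
    obtain ⟨y, rfl⟩ := tri_yo2 hT x h1
    rw [CategoryTheory.Functor.map_comp] at hx
    obtain ⟨φ, hφ⟩ := tri_yo3 (fd_tri (F := F) hT) _ hx
    obtain ⟨ψ, hψ⟩ := (hg1 X k).2 ((F.mapDerivedCategory.commShiftIso (1 : ℤ)).hom.app _ ≫ φ)
    have h2 : y - δ ≫ ψ = 0 := by
      apply ih (m - 1) k (by push_cast at h; lia) N' hN' hO' X
      dsimp only at hψ
      rw [CategoryTheory.Functor.map_sub, CategoryTheory.Functor.map_comp, hψ, hφ,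
        Category.assoc, sub_self]
    rw [sub_eq_zero.1 h2, ← Category.assoc, tri_comp23 hT, zero_comp]

lemma fd_inj' (hF : CoverHyp F S) {m k : ℤ} {N : DerivedCategory C}
    (hN : TStructure.t.IsLE N m) (hO : Orth S N) {X : C} (x : N ⟶ sstk X k)
    (hx : F.mapDerivedCategory.map x = 0) : x = 0 :=
  fd_inj hF ((m + k).toNat + 1) m k (by push_cast; have := Int.self_le_toNat (m + k); lia)
    N hN hO X x hx

lemma fd_surj (hF : CoverHyp F S) (j : ℕ) : ∀ (m k : ℤ), m + k < j → ∀ (N : DerivedCategory C),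
    TStructure.t.IsLE N m → Orth S N → ∀ (X : C)
    (φ : F.mapDerivedCategory.obj N ⟶ F.mapDerivedCategory.obj (sstk X k)),
    ∃ x : N ⟶ sstk X k, F.mapDerivedCategory.map x = φ := by
  induction j with
  | zero =>
    intro m k h N hN hO X φ
    refine ⟨0, ?_⟩
    have := sstk_isGE (F.obj X) k
    have := fd_isLE F N m hN
    rw [← cancel_mono (fdIso F X k).hom]
    rw [TStructure.t.zero (φ ≫ (fdIso F X k).hom) m (-k) (by push_cast at h; lia)]
    simp
  | succ j ih =>
    intro m k h N hN hO X φ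
    obtain ⟨P, N', q, w, δ, hT, hP, ⟨hp1, hp2⟩, hN', hO'⟩ := orth_step N m hN hO _ hF
    have hg := qgood_proj F P hp1 hp2 (-m)
    obtain ⟨ψ, hψ⟩ := (hg X k).2 (F.mapDerivedCategory.map q ≫ φ)
    dsimp only at hψ
    have h1 : δ ≫ ψ⟦(1 : ℤ)⟧' = 0 := by
      have h2 : (δ ≫ ψ⟦(1 : ℤ)⟧') ≫ (sstkShift X k 1 (k + 1) rfl).hom = 0 := by
        apply fd_inj' hF hN' hO'
        have h3 : F.mapDerivedCategory.map (δ ≫ ψ⟦(1 : ℤ)⟧') = 0 := by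
          have hc := (F.mapDerivedCategory.commShiftIso (1 : ℤ)).hom.naturality ψ
          dsimp at hc
          have h31 := tri_comp31 (fd_tri (F := F) hT)
          rw [← cancel_mono ((F.mapDerivedCategory.commShiftIso (1 : ℤ)).hom.app _),
            CategoryTheory.Functor.map_comp, Category.assoc, hc, zero_comp, hψ,
            CategoryTheory.Functor.map_comp, ← Category.assoc, ← Category.assoc, h31, zero_comp]
        rw [CategoryTheory.Functor.map_comp, h3, zero_comp]
      rw [← cancel_mono (sstkShift X k 1 (k + 1) rfl).hom, h2, zero_comp]
    obtain ⟨g, hg'⟩ := tri_yo1 hT _ h1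
    obtain ⟨g, rfl⟩ := (shiftFunctor (DerivedCategory C) (1 : ℤ)).map_surjective g
    rw [← CategoryTheory.Functor.map_comp] at hg'
    have hg2 := (shiftFunctor (DerivedCategory C) (1 : ℤ)).map_injective hg'
    have h4 : F.mapDerivedCategory.map q ≫ (φ - F.mapDerivedCategory.map g) = 0 := by
      rw [Preadditive.comp_sub, ← hψ, hg2, CategoryTheory.Functor.map_comp, sub_self]
    obtain ⟨φ', hφ'⟩ := tri_yo2 (fd_tri (F := F) hT) _ h4
    obtain ⟨x', hx'⟩ := ih (m - 1) k (by push_cast at h; lia) N' hN' hO' X φ'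
    refine ⟨g + w ≫ x', ?_⟩
    rw [CategoryTheory.Functor.map_add, CategoryTheory.Functor.map_comp, hx', ← hφ']
    abel

lemma fd_surj' (hF : CoverHyp F S) {m k : ℤ} {N : DerivedCategory C}
    (hN : TStructure.t.IsLE N m) (hO : Orth S N) {X : C}
    (φ : F.mapDerivedCategory.obj N ⟶ F.mapDerivedCategory.obj (sstk X k)) :
    ∃ x : N ⟶ sstk X k, F.mapDerivedCategory.map x = φ :=
  fd_surj hF ((m + k).toNat + 1) m k (by push_cast; have := Int.self_le_toNat (m + k); lia)
    N hN hO X φ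

variable {ι : Type} [Fintype ι] (D : SSDec S ι)

/-- bounded objects with bounded maps to modules -/
def Good (M : DerivedCategory C) : Prop :=
  (∃ m, TStructure.t.IsLE M m) ∧ ∃ K : ℤ, ∀ (X : C) (k : ℤ), K ≤ k → ∀ x : M ⟶ sstk X k, x = 0

/-- the property propagated along the tower -/
def P2 (F : C ⥤ C') [F.Additive] [PreservesFiniteLimits F] [PreservesFiniteColimits F]
    (M : DerivedCategory C) : Prop :=
  Good M → ∃ K : ℤ, ∀ (X : C) (k : ℤ), K ≤ k →
    ∀ φ : F.mapDerivedCategory.obj M ⟶ F.mapDerivedCategory.obj (sstk X k), φ = 0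

lemma P2_zero (hF : CoverHyp F S) (N : DerivedCategory C) (hO : Orth S N) : P2 F N := by
  rintro ⟨⟨m, hm⟩, K, hK⟩
  refine ⟨K, fun X k hk φ => ?_⟩
  obtain ⟨x, rfl⟩ := fd_surj' hF hm hO φ
  rw [hK X k hk x, CategoryTheory.Functor.map_zero]

lemma cellSum_isLE {α : Type} [Fintype α] (c : α → ι × ℕ) :
    TStructure.t.IsLE (cellSum D c) 0 := by
  rw [TStructure.t.isLE_iff_orthogonal 0 1 (by lia)]
  intro Y f hY
  apply biproduct.hom_ext'
  intro a
  rw [comp_zero]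
  have := sstk_isLE (D.T (c a).1) (c a).2
  exact TStructure.t.zero (X := sstk (D.T (c a).1) (c a).2) _ (-((c a).2 : ℤ)) 1 (by lia)

lemma cellSum_good (n : ℕ)
    (hgl : ∀ (X Y : C) (k : ℤ), n < k → ∀ x : stk X ⟶ sstk Y k, x = 0)
    {α : Type} [Fintype α] (c : α → ι × ℕ) : Good (cellSum D c) := by
  classical
  refine ⟨⟨0, cellSum_isLE D c⟩, n + 1 + ∑ a, ((c a).2 : ℤ), fun X k hk x => ?_⟩
  apply biproduct.hom_ext'
  intro a
  rw [comp_zero]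
  have hle : ((c a).2 : ℤ) ≤ ∑ a, ((c a).2 : ℤ) :=
    Finset.single_le_sum (f := fun a => ((c a).2 : ℤ)) (fun _ _ => by positivity)
      (Finset.mem_univ a)
  generalize biproduct.ι (fun a => cell D (c a)) a ≫ x = y
  change sstk (D.T (c a).1) (c a).2 ⟶ sstk X k at y
  have hj : (k - (c a).2).toNat + ((c a).2 : ℤ) = k := by
    rw [Int.toNat_of_nonneg (by lia)]; lia
  obtain ⟨e, he⟩ := shift_factor hj y
  have : e.hom = 0 := hgl _ _ _ (by rw [Int.toNat_of_nonneg (by lia)]; lia) e.hom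
  rw [this] at he
  simpa using he

lemma P2_step (n : ℕ)
    (hgl : ∀ (X Y : C) (k : ℤ), n < k → ∀ x : stk X ⟶ sstk Y k, x = 0)
    (hFS : IsZero (F.obj S))
    (M M' : DerivedCategory C) {α : Type} [Fintype α] (c : α → ι × ℕ)
    (v : M ⟶ cellSum D c) (w : cellSum D c ⟶ M') (δ : M' ⟶ M⟦(1 : ℤ)⟧)
    (hT : Pretriangulated.Triangle.mk v w δ ∈
      Pretriangulated.distinguishedTriangles (C := DerivedCategory C))
    (hP : P2 F M') : P2 F M := by
  classical
  rintro ⟨⟨m, hm⟩, K, hK⟩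
  have hG : Good M' := by
    refine ⟨⟨max m 0, ?_⟩, ?_⟩
    · have h1 := cellSum_isLE D c
      have h2 := TStructure.t.isLE_shift M m 1 (m - 1) (by lia)
      exact TStructure.t.isLE₂ _ (Pretriangulated.rot_of_distTriang _ hT) (max m 0)
        (TStructure.t.isLE_of_le (cellSum D c) 0 _ (by lia))
        (TStructure.t.isLE_of_le (M⟦(1 : ℤ)⟧) (m - 1) _ (by lia))
    · obtain ⟨-, K', hK'⟩ := cellSum_good D n hgl c
      refine ⟨max K' (K + 1), fun X k hk x => ?_⟩
      obtain ⟨y, hy⟩ := tri_yo3 hT x (hK' X k (by lia) _)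
      obtain ⟨y', hy'⟩ := (shiftFunctor (DerivedCategory C) (1 : ℤ)).map_surjective
        (y ≫ (sstkShift X (k - 1) 1 k (by lia)).inv)
      have : y' = 0 := hK X (k - 1) (by lia) y'
      rw [this, CategoryTheory.Functor.map_zero] at hy'
      have hy0 : y = 0 := by
        rw [← cancel_mono (sstkShift X (k - 1) 1 k (by lia)).inv, ← hy', zero_comp]
      rw [hy, hy0, comp_zero]
  obtain ⟨K', hK'⟩ := hP hG
  have hv : F.mapDerivedCategory.map v = 0 := by
    have hid : v = ∑ a, (v ≫ biproduct.π (fun a => cell D (c a)) a) ≫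
        biproduct.ι (fun a => cell D (c a)) a := by
      simp only [Category.assoc]
      rw [← Preadditive.comp_sum, biproduct.total]
      exact (Category.comp_id _).symm
    rw [hid, CategoryTheory.Functor.map_sum]
    apply Finset.sum_eq_zero
    intro a _
    have hz : IsZero (F.mapDerivedCategory.obj (cell D (c a))) := by
      have hFT : IsZero (F.obj (D.T (c a).1)) := by
        rw [IsZero.iff_id_eq_zero, ← CategoryTheory.Functor.map_id, ← D.inc_proj,
          CategoryTheory.Functor.map_comp, hFS.eq_of_tgt (F.map (D.inc _)) 0, zero_comp]
      refine IsZero.of_iso ?_ (fdIso F (D.T (c a).1) (c a).2)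
      exact Functor.map_isZero (shiftFunctor _ _) (Functor.map_isZero (singleFunctor C' 0) hFT)
    rw [CategoryTheory.Functor.map_comp, hz.eq_of_tgt (F.mapDerivedCategory.map _) 0, zero_comp]
  refine ⟨K', fun X k hk φ => ?_⟩
  have h1 : (F.mapDerivedCategory.map δ ≫ (F.mapDerivedCategory.commShiftIso (1 : ℤ)).hom.app M) ≫
      φ⟦(1 : ℤ)⟧' = 0 := by
    have := hK' X (k + 1) (by lia) (((F.mapDerivedCategory.map δ ≫
      (F.mapDerivedCategory.commShiftIso (1 : ℤ)).hom.app M) ≫ φ⟦(1 : ℤ)⟧') ≫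
      (F.mapDerivedCategory.commShiftIso (1 : ℤ)).inv.app _ ≫
      F.mapDerivedCategory.map (sstkShift X k 1 (k + 1) rfl).hom)
    rw [← cancel_mono ((F.mapDerivedCategory.commShiftIso (1 : ℤ)).inv.app _ ≫
      F.mapDerivedCategory.map (sstkShift X k 1 (k + 1) rfl).hom), this, zero_comp]
  obtain ⟨g, hg⟩ := tri_yo1 (fd_tri (F := F) hT) _ h1
  rw [hv, CategoryTheory.Functor.map_zero, zero_comp] at hg
  apply (shiftFunctor (DerivedCategory C') (1 : ℤ)).map_injective
  rw [hg, CategoryTheory.Functor.map_zero]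

end FF
end CDR
end

noncomputable section
namespace CDR
open CategoryTheory.Limits
open MulOpposite (op unop)

section Corner
variable {A : Type} [Ring A] (f : A) (hf : IsIdempotentElem f)

/-- The subgroup `M f`. -/
def cor (M : Type) [AddCommGroup M] [Module Aᵐᵒᵖ M] : AddSubgroup M where
  carrier := {m | op f • m = m}
  add_mem' {a b} ha hb := by
    simp only [Set.mem_ofPred_eq] at *
    rw [smul_add, ha, hb]
  zero_mem' := smul_zero _
  neg_mem' {a} ha := by
    simp only [Set.mem_ofPred_eq] at *
    rw [smul_neg, ha]

lemma op_smul_smul {M : Type} [AddCommGroup M] [Module Aᵐᵒᵖ M] (a b : A) (m : M) :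
    op a • op b • m = op (b * a) • m := by
  rw [smul_smul, MulOpposite.op_mul]

lemma mem_cor {M : Type} [AddCommGroup M] [Module Aᵐᵒᵖ M] {m : M} :
    m ∈ cor f M ↔ op f • m = m := Iff.rfl

variable {f} in
lemma smul_mem_cor {M : Type} [AddCommGroup M] [Module Aᵐᵒᵖ M] (x : CornerRing f hf) (m : M) :
    op x.1 • m ∈ cor f M := by
  rw [mem_cor, op_smul_smul, x.2.2]

variable (M : Type) [AddCommGroup M] [Module Aᵐᵒᵖ M]

instance corSMul : SMul (CornerRing f hf)ᵐᵒᵖ (cor f M) :=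
  ⟨fun c m => ⟨op (unop c).1 • m.1, smul_mem_cor hf _ _⟩⟩

instance corModule : Module (CornerRing f hf)ᵐᵒᵖ (cor f M) where
  one_smul m := Subtype.ext m.2
  mul_smul c d m := Subtype.ext (by
    change op ((unop d).1 * (unop c).1) • m.1 = op (unop c).1 • op (unop d).1 • m.1
    rw [op_smul_smul])
  smul_zero c := Subtype.ext (smul_zero _)
  smul_add c x y := Subtype.ext (smul_add _ _ _)
  add_smul c d x := Subtype.ext (by
    change op ((unop c).1 + (unop d).1) • x.1 = _
    rw [MulOpposite.op_add, add_smul]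
    rfl)
  zero_smul x := Subtype.ext (by
    change op (0 : A) • x.1 = 0
    rw [MulOpposite.op_zero, zero_smul])

variable {M} in
lemma cor_smul_val (c : CornerRing f hf) (m : cor f M) : (op c • m).1 = op c.1 • m.1 := rfl

variable {M} {N : Type} [AddCommGroup N] [Module Aᵐᵒᵖ N]

/-- restriction of a linear map -/
def corMap (φ : M →ₗ[Aᵐᵒᵖ] N) : cor f M →ₗ[(CornerRing f hf)ᵐᵒᵖ] cor f N where
  toFun m := ⟨φ m.1, by rw [mem_cor, ← map_smul, (mem_cor f).1 m.2]⟩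
  map_add' x y := Subtype.ext (map_add φ _ _)
  map_smul' c x := Subtype.ext (map_smul φ (op (unop c).1) x.1)

/-- The functor `M ↦ M f`. -/
def corF : ModuleCat.{0} Aᵐᵒᵖ ⥤ ModuleCat.{0} (CornerRing f hf)ᵐᵒᵖ where
  obj M := ModuleCat.of _ (cor f M)
  map φ := ModuleCat.ofHom (corMap f hf φ.hom)
  map_id M := rfl
  map_comp φ ψ := rfl

instance corF_additive : (corF f hf).Additive where
  map_add := rfl

lemma corF_exact (S : ShortComplex (ModuleCat.{0} Aᵐᵒᵖ)) (hS : S.ShortExact) :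
    (S.map (corF f hf)).ShortExact := by
  have hinj : Function.Injective S.f := (ModuleCat.mono_iff_injective _).1 hS.mono_f
  have hsurj : Function.Surjective S.g := (ModuleCat.epi_iff_surjective _).1 hS.epi_g
  have hex := (ShortComplex.ShortExact.moduleCat_exact_iff_function_exact S).1 hS.exact
  refine { exact := ?_, mono_f := ?_, epi_g := ?_ }
  · rw [ShortComplex.ShortExact.moduleCat_exact_iff_function_exact]
    rintro ⟨m, hm⟩
    constructor
    · intro h
      obtain ⟨x, hx⟩ := (hex m).1 (congrArg Subtype.val h)
      refine ⟨⟨x, ?_⟩, Subtype.ext hx⟩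
      apply hinj
      rw [map_smul, hx]
      exact hm
    · rintro ⟨x, hx⟩
      exact Subtype.ext ((hex m).2 ⟨x.1, congrArg Subtype.val hx⟩)
  · exact (ModuleCat.mono_iff_injective _).2 fun x y hxy =>
      Subtype.ext (hinj (congrArg Subtype.val hxy))
  · refine (ModuleCat.epi_iff_surjective _).2 ?_
    rintro ⟨m, hm⟩
    obtain ⟨x, rfl⟩ := hsurj m
    refine ⟨⟨op f • x, by rw [mem_cor, op_smul_smul, hf.eq]⟩, Subtype.ext ?_⟩
    refine Eq.trans ?_ hm
    exact map_smul S.g.hom _ _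

lemma corF_pres : PreservesFiniteLimits (corF f hf) ∧ PreservesFiniteColimits (corF f hf) := by
  have h : (∀ (S : ShortComplex (ModuleCat.{0} Aᵐᵒᵖ)), S.ShortExact →
    (S.map (corF f hf)).ShortExact) ↔ _ := (corF f hf).exact_tfae.out 0 3
  exact h.1 (corF_exact f hf)

instance corF_lim : PreservesFiniteLimits (corF f hf) := (corF_pres f hf).1

instance corF_colim : PreservesFiniteColimits (corF f hf) := (corF_pres f hf).2

/-- coinduced module -/
def coind (Y : Type) [AddCommGroup Y] [Module (CornerRing f hf)ᵐᵒᵖ Y] : AddSubgroup (A →+ Y) where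
  carrier := {φ | ∀ (x : A) (c : CornerRing f hf), φ (x * c.1) = op c • φ x}
  add_mem' {a b} ha hb x c := by
    simp only [Set.mem_ofPred_eq] at ha hb
    simp [ha, hb]
  zero_mem' x c := by simp
  neg_mem' {a} ha x c := by
    simp only [Set.mem_ofPred_eq] at ha
    simp [ha]

variable (Y : Type) [AddCommGroup Y] [Module (CornerRing f hf)ᵐᵒᵖ Y]

instance coindSMul : SMul Aᵐᵒᵖ (coind f hf Y) :=
  ⟨fun a φ => ⟨φ.1.comp (AddMonoidHom.mulLeft (unop a)), fun x c => by
    have := φ.2 (unop a * x) c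
    simpa [mul_assoc] using this⟩⟩

lemma coind_smul_apply (a : Aᵐᵒᵖ) (φ : coind f hf Y) (x : A) : (a • φ).1 x = φ.1 (unop a * x) := rfl

instance coindModule : Module Aᵐᵒᵖ (coind f hf Y) where
  one_smul φ := Subtype.ext (by ext x; rw [coind_smul_apply]; simp)
  mul_smul a b φ := Subtype.ext (by ext x; simp only [coind_smul_apply]; simp [mul_assoc])
  smul_zero a := rfl
  smul_add a x y := rfl
  add_smul a b φ := Subtype.ext (by
    ext x
    change φ.1 ((unop a + unop b) * x) = φ.1 (unop a * x) + φ.1 (unop b * x)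
    rw [add_mul, map_add])
  zero_smul φ := Subtype.ext (by
    ext x
    change φ.1 (0 * x) = 0
    rw [zero_mul, map_zero])

/-- `f x f` as element of the corner -/
def comp (x : A) : CornerRing f hf :=
  ⟨f * x * f, by rw [← mul_assoc, ← mul_assoc, hf.eq], by rw [mul_assoc, hf.eq]⟩

/-- every module over the corner is a corner -/
def corCoind : cor f (coind f hf Y) ≃ₗ[(CornerRing f hf)ᵐᵒᵖ] Y where
  toFun φ := φ.1.1 f
  map_add' x y := rfl
  map_smul' c φ := by
    change φ.1.1 ((unop c).1 * f) = c • φ.1.1 f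
    have h1 := φ.1.2 f (unop c)
    rw [(unop c).2.2]
    rw [(unop c).2.1] at h1
    simpa using h1
  invFun y := ⟨⟨AddMonoidHom.mk' (fun x => op (comp f hf x) • y) (fun a b => by
      rw [← add_smul, ← MulOpposite.op_add]
      congr 2
      exact Subtype.ext (by change f * (a + b) * f = f * a * f + f * b * f; noncomm_ring)),
    fun x c => by
      change op (comp f hf (x * c.1)) • y = op c • op (comp f hf x) • y
      rw [smul_smul, ← MulOpposite.op_mul]
      congr 2
      refine Subtype.ext ?_
      change f * (x * c.1) * f = f * x * f * c.1
      rw [mul_assoc (f * x), c.2.1, mul_assoc, mul_assoc, c.2.2, mul_assoc]⟩, by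
    rw [mem_cor]
    refine Subtype.ext ?_
    ext x
    change op (comp f hf (f * x)) • y = op (comp f hf x) • y
    congr 2
    exact Subtype.ext (by change f * (f * x) * f = f * x * f; rw [← mul_assoc f f, hf.eq])⟩
  left_inv φ := by
    refine Subtype.ext (Subtype.ext ?_)
    ext x
    change op (comp f hf x) • φ.1.1 f = φ.1.1 x
    rw [← φ.1.2]
    change φ.1.1 (f * (f * x * f)) = _
    have h2 : f * (f * x * f) = f * x * (1 : CornerRing f hf).1 := by
      change _ = f * x * f
      rw [← mul_assoc, ← mul_assoc, hf.eq]
    rw [h2, φ.1.2]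
    have h3 := congrArg (fun ψ : coind f hf Y => ψ.1 x) φ.2
    change φ.1.1 (f * x) = φ.1.1 x at h3
    rw [h3]
    exact one_smul _ _
  right_inv y := by
    change op (comp f hf f) • y = y
    have : comp f hf f = 1 := Subtype.ext (by change f * f * f = f; rw [hf.eq, hf.eq])
    rw [this]
    exact one_smul _ _

lemma corF_essSurj (Y : ModuleCat.{0} (CornerRing f hf)ᵐᵒᵖ) :
    ∃ X : ModuleCat.{0} Aᵐᵒᵖ, Nonempty ((corF f hf).obj X ≅ Y) :=
  ⟨ModuleCat.of _ (coind f hf Y), ⟨(corCoind f hf Y).toModuleIso⟩⟩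

/-! ### The free objects on elements of `M f` -/

/-- `Q` is free on a family of elements of `Q f` -/
structure FFree {A : Type} [Ring A] (f : A) (Q : Type) [AddCommGroup Q] [Module Aᵐᵒᵖ Q] {B : Type}
    (x : B → Q) : Prop where
  mem : ∀ b, op f • x b = x b
  span : Submodule.span Aᵐᵒᵖ (Set.range x) = ⊤
  lift : ∀ (X : Type) [AddCommGroup X] [Module Aᵐᵒᵖ X] (y : B → X), (∀ b, op f • y b = y b) →
    ∃ φ : Q →ₗ[Aᵐᵒᵖ] X, ∀ b, φ (x b) = y b

variable {f} in
lemma FFree.ext {Q : Type} [AddCommGroup Q] [Module Aᵐᵒᵖ Q] {B : Type} {x : B → Q}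
    (h : FFree f Q x) {X : Type} [AddCommGroup X] [Module Aᵐᵒᵖ X] {φ ψ : Q →ₗ[Aᵐᵒᵖ] X}
    (hh : ∀ b, φ (x b) = ψ (x b)) : φ = ψ :=
  LinearMap.ext_on_range h.span hh

variable {f} in
lemma FFree.projective {Q : Type} [AddCommGroup Q] [Module Aᵐᵒᵖ Q] {B : Type} {x : B → Q}
    (hf : IsIdempotentElem f)
    (h : FFree f Q x) : Projective (ModuleCat.of Aᵐᵒᵖ Q) where
  factors {E X} φ e he := by
    have hs : Function.Surjective e := (ModuleCat.epi_iff_surjective _).1 he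
    choose y hy using fun b => hs (φ.hom (x b))
    obtain ⟨ψ, hψ⟩ := h.lift E (fun b => op f • y b) (fun b => by
      rw [op_smul_smul, hf.eq])
    refine ⟨ModuleCat.ofHom ψ, ?_⟩
    apply ModuleCat.hom_ext
    refine h.ext (fun b => ?_)
    change e.hom (ψ (x b)) = φ.hom (x b)
    rw [hψ, map_smul]
    refine Eq.trans (congrArg _ (hy b)) ?_
    rw [← map_smul, h.mem]

variable {f} in
lemma FFree.cor_span {Q : Type} [AddCommGroup Q] [Module Aᵐᵒᵖ Q] {B : Type} {x : B → Q}
    (h : FFree f Q x) : Submodule.span (CornerRing f hf)ᵐᵒᵖ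
      (Set.range fun b => (⟨x b, h.mem b⟩ : cor f Q)) = ⊤ := by
  have key : ∀ q ∈ Submodule.span Aᵐᵒᵖ (Set.range x), ∀ a : A,
      (⟨op (a * f) • q, by rw [mem_cor, op_smul_smul, mul_assoc, hf.eq]⟩ : cor f Q) ∈
      Submodule.span (CornerRing f hf)ᵐᵒᵖ (Set.range fun b => (⟨x b, h.mem b⟩ : cor f Q)) := by
    intro q hq
    induction hq using Submodule.span_induction with
    | mem q hq =>
      obtain ⟨b, rfl⟩ := hq
      intro a
      have h0 := Submodule.subset_span (R := (CornerRing f hf)ᵐᵒᵖ)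
        (Set.mem_range_self (f := fun b => (⟨x b, h.mem b⟩ : cor f Q)) b)
      convert Submodule.smul_mem _ (op (comp f hf a)) h0 using 1
      refine Subtype.ext ?_
      change op (a * f) • x b = op (f * a * f) • x b
      conv_lhs => rw [← h.mem b, op_smul_smul, ← mul_assoc]
    | zero =>
      intro a
      convert Submodule.zero_mem _ using 1
      exact Subtype.ext (smul_zero _)
    | add q r _ _ ihq ihr =>
      intro a
      convert Submodule.add_mem _ (ihq a) (ihr a) using 1
      exact Subtype.ext (smul_add _ _ _)
    | smul c q _ ih =>
      intro a
      convert ih (unop c * a) using 1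
      refine Subtype.ext ?_
      change op (a * f) • c • q = op (unop c * a * f) • q
      rw [mul_assoc, ← op_smul_smul (a * f), MulOpposite.op_unop]
  rw [eq_top_iff]
  rintro q -
  have h1 := key q.1 (by rw [h.span]; trivial) 1
  convert h1 using 1
  refine Subtype.ext ?_
  change q.1 = op (1 * f) • q.1
  rw [one_mul, (mem_cor f).1 q.2]

variable {f} in
lemma FFree.cor {Q : Type} [AddCommGroup Q] [Module Aᵐᵒᵖ Q] {B : Type} {x : B → Q}
    (h : FFree f Q x) :
    FFree (1 : CornerRing f hf) (cor f Q) (fun b => (⟨x b, h.mem b⟩ : cor f Q)) where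
  mem b := one_smul _ _
  span := h.cor_span hf
  lift Y _ _ y hy := by
    obtain ⟨φ, hφ⟩ := h.lift (coind f hf Y) (fun b => ((corCoind f hf Y).symm (y b)).1)
      (fun b => ((corCoind f hf Y).symm (y b)).2)
    refine ⟨(corCoind f hf Y).toLinearMap ∘ₗ corMap f hf φ, fun b => ?_⟩
    rw [LinearMap.comp_apply, LinearEquiv.coe_coe, ← LinearEquiv.eq_symm_apply]
    exact Subtype.ext (hφ b)

variable {f} in
lemma FFree.bij {Q : Type} [AddCommGroup Q] [Module Aᵐᵒᵖ Q] {B : Type} {x : B → Q}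
    (h : FFree f Q x) (X : ModuleCat.{0} Aᵐᵒᵖ) :
    Function.Bijective (fun φ : ModuleCat.of Aᵐᵒᵖ Q ⟶ X => (corF f hf).map φ) := by
  refine ⟨fun φ ψ hh => ?_, fun ψ => ?_⟩
  · apply ModuleCat.hom_ext
    refine h.ext (fun b => ?_)
    have := congrArg (fun g => (g.hom (⟨x b, h.mem b⟩ : CDR.cor f Q)).1) hh
    exact this
  · obtain ⟨φ, hφ⟩ := h.lift X (fun b => (ψ.hom (⟨x b, h.mem b⟩ : CDR.cor f Q)).1)
      (fun b => (ψ.hom (⟨x b, h.mem b⟩ : CDR.cor f Q)).2)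
    refine ⟨ModuleCat.ofHom φ, ?_⟩
    apply ModuleCat.hom_ext
    refine LinearMap.ext_on_range (h.cor_span hf) (fun b => ?_)
    exact Subtype.ext (hφ b)

lemma mem_rightIdeal {A : Type} [Ring A] {e : A} (he : IsIdempotentElem e) {x : A} :
    x ∈ rightIdeal A e ↔ e * x = x := by
  rw [rightIdeal, Submodule.mem_span_singleton]
  constructor
  · rintro ⟨a, rfl⟩
    change e * (e * unop a) = e * unop a
    rw [← mul_assoc, he.eq]
  · intro h
    exact ⟨op x, h⟩

/-- `x ↦ y x` -/
def rmul (X : Type) [AddCommGroup X] [Module Aᵐᵒᵖ X] (y : X) : A →ₗ[Aᵐᵒᵖ] X where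
  toFun a := op a • y
  map_add' a b := by rw [MulOpposite.op_add, add_smul]
  map_smul' c a := by
    change op (a * unop c) • y = c • op a • y
    rw [← op_smul_smul, MulOpposite.op_unop]

open Classical in
variable {f} in
lemma ffree_finsupp (hf : IsIdempotentElem f) (B : Type) :
    FFree f (B →₀ rightIdeal A f)
      (fun b => Finsupp.single b (⟨f, (mem_rightIdeal hf).2 hf⟩ : rightIdeal A f)) where
  mem b := by
    rw [Finsupp.smul_single]
    congr 1
    exact Subtype.ext hf
  span := by
    rw [eq_top_iff]
    rintro q -
    induction q using Finsupp.induction_linear with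
    | zero => exact Submodule.zero_mem _
    | add p q hp hq => exact Submodule.add_mem _ hp hq
    | single b q =>
      have h0 := Submodule.subset_span (R := Aᵐᵒᵖ) (Set.mem_range_self
        (f := fun b : B => Finsupp.single b (⟨f, (mem_rightIdeal hf).2 hf⟩ : rightIdeal A f)) b)
      convert Submodule.smul_mem _ (op q.1) h0 using 1
      rw [Finsupp.smul_single]
      congr 1
      exact Subtype.ext ((mem_rightIdeal hf).1 q.2).symm
  lift X _ _ y hy := by
    refine ⟨Finsupp.lsum ℕ (fun b => (rmul X (y b)) ∘ₗ (rightIdeal A f).subtype), fun b => ?_⟩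
    simp only [Finsupp.lsum_single]
    exact hy b

lemma cor_coverHyp (S : ModuleCat.{0} Aᵐᵒᵖ) (hS : ∀ s : S, op f • s = 0)
    (hgen : ∀ (Z : Type) [AddCommGroup Z] [Module Aᵐᵒᵖ Z], (∀ z : Z, op f • z = 0) →
      (∀ φ : Z →ₗ[Aᵐᵒᵖ] S, φ = 0) → ∀ z : Z, z = 0) : CoverHyp (corF f hf) S := by
  intro H hH
  have hfree := ffree_finsupp hf (cor f H)
  obtain ⟨φ, hφ⟩ := hfree.lift H (fun h => h.1) (fun h => h.2)
  refine ⟨ModuleCat.of _ (cor f H →₀ rightIdeal A f), ModuleCat.ofHom φ, ?_, hfree.projective hf,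
    ?_, (hfree.cor hf).projective (IsIdempotentElem.one), hfree.bij hf⟩
  · refine (ModuleCat.epi_iff_surjective _).2 ?_
    change Function.Surjective φ
    rw [← LinearMap.range_eq_top, eq_top_iff]
    rintro h -
    rw [← Submodule.Quotient.mk_eq_zero]
    apply hgen (H ⧸ LinearMap.range φ)
    · intro z
      obtain ⟨z, rfl⟩ := Submodule.Quotient.mk_surjective _ z
      rw [← Submodule.Quotient.mk_smul, Submodule.Quotient.mk_eq_zero]
      have hm : op f • z ∈ cor f H := by rw [mem_cor, op_smul_smul, hf.eq]
      exact ⟨_, hφ ⟨_, hm⟩⟩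
    · intro ψ
      have h1 := hH (ModuleCat.ofHom (ψ ∘ₗ (LinearMap.range φ).mkQ))
      have h2 : ψ ∘ₗ (LinearMap.range φ).mkQ = 0 := congrArg (fun g => g.hom) h1
      refine LinearMap.ext fun z => ?_
      obtain ⟨z, rfl⟩ := Submodule.Quotient.mk_surjective _ z
      exact LinearMap.congr_fun h2 z
  · intro g
    apply ModuleCat.hom_ext
    refine hfree.ext (fun b => ?_)
    rw [← hfree.mem b, map_smul, hS]
    rfl

end Corner
end CDR
end

noncomputable section
namespace CDR
open CategoryTheory.Limits DerivedCategory
open MulOpposite (op unop)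
open scoped ModuleCat.Algebra

section Sh
universe w v u
variable {C : Type u} [Category.{v} C] [Abelian C] [HasDerivedCategory.{w} C]
variable (R : Type) [CommRing R] [Linear R C]

/-- shifting homs -/
def shiftHom (X Y : C) (a b : ℤ) : (stk X ⟶ sstk Y (b - a)) →ₗ[R] (sstk X a ⟶ sstk Y b) where
  toFun := fun f => f⟦a⟧' ≫ (shiftFunctorAdd' (DerivedCategory C) (b - a) a b (by lia)).inv.app _
  map_add' := by intro f g; simp
  map_smul' := by intro r f; simp [Functor.map_smul]

lemma shiftHom_bij (X Y : C) (a b : ℤ) : Function.Bijective (shiftHom R X Y a b) := by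
  constructor
  · intro f g hfg
    apply (shiftFunctor (DerivedCategory C) a).map_injective
    exact (cancel_mono ((shiftFunctorAdd' (DerivedCategory C) (b - a) a b (by lia)).inv.app _)).1 hfg
  · intro z
    obtain ⟨z', hz⟩ := (shiftFunctor (DerivedCategory C) a).map_surjective
      (z ≫ (shiftFunctorAdd' (DerivedCategory C) (b - a) a b (by lia)).hom.app _)
    refine ⟨z', ?_⟩
    change z'⟦a⟧' ≫ _ = z
    rw [hz]
    simp

lemma finite_shift1 (X Y : C) (a b : ℤ) (h : Module.Finite R (stk X ⟶ sstk Y (b - a))) :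
    Module.Finite R (sstk X a ⟶ sstk Y b) :=
  Module.Finite.of_surjective _ (shiftHom_bij R X Y a b).2
end Sh

section Fin
variable (R : Type) [CommRing R] [IsArtinianRing R] {A : Type} [Ring A] [Algebra R A]
  [Module.Finite R A]

lemma finite_op : Module.Finite R Aᵐᵒᵖ :=
  Module.Finite.equiv (MulOpposite.opLinearEquiv R : A ≃ₗ[R] Aᵐᵒᵖ)

lemma finite_of_fg (M : ModuleCat.{0} Aᵐᵒᵖ) [Module.Finite Aᵐᵒᵖ M] : Module.Finite R M := by
  have := finite_op R (A := A)
  exact Module.Finite.trans Aᵐᵒᵖ M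

lemma noeth_op (R : Type) [CommRing R] [IsArtinianRing R] {A : Type} [Ring A] [Algebra R A]
    [Module.Finite R A] : IsNoetherianRing Aᵐᵒᵖ := by
  have := finite_op R (A := A)
  have : IsNoetherian R Aᵐᵒᵖ := inferInstance
  exact isNoetherian_of_tower R this

lemma finite_homs (M N : ModuleCat.{0} Aᵐᵒᵖ) [Module.Finite Aᵐᵒᵖ M] [Module.Finite Aᵐᵒᵖ N] :
    Module.Finite R (M ⟶ N) := by
  have := finite_of_fg R N
  obtain ⟨n, s, hs⟩ := Module.Finite.exists_fin (R := Aᵐᵒᵖ) (M := M)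
  let φ : (M ⟶ N) →ₗ[R] (Fin n → N) :=
    { toFun := fun f i => f.hom (s i)
      map_add' := fun f g => rfl
      map_smul' := fun r f => rfl }
  refine Module.Finite.of_injective φ ?_
  intro f g hfg
  apply ModuleCat.hom_ext
  exact LinearMap.ext_on_range hs (fun i => congrFun hfg i)

variable [HasDerivedCategory.{1} (ModuleCat.{0} Aᵐᵒᵖ)]

lemma finite_ext_nat (N : ModuleCat.{0} Aᵐᵒᵖ) [Module.Finite Aᵐᵒᵖ N] (k : ℕ) :
    ∀ (M : ModuleCat.{0} Aᵐᵒᵖ) [Module.Finite Aᵐᵒᵖ M], Module.Finite R (stk M ⟶ sstk N k) := by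
  induction k with
  | zero =>
    intro M _
    have := finite_homs R M N
    let φ : (M ⟶ N) →ₗ[R] (stk M ⟶ sstk N (0 : ℕ)) :=
      { toFun := fun f => (singleFunctor _ 0).map f ≫ (shiftFunctorZero' _ ((0 : ℕ) : ℤ) rfl).inv.app _
        map_add' := by intro f g; simp
        map_smul' := by intro r f; simp [Functor.map_smul] }
    refine Module.Finite.of_surjective φ fun z => ?_
    obtain ⟨u, hu⟩ := (singleFunctor _ 0).map_surjective
      (z ≫ (shiftFunctorZero' _ ((0 : ℕ) : ℤ) rfl).hom.app _)
    refine ⟨u, ?_⟩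
    change (singleFunctor _ 0).map u ≫ _ = z
    rw [hu]
    simp
  | succ k ih =>
    intro M _
    have := noeth_op R (A := A)
    obtain ⟨n, g, hg⟩ := Module.Finite.exists_fin' Aᵐᵒᵖ M
    let p : ModuleCat.of Aᵐᵒᵖ (Fin n → Aᵐᵒᵖ) ⟶ M := ModuleCat.ofHom g
    have : Epi p := (ModuleCat.epi_iff_surjective _).2 hg
    let K : ModuleCat.{0} Aᵐᵒᵖ := ModuleCat.of _ (LinearMap.ker g)
    have : Module.Finite Aᵐᵒᵖ K := inferInstanceAs (Module.Finite Aᵐᵒᵖ (LinearMap.ker g))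
    let i : K ⟶ ModuleCat.of Aᵐᵒᵖ (Fin n → Aᵐᵒᵖ) := ModuleCat.ofHom (LinearMap.ker g).subtype
    have : Mono i := (ModuleCat.mono_iff_injective _).2 (Submodule.injective_subtype _)
    let Sh : ShortComplex (ModuleCat.{0} Aᵐᵒᵖ) := ShortComplex.mk i p (by
      apply ModuleCat.hom_ext
      exact LinearMap.comp_ker_subtype g)
    have hS : Sh.ShortExact :=
      { exact := (ShortComplex.ShortExact.moduleCat_exact_iff_function_exact Sh).2
          (LinearMap.exact_subtype_ker_map g) }
    have hd : Pretriangulated.Triangle.mk _ _ _ ∈ _ := hS.singleTriangle_distinguished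
    have hpr : Projective (ModuleCat.of Aᵐᵒᵖ (Fin n → Aᵐᵒᵖ)) :=
      (IsProjective.iff_projective _).1 inferInstance
    have hK : Module.Finite R (sstk K 1 ⟶ sstk N (k + 1 : ℕ)) := by
      apply finite_shift1 R K N 1
      have : ((k + 1 : ℕ) : ℤ) - 1 = k := by push_cast; lia
      rw [this]
      exact ih K
    let φ : (sstk K 1 ⟶ sstk N (k + 1 : ℕ)) →ₗ[R] (stk M ⟶ sstk N (k + 1 : ℕ)) :=
      { toFun := fun f => hS.singleδ ≫ f
        map_add' := by intro f g; simp
        map_smul' := by intro r f; simp }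
    refine Module.Finite.of_surjective φ fun z => ?_
    obtain ⟨y, hy⟩ := tri_yo3 hd z (proj_van_zero _ _ _ (sstk_isLE N _) (by push_cast; lia) _)
    exact ⟨y, hy.symm⟩

lemma sstk_neg0 (N M : ModuleCat.{0} Aᵐᵒᵖ) (k : ℤ) (hk : k < 0) (x : stk M ⟶ sstk N k) : x = 0 := by
  have : TStructure.t.IsLE (stk M) 0 := inferInstance
  have := sstk_isGE N k
  exact TStructure.t.zero x 0 (-k) (by lia)

lemma finite_ext (M N : ModuleCat.{0} Aᵐᵒᵖ) [Module.Finite Aᵐᵒᵖ M] [Module.Finite Aᵐᵒᵖ N] (k : ℤ) :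
    Module.Finite R (stk M ⟶ sstk N k) := by
  rcases lt_or_ge k 0 with h | h
  · have : Subsingleton (stk M ⟶ sstk N k) :=
      ⟨fun x y => by rw [sstk_neg0 N M k h x, sstk_neg0 N M k h y]⟩
    infer_instance
  · obtain ⟨j, rfl⟩ := Int.eq_ofNat_of_zero_le h
    exact finite_ext_nat R N j M

end Fin
end CDR
end

noncomputable section
namespace CDR
open CategoryTheory.Limits DerivedCategory
open MulOpposite (op unop)
open scoped ModuleCat.Algebra

section Pd
variable {T : Type} [Ring T]

lemma ses_of_exact {X Y Z : Type} [AddCommGroup X] [AddCommGroup Y] [AddCommGroup Z]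
    [Module T X] [Module T Y] [Module T Z] (i : X →ₗ[T] Y) (p : Y →ₗ[T] Z)
    (hi : Function.Injective i) (hp : Function.Surjective p) (h : Function.Exact i p) :
    ∃ hc, (ShortComplex.mk (ModuleCat.ofHom i) (ModuleCat.ofHom p) hc).ShortExact := by
  refine ⟨by apply ModuleCat.hom_ext; exact h.linearMap_comp_eq_zero, ?_⟩
  exact { exact := (ShortComplex.ShortExact.moduleCat_exact_iff_function_exact _).2 h
          mono_f := (ModuleCat.mono_iff_injective _).2 hi
          epi_g := (ModuleCat.epi_iff_surjective _).2 hp }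

lemma ses_ker {Y Z : Type} [AddCommGroup Y] [AddCommGroup Z]
    [Module T Y] [Module T Z] (p : Y →ₗ[T] Z) (hp : Function.Surjective p) :
    ∃ hc, (ShortComplex.mk (ModuleCat.ofHom (LinearMap.ker p).subtype)
      (ModuleCat.ofHom p) hc).ShortExact :=
  ses_of_exact _ p (Submodule.injective_subtype _) hp (LinearMap.exact_subtype_ker_map p)

lemma ses_finsupp (B : Type) {Y M : Type} [AddCommGroup Y] [AddCommGroup M]
    [Module T Y] [Module T M] (p : Y →ₗ[T] M) (hp : Function.Surjective p) :
    ∃ hc, (ShortComplex.mk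
      (ModuleCat.ofHom (Finsupp.mapRange.linearMap (α := B) (LinearMap.ker p).subtype))
      (ModuleCat.ofHom (Finsupp.mapRange.linearMap (α := B) p)) hc).ShortExact := by
  let i1 : (B →₀ LinearMap.ker p) →ₗ[T] (B →₀ Y) :=
    Finsupp.mapRange.linearMap (LinearMap.ker p).subtype
  let p1 : (B →₀ Y) →ₗ[T] (B →₀ M) := Finsupp.mapRange.linearMap p
  have hex : Function.Exact i1 p1 := by
    intro q
    constructor
    · intro hq
      have hq' : ∀ b, p (q b) = 0 := fun b => by
        have := DFunLike.congr_fun hq b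
        simpa [p1] using this
      refine ⟨Finsupp.onFinset q.support (fun b => ⟨q b, hq' b⟩) ?_, ?_⟩
      · intro b hb
        rw [Finsupp.mem_support_iff]
        intro h0
        exact hb (Subtype.ext h0)
      · ext b : 1
        rfl
    · rintro ⟨r, rfl⟩
      ext b : 1
      simp only [i1, p1, Finsupp.mapRange.linearMap_apply, Finsupp.mapRange_apply]
      exact (r b).2
  have hi1 : Function.Injective i1 :=
    Finsupp.mapRange_injective _ (map_zero _) (Submodule.injective_subtype _)
  have hp2 : Function.Surjective p1 := Finsupp.mapRange_surjective _ (map_zero _) hp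
  exact ses_of_exact i1 p1 hi1 hp2 hex

lemma free_cover_surj (M : Type) [AddCommGroup M] [Module T M] :
    Function.Surjective (Finsupp.linearCombination T (id : M → M)) := by
  intro m
  exact ⟨Finsupp.single m 1, by simp⟩

open Classical in
lemma proj_finsupp (M : Type) [AddCommGroup M] [Module T M] [Module.Projective T M] (B : Type) :
    Module.Projective T (B →₀ M) :=
  Module.Projective.of_equiv (finsuppLequivDFinsupp T).symm

lemma pd_finsupp (B : Type) (d : ℕ) : ∀ (M : Type) [AddCommGroup M] [Module T M],
    HasProjectiveDimensionLT (ModuleCat.of T M) d →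
      HasProjectiveDimensionLT (ModuleCat.of T (B →₀ M)) d := by
  have h1 : ∀ (M : Type) [AddCommGroup M] [Module T M],
      HasProjectiveDimensionLT (ModuleCat.of T M) 1 →
      HasProjectiveDimensionLT (ModuleCat.of T (B →₀ M)) 1 := by
    intro M _ _ h
    rw [← projective_iff_hasProjectiveDimensionLT_one, ← IsProjective.iff_projective] at h ⊢
    exact proj_finsupp M B
  induction d with
  | zero =>
    intro M _ _ h
    have hz := isZero_of_hasProjectiveDimensionLT_zero (ModuleCat.of T M)
    have : Subsingleton M := ModuleCat.subsingleton_of_isZero hz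
    exact (ModuleCat.isZero_of_subsingleton (ModuleCat.of T (B →₀ M))).hasProjectiveDimensionLT_zero
  | succ d ih =>
    rcases d with _ | d
    · exact h1
    · intro M _ _ h
      obtain ⟨hc, hS⟩ := ses_ker _ (free_cover_surj (T := T) M)
      have hp : Projective (ModuleCat.of T (M →₀ T)) := (IsProjective.iff_projective _).1 inferInstance
      have h2 := ih _ ((hS.hasProjectiveDimensionLT_X₃_iff d hp).1 h)
      obtain ⟨hc', hS'⟩ := ses_finsupp (T := T) B _ (free_cover_surj (T := T) M)
      have hp1 : Module.Projective T (B →₀ (M →₀ T)) := proj_finsupp _ _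
      have hp' : Projective (ModuleCat.of T (B →₀ (M →₀ T))) := (IsProjective.iff_projective _).1 hp1
      exact (hS'.hasProjectiveDimensionLT_X₃_iff d hp').2 h2

end Pd

section PdCor
variable {A : Type} [Ring A] (f : A) (hf : IsIdempotentElem f)

/-- `F` commutes with coproducts -/
def corFinsupp (B : Type) (M : Type) [AddCommGroup M] [Module Aᵐᵒᵖ M] :
    (B →₀ cor f M) →ₗ[(CornerRing f hf)ᵐᵒᵖ] cor f (B →₀ M) where
  toFun q := ⟨Finsupp.mapRange (fun m : cor f M => m.1) rfl q, by
    rw [mem_cor]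
    ext b : 1
    exact (q b).2⟩
  map_add' p q := Subtype.ext (by ext b : 1; rfl)
  map_smul' c q := Subtype.ext (by ext b : 1; rfl)

lemma corFinsupp_bij (B : Type) (M : Type) [AddCommGroup M] [Module Aᵐᵒᵖ M] :
    Function.Bijective (corFinsupp f hf B M) := by
  constructor
  · intro p q h
    have h' := congrArg Subtype.val h
    ext b : 1
    exact Subtype.ext (DFunLike.congr_fun h' b)
  · rintro ⟨q, hq⟩
    have hq' : ∀ b, q b ∈ cor f M := fun b => DFunLike.congr_fun hq b
    refine ⟨Finsupp.onFinset q.support (fun b => ⟨q b, hq' b⟩) ?_, ?_⟩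
    · intro b hb
      rw [Finsupp.mem_support_iff]
      intro h0
      exact hb (Subtype.ext h0)
    · refine Subtype.ext ?_
      ext b : 1
      rfl

lemma pd_cor (N : ℕ) (hN : HasProjectiveDimensionLT ((corF f hf).obj (ModuleCat.of Aᵐᵒᵖ Aᵐᵒᵖ)) N)
    (d : ℕ) : ∀ X : ModuleCat.{0} Aᵐᵒᵖ, HasProjectiveDimensionLT X (d + 1) →
      HasProjectiveDimensionLT ((corF f hf).obj X) (N + d) := by
  have hfree : ∀ B : Type,
      HasProjectiveDimensionLT ((corF f hf).obj (ModuleCat.of Aᵐᵒᵖ (B →₀ Aᵐᵒᵖ))) N := by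
    intro B
    have := pd_finsupp B N (cor f Aᵐᵒᵖ) hN
    exact hasProjectiveDimensionLT_of_iso
      (LinearEquiv.ofBijective _ (corFinsupp_bij f hf B Aᵐᵒᵖ)).toModuleIso N
  induction d with
  | zero =>
    intro X hX
    rw [← projective_iff_hasProjectiveDimensionLT_one, ] at hX
    have hs := free_cover_surj (T := Aᵐᵒᵖ) X
    let p : ModuleCat.of Aᵐᵒᵖ (X →₀ Aᵐᵒᵖ) ⟶ X :=
      ModuleCat.ofHom (Finsupp.linearCombination Aᵐᵒᵖ (id : X → X))
    have : Epi p := (ModuleCat.epi_iff_surjective _).2 hs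
    let r : Retract X (ModuleCat.of Aᵐᵒᵖ (X →₀ Aᵐᵒᵖ)) :=
      { i := Projective.factorThru (𝟙 X) p
        r := p
        retract := Projective.factorThru_comp _ _ }
    have := hfree X
    exact (r.map (corF f hf)).hasProjectiveDimensionLT N
  | succ d ih =>
    intro X hX
    obtain ⟨hc, hS⟩ := ses_ker _ (free_cover_surj (T := Aᵐᵒᵖ) X)
    have hp : Projective (ModuleCat.of Aᵐᵒᵖ (X →₀ Aᵐᵒᵖ)) :=
      (IsProjective.iff_projective _).1 inferInstance
    have h2 := ih _ ((hS.hasProjectiveDimensionLT_X₃_iff d hp).1 hX)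
    have h3 := hfree X
    have h4 := hasProjectiveDimensionLT_of_ge ((corF f hf).obj (ModuleCat.of Aᵐᵒᵖ (X →₀ Aᵐᵒᵖ)))
      N (N + d + 1) (by lia)
    exact (corF_exact f hf _ hS).hasProjectiveDimensionLT_X₃ (N + d) h2 h4

end PdCor

section Main
variable (R : Type) [CommRing R] [IsArtinianRing R] {A : Type} [Ring A] [Algebra R A]
  [Module.Finite R A] (f : A) (hf : IsIdempotentElem f)

lemma hgl_of {A : Type} [Ring A] [HasDerivedCategory.{1} (ModuleCat.{0} Aᵐᵒᵖ)] {n : ℕ}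
    (hA : ∀ (M N : ModuleCat.{0} Aᵐᵒᵖ) (i : ℕ), n < i → Subsingleton (Ext M N i))
    (X Y : ModuleCat.{0} Aᵐᵒᵖ) (k : ℤ) (hk : n < k) (x : stk X ⟶ sstk Y k) : x = 0 := by
  obtain ⟨j, rfl⟩ := Int.eq_ofNat_of_zero_le (a := k) (by lia)
  have := hA X Y j (by lia)
  obtain ⟨e, he⟩ := Ext.homEquiv.surjective x
  rw [← he, Subsingleton.elim e 0]
  exact Ext.zero_hom _ _ _

lemma SSDec.finite {S : ModuleCat.{0} Aᵐᵒᵖ} [Module.Finite Aᵐᵒᵖ S] {ι : Type} [Fintype ι]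
    (D : SSDec S ι) (i : ι) : Module.Finite Aᵐᵒᵖ (D.T i) := by
  refine Module.Finite.of_surjective (D.proj i).hom fun t => ⟨(D.inc i).hom t, ?_⟩
  exact congrArg (fun g => g.hom t) (D.inc_proj i)

lemma finH_stk [HasDerivedCategory.{1} (ModuleCat.{0} Aᵐᵒᵖ)]
    (hA : HasFiniteGlobalDimension A) (S M : ModuleCat.{0} Aᵐᵒᵖ)
    [Module.Finite Aᵐᵒᵖ S] [Module.Finite Aᵐᵒᵖ M] : FinH R S (stk M) := by
  obtain ⟨n, hn⟩ := hA
  refine ⟨finite_ext R M S, fun k hk x => sstk_neg0 S M k hk x, n + 1, fun k hk x =>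
    hgl_of hn _ _ k (by push_cast at hk; lia) x⟩

lemma pd_of_gldim {B : Type 1} [Ring B] (hY : HasFiniteGlobalDimension B) : ∃ d : ℕ,
    ∀ M : ModuleCat.{1} Bᵐᵒᵖ, HasProjectiveDimensionLT M d := by
  obtain ⟨n, hn⟩ := hY
  refine ⟨n + 1, fun M => ?_⟩
  rw [hasProjectiveDimensionLT_iff]
  intro i hi Y e
  have := hn M Y i (by lia)
  exact Subsingleton.elim _ _

lemma tower' [HasDerivedCategory.{1} (ModuleCat.{0} Aᵐᵒᵖ)]
    (hA : HasFiniteGlobalDimension A) (S : ModuleCat.{0} Aᵐᵒᵖ)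
    [Module.Finite Aᵐᵒᵖ S] {ι : Type} [Fintype ι] (D : SSDec S ι)
    (hY : HasFiniteGlobalDimension (ExtRing S))
    (P : DerivedCategory (ModuleCat.{0} Aᵐᵒᵖ) → Prop)
    (hzero : ∀ N : DerivedCategory (ModuleCat.{0} Aᵐᵒᵖ),
      (∀ (k : ℤ) (x : N ⟶ sstk S k), x = 0) → P N)
    (hstep : ∀ (M M' : DerivedCategory (ModuleCat.{0} Aᵐᵒᵖ)) {α : Type} [Fintype α] (c : α → ι × ℕ)
      (v : M ⟶ cellSum D c) (w : cellSum D c ⟶ M') (δ : M' ⟶ M⟦(1 : ℤ)⟧),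
      Pretriangulated.Triangle.mk v w δ ∈
        Pretriangulated.distinguishedTriangles (C := DerivedCategory (ModuleCat.{0} Aᵐᵒᵖ)) →
      SurjS S v → FinH R S M → FinH R S M' → P M' → P M)
    (M : ModuleCat.{0} Aᵐᵒᵖ) [Module.Finite Aᵐᵒᵖ M] : P (stk M) := by
  have hM := finH_stk R hA S M
  obtain ⟨n, hn⟩ := hA
  obtain ⟨d, hd⟩ := pd_of_gldim hY
  refine tower D R n ?_ ?_ P hzero hstep d (stk M) hM (hd _)
  · intro j hj a
    have := hn S S j hj
    exact Subsingleton.elim _ _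
  · intro i k
    have := SSDec.finite D i
    exact finite_ext R _ _ k

theorem gldim_cor (R : Type) [CommRing R] [IsArtinianRing R] {A : Type} [Ring A] [Algebra R A]
    [Module.Finite R A] (f : A) (hf : IsIdempotentElem f) (hA : HasFiniteGlobalDimension A) (S : ModuleCat.{0} Aᵐᵒᵖ)
    [Module.Finite Aᵐᵒᵖ S] {ι : Type} [Fintype ι] (D : SSDec S ι)
    (hY : HasFiniteGlobalDimension (ExtRing S)) (hS : ∀ s : S, op f • s = 0)
    (hgen : ∀ (Z : Type) [AddCommGroup Z] [Module Aᵐᵒᵖ Z], (∀ z : Z, op f • z = 0) →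
      (∀ φ : Z →ₗ[Aᵐᵒᵖ] S, φ = 0) → ∀ z : Z, z = 0) :
    HasFiniteGlobalDimension (CornerRing f hf) := by
  let _ := HasDerivedCategory.standard (ModuleCat.{0} Aᵐᵒᵖ)
  let _ := HasDerivedCategory.standard (ModuleCat.{0} (CornerRing f hf)ᵐᵒᵖ)
  have hF := cor_coverHyp f hf S hS hgen
  obtain ⟨n, hn⟩ := id hA
  have hgl := hgl_of hn
  have hFS : IsZero ((corF f hf).obj S) := by
    have : Subsingleton ((corF f hf).obj S) := by
      refine ⟨fun a b => Subtype.ext ?_⟩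
      have h1 := (mem_cor f).1 a.2
      have h2 := (mem_cor f).1 b.2
      rw [hS] at h1 h2
      rw [← h1, ← h2]
    exact ModuleCat.isZero_of_subsingleton _
  have hP : P2 (corF f hf) (stk (ModuleCat.of Aᵐᵒᵖ Aᵐᵒᵖ)) := by
    refine tower' R hA S D hY (P2 (corF f hf)) (fun N hN => P2_zero hF N hN) ?_ _
    intro M M' α _ c v w δ hT _ _ _ hP'
    exact P2_step D n hgl hFS M M' c v w δ hT hP'
  obtain ⟨K, hK⟩ := hP ⟨⟨0, inferInstance⟩, n + 1, fun X k hk x => hgl _ _ _ (by lia) x⟩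
  have hpd : HasProjectiveDimensionLT ((corF f hf).obj (ModuleCat.of Aᵐᵒᵖ Aᵐᵒᵖ)) K.toNat := by
    rw [hasProjectiveDimensionLT_iff]
    intro i hi Y x
    obtain ⟨X, ⟨e⟩⟩ := corF_essSurj f hf Y
    apply Ext.homEquiv.injective
    refine Eq.trans ?_ (Ext.zero_hom _ _ _).symm
    let y : stk ((corF f hf).obj (ModuleCat.of Aᵐᵒᵖ Aᵐᵒᵖ)) ⟶ sstk Y i := Ext.homEquiv x
    change y = 0
    let t1 : (corF f hf).mapDerivedCategory.obj (stk (ModuleCat.of Aᵐᵒᵖ Aᵐᵒᵖ)) ≅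
        stk ((corF f hf).obj (ModuleCat.of Aᵐᵒᵖ Aᵐᵒᵖ)) :=
      (corF f hf).mapDerivedCategory.mapIso ((shiftFunctorZero _ ℤ).symm.app _) ≪≫
        fdIso (corF f hf) _ 0 ≪≫ (shiftFunctorZero _ ℤ).app _
    let t2 : sstk Y i ≅ (corF f hf).mapDerivedCategory.obj (sstk X i) :=
      (shiftFunctor _ (i : ℤ)).mapIso ((singleFunctor _ 0).mapIso e.symm) ≪≫
        (fdIso (corF f hf) X i).symm
    have h := hK X i (by lia) (t1.hom ≫ y ≫ t2.hom)
    rw [← cancel_epi t1.hom, ← cancel_mono t2.hom, Category.assoc, h]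
    simp
  refine ⟨K.toNat + n, fun M N i hi => ?_⟩
  obtain ⟨X, ⟨e⟩⟩ := corF_essSurj f hf M
  have h1 : HasProjectiveDimensionLT X (n + 1) := by
    rw [hasProjectiveDimensionLT_iff]
    intro i hi Y x
    have := hn X Y i (by lia)
    exact Subsingleton.elim _ _
  have h2 := pd_cor f hf _ hpd n X h1
  have h3 := hasProjectiveDimensionLT_of_iso e (K.toNat + n)
  exact HasProjectiveDimensionLT.subsingleton M (K.toNat + n) i hi.le N

end Main
end CDR
end

noncomputable section
namespace CDR
open MulOpposite (op unop)

/-- The quotient of a ring by its Jacobson radical. -/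
def Bq (A : Type) [Ring A] : Type := A ⧸ Ring.jacobson A

instance (A : Type) [Ring A] : Ring (Bq A) := inferInstanceAs (Ring (A ⧸ Ring.jacobson A))

/-- The projection onto the quotient by the radical. -/
def pq (A : Type) [Ring A] : A →+* Bq A := Ideal.Quotient.mk (Ring.jacobson A)

section
variable {A : Type} [Ring A]

lemma pq_surj : Function.Surjective (pq A) := Ideal.Quotient.mk_surjective

lemma pq_eq_zero {x : A} : pq A x = 0 ↔ x ∈ Ring.jacobson A := Ideal.Quotient.eq_zero_iff_mem

lemma mem_ringRadical {x : A} : x ∈ ringRadical A ↔ pq A x = 0 := by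
  rw [pq_eq_zero, ← Ideal.jacobson_bot, Ideal.mem_jacobson_iff]
  change x ∈ (⊥ : TwoSidedIdeal A).jacobson ↔ _
  rw [TwoSidedIdeal.mem_jacobson_iff]
  simp only [TwoSidedIdeal.mem_bot, Ideal.mem_bot]

lemma nil_swap {x y : A} (h : IsNilpotent (x * y)) : IsNilpotent (y * x) := by
  obtain ⟨k, hk⟩ := h
  refine ⟨k + 1, ?_⟩
  have : ∀ k : ℕ, (y * x) ^ (k + 1) = y * (x * y) ^ k * x := by
    intro k
    induction k with
    | zero => simp
    | succ k ih => rw [pow_succ, ih, pow_succ]; simp only [mul_assoc]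
  rw [this, hk, mul_zero, zero_mul]

lemma pq_zero_of_nil {x : A} (h : ∀ y, IsNilpotent (x * y)) : pq A x = 0 := by
  rw [pq_eq_zero, ← Ideal.jacobson_bot, Ideal.mem_jacobson_iff]
  intro y
  obtain ⟨u, hu⟩ := (nil_swap (h y)).isUnit_one_add
  refine ⟨↑u⁻¹, ?_⟩
  have : (↑u⁻¹ : A) * y * x + ↑u⁻¹ - 1 = ↑u⁻¹ * (1 + y * x) - 1 := by noncomm_ring
  rw [this, ← hu]; simp

variable [IsArtinianRing A]

lemma jac_nil : ∃ n : ℕ, (Ring.jacobson A) ^ n = ⊥ := by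
  obtain ⟨n, hn⟩ := IsArtinianRing.isNilpotent_jacobson_bot (R := A)
  rw [Ideal.jacobson_bot] at hn
  exact ⟨n, hn⟩

lemma nil_of_pq {x : A} (h : pq A x = 0) : IsNilpotent x := by
  obtain ⟨n, hn⟩ := jac_nil (A := A)
  refine ⟨n, ?_⟩
  have := Ideal.pow_mem_pow (pq_eq_zero.1 h) n
  rw [hn] at this
  simpa using this

lemma isUnit_of_pq {x : A} (h : pq A x = 1) : IsUnit x := by
  have : IsNilpotent (x - 1) := nil_of_pq (by rw [map_sub, h, map_one, sub_self])
  simpa using this.isUnit_one_add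

lemma idem_zero_of_pq {x : A} (hx : IsIdempotentElem x) (h : pq A x = 0) : x = 0 := by
  obtain ⟨n, hn⟩ := nil_of_pq h
  rcases n with _ | n
  · have : (1 : A) = 0 := by simpa using hn
    calc x = x * 1 := by simp
      _ = 0 := by rw [this, mul_zero]
  · rwa [hx.pow_succ_eq] at hn

/-- congruent idempotents are conjugate -/
lemma conj_of_pq {e f : A} (he : IsIdempotentElem e) (hf : IsIdempotentElem f)
    (h : pq A e = pq A f) : ∃ u : Aˣ, pq A u = 1 ∧ e * u = u * f := by
  have h1 : pq A (e * f + (1 - e) * (1 - f)) = 1 := by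
    have h2 : pq A f * pq A f = pq A f := by rw [← map_mul, hf.eq]
    simp only [map_add, map_mul, map_sub, map_one, h, mul_sub, sub_mul, one_mul, mul_one, h2]
    abel
  obtain ⟨u, hu⟩ := isUnit_of_pq h1
  refine ⟨u, by rw [hu, h1], ?_⟩
  rw [hu]
  simp only [mul_add, add_mul, mul_sub, sub_mul, one_mul, mul_one]
  rw [← mul_assoc, he.eq, mul_assoc, hf.eq]; abel

end

lemma fitting (R : Type) [CommRing R] [IsArtinianRing R] {A : Type} [Ring A] [Algebra R A]
    [Module.Finite R A] {f x : A} (hf : IsPrimitiveIdempotent f) (h1 : f * x = x) (h2 : x * f = x) :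
    IsNilpotent x ∨ ∃ z, x * z = f ∧ z * x = f ∧ f * z = z ∧ z * f = z := by
  -- powers of `x` stabilise
  haveI : IsNoetherian R A := inferInstance
  haveI : IsArtinian R A := inferInstance
  let c : ℕ →o (Submodule R A)ᵒᵈ :=
    { toFun := fun n => OrderDual.toDual ((Submodule.span R (Set.range (fun k : ℕ => x ^ (n + k)))))
      monotone' := by
        intro a b hab
        change Submodule.span R _ ≤ Submodule.span R _
        refine Submodule.span_mono ?_
        rintro _ ⟨k, rfl⟩
        exact ⟨b - a + k, by simp only; congr 1; omega⟩ }
  obtain ⟨n, hn⟩ := IsArtinian.monotone_stabilizes c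
  have hx : x ^ (n + 1) ∈ Submodule.span R (Set.range (fun k : ℕ => x ^ (2 * n + 2 + k))) := by
    have := hn (2 * n + 2) (by omega)
    have h3 : Submodule.span R (Set.range (fun k : ℕ => x ^ (n + k))) =
      Submodule.span R (Set.range (fun k : ℕ => x ^ (2 * n + 2 + k))) := this
    rw [← h3]
    exact Submodule.subset_span ⟨1, rfl⟩
  have hy : ∃ y, x ^ (n + 1) = x ^ (2 * n + 2) * y ∧ x * y = y * x := by
    have key : ∀ w ∈ Submodule.span R (Set.range (fun k : ℕ => x ^ (2 * n + 2 + k))),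
        ∃ y, w = x ^ (2 * n + 2) * y ∧ x * y = y * x := by
      intro w hw
      induction hw using Submodule.span_induction with
      | mem w hw =>
        obtain ⟨k, rfl⟩ := hw
        exact ⟨x ^ k, by simp only [pow_add], by rw [← pow_succ, ← pow_succ']⟩
      | zero => exact ⟨0, by simp, by simp⟩
      | add a b _ _ ha hb =>
        obtain ⟨p, rfl, hp⟩ := ha
        obtain ⟨q, rfl, hq⟩ := hb
        exact ⟨p + q, by rw [mul_add], by rw [mul_add, add_mul, hp, hq]⟩
      | smul r a _ ha =>
        obtain ⟨p, rfl, hp⟩ := ha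
        exact ⟨r • p, by simp, by simp [hp]⟩
    exact key _ hx
  obtain ⟨y, hy, hc⟩ := hy
  have hcm : Commute (x ^ (n + 1)) y := (show Commute x y from hc).pow_left _
  have e2 : x ^ (2 * n + 2) = x ^ (n + 1) * x ^ (n + 1) := by rw [← pow_add]; congr 1; omega
  set X := x ^ (n + 1) with hX
  have hXf : X * f = X := by rw [hX, pow_succ, mul_assoc, h2]
  have hfX : f * X = X := by rw [hX, pow_succ', ← mul_assoc, h1]
  have hfx : f * f = f := hf.1
  rw [e2] at hy
  -- `p = X y` is an idempotent
  have hp : (X * y) * (X * y) = X * y := by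
    calc (X * y) * (X * y) = X * (y * X) * y := by noncomm_ring
      _ = X * (X * y) * y := by rw [hcm.eq]
      _ = (X * X * y) * y := by noncomm_ring
      _ = X * y := by rw [← hy]
  have hpf : (X * y) * f = X * y := by rw [hcm.eq, mul_assoc, hXf]
  have hfp : f * (X * y) = X * y := by rw [← mul_assoc, hfX]
  rcases hf.2.2 (X * y) (f - X * y) hp
    (by
      change (f - X * y) * (f - X * y) = f - X * y
      rw [sub_mul, mul_sub, mul_sub, hfp, hpf, hp, hfx]; abel)
    (by rw [mul_sub, hpf, hp, sub_self]) (by rw [sub_mul, hfp, hp, sub_self])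
    (by abel) with h | h
  · left
    refine ⟨n + 1, ?_⟩
    rw [← hX, hy, mul_assoc, h, mul_zero]
  · right
    have h' : X * y = f := by rw [sub_eq_zero] at h; exact h.symm
    have hXx : X = x * x ^ n := by rw [hX, pow_succ']
    have hxx : x ^ n * y = y * x ^ n := ((show Commute x y from hc).pow_left n).eq
    have hA : x * (x ^ n * y) = f := by rw [← h', hXx, mul_assoc]
    have hB : (x ^ n * y) * x = f := by
      rw [mul_assoc, ← hc, ← mul_assoc, ← pow_succ, ← hX, h']
    refine ⟨f * (x ^ n * y) * f, ?_, ?_, ?_, ?_⟩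
    · rw [← mul_assoc, ← mul_assoc, h2, hA, hfx]
    · rw [mul_assoc, h1, mul_assoc, hB, hfx]
    · rw [← mul_assoc, ← mul_assoc, hfx]
    · rw [mul_assoc, hfx]

end CDR
end

noncomputable section
namespace CDR
open MulOpposite (op unop)

/-- complete families of orthogonal idempotents that are basic modulo the radical -/
structure BF {A : Type} [Ring A] {K : Type} [Fintype K] (F : K → A) : Prop where
  idem : ∀ i, IsIdempotentElem (F i)
  orth : ∀ i j, i ≠ j → F i * F j = 0
  sum : ∑ i, F i = 1
  cen : ∀ i (x : Bq A), pq A (F i) * x = x * pq A (F i)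
  div : ∀ i (x : Bq A), pq A (F i) * x ≠ 0 → ∃ z : Bq A, pq A (F i) * x * z = pq A (F i)
  ne : ∀ i, pq A (F i) ≠ 0

/-- the isomorphism of right ideals given by left multiplication -/
def rIso {A : Type} [Ring A] {f f' : A} (hf : IsIdempotentElem f) (hf' : IsIdempotentElem f')
    (a b : A) (ha : f * a = a) (hb : f' * b = b)
    (hab : a * b * f = f) (hba : b * a * f' = f') : rightIdeal A f' ≃ₗ[Aᵐᵒᵖ] rightIdeal A f where
  toFun x := ⟨a * x.1, (mem_rightIdeal hf).2 (by rw [← mul_assoc, ha])⟩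
  map_add' x y := Subtype.ext (mul_add _ _ _)
  map_smul' r x := Subtype.ext (by
    change a * (x.1 * r.unop) = a * x.1 * r.unop
    rw [mul_assoc])
  invFun x := ⟨b * x.1, (mem_rightIdeal hf').2 (by rw [← mul_assoc, hb])⟩
  left_inv x := Subtype.ext (by
    have := (mem_rightIdeal hf').1 x.2
    change b * (a * x.1) = x.1
    rw [← this, ← mul_assoc, ← mul_assoc, hba])
  right_inv x := Subtype.ext (by
    have := (mem_rightIdeal hf).1 x.2
    change a * (b * x.1) = x.1
    rw [← this, ← mul_assoc, ← mul_assoc, hab])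

section

lemma artA (R : Type) [CommRing R] [IsArtinianRing R] (A : Type) [Ring A] [Algebra R A]
    [Module.Finite R A] : IsArtinianRing A := by
  have : IsArtinian R A := inferInstance
  exact isArtinian_of_tower R this

lemma basicL1 (R : Type) [CommRing R] [IsArtinianRing R] {A : Type} [Ring A] [Algebra R A]
    [Module.Finite R A] {f f' a b : A} (hf : IsPrimitiveIdempotent f) (hf' : IsPrimitiveIdempotent f')
    (h : ¬ IsNilpotent ((f * a * f') * (f' * b * f))) :
    Nonempty (rightIdeal A f' ≃ₗ[Aᵐᵒᵖ] rightIdeal A f) := by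
  have hff : f * f = f := hf.1
  have hff' : f' * f' = f' := hf'.1
  set a' := f * a * f' with ha
  have a1 : f * a' = a' := by rw [ha, ← mul_assoc, ← mul_assoc, hff]
  have a2 : a' * f' = a' := by rw [ha, mul_assoc, hff']
  set b' := f' * b * f with hb
  have b1 : f' * b' = b' := by rw [hb, ← mul_assoc, ← mul_assoc, hff']
  have b2 : b' * f = b' := by rw [hb, mul_assoc, hff]
  rcases fitting R hf (x := a' * b') (by rw [← mul_assoc, a1]) (by rw [mul_assoc, b2]) with hn | hz
  · exact absurd hn h
  obtain ⟨z, z1, z2, z3, z4⟩ := hz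
  have c1 : a' * (b' * z) = f := by rw [← mul_assoc, z1]
  have c2 : f' * (b' * z) = b' * z := by rw [← mul_assoc, b1]
  have c3 : (b' * z) * f = b' * z := by rw [mul_assoc, z4]
  set q := b' * z with hq
  have p1 : (q * a') * (q * a') = q * a' := by
    rw [mul_assoc, ← mul_assoc a', c1, a1]
  have p2 : f' * (q * a') = q * a' := by rw [← mul_assoc, c2]
  have p3 : (q * a') * f' = q * a' := by rw [mul_assoc, a2]
  rcases hf'.2.2 (q * a') (f' - q * a') p1
    (by
      change (f' - q * a') * (f' - q * a') = f' - q * a'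
      rw [sub_mul, mul_sub, mul_sub, p2, p3, p1, hff']; abel)
    (by rw [mul_sub, p3, p1, sub_self]) (by rw [sub_mul, p2, p1, sub_self])
    (by abel) with h0 | h0
  · exfalso
    apply hf.2.1
    calc f = (a' * q) * (a' * q) := by rw [c1, hff]
      _ = a' * (q * a') * q := by noncomm_ring
      _ = 0 := by rw [h0, mul_zero, zero_mul]
  · have h1 : q * a' = f' := by rw [sub_eq_zero] at h0; exact h0.symm
    exact ⟨rIso hf.1 hf'.1 a' q a1 c2 (by rw [c1, hff]) (by rw [h1, hff'])⟩

theorem BF.of_basic (R : Type) [CommRing R] [IsArtinianRing R] {A : Type} [Ring A] [Algebra R A]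
    [Module.Finite R A] {n : ℕ} (f : Fin n → A) (hp : ∀ i, IsPrimitiveIdempotent (f i))
    (ho : ∀ i j, i ≠ j → f i * f j = 0) (hs : ∑ i, f i = 1)
    (hi : ∀ i j, i ≠ j → IsEmpty ((rightIdeal A (f i)) ≃ₗ[Aᵐᵒᵖ] (rightIdeal A (f j)))) :
    BF f := by
  have := artA R A
  have hff : ∀ i, f i * f i = f i := fun i => (hp i).1
  -- off-diagonal entries are radical
  have B1 : ∀ i j, i ≠ j → ∀ x : Bq A, pq A (f i) * x * pq A (f j) = 0 := by
    intro i j hij x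
    obtain ⟨x, rfl⟩ := pq_surj x
    rw [← map_mul, ← map_mul]
    apply pq_zero_of_nil
    intro y
    by_contra hn
    have h2 : ¬ IsNilpotent ((f i * x * f j) * (f j * y * f i)) := by
      intro h
      apply hn
      have h3 : IsNilpotent ((f i * x * f j * y) * f i) := by
        convert h using 1
        simp only [mul_assoc]; rw [← mul_assoc (f j) (f j), hff]
      have h4 := nil_swap h3
      convert h4 using 1
      simp only [← mul_assoc]; rw [hff]
    obtain ⟨E⟩ := basicL1 R (hp i) (hp j) h2
    exact (hi j i (Ne.symm hij)).false E
  have hsum : ∑ i, pq A (f i) = 1 := by rw [← map_sum, hs, map_one]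
  have cen : ∀ i (x : Bq A), pq A (f i) * x = x * pq A (f i) := by
    intro i x
    have h1 : pq A (f i) * x = pq A (f i) * x * pq A (f i) := by
      conv_lhs => rw [← mul_one (pq A (f i) * x), ← hsum, Finset.mul_sum]
      exact Finset.sum_eq_single_of_mem i (Finset.mem_univ _) fun j _ hj => B1 i j (Ne.symm hj) x
    have h2 : x * pq A (f i) = pq A (f i) * x * pq A (f i) := by
      conv_lhs => rw [← one_mul (x * pq A (f i)), ← hsum, Finset.sum_mul]
      rw [Finset.sum_eq_single_of_mem i (Finset.mem_univ _) fun j _ hj => by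
        rw [← mul_assoc]; exact B1 j i hj x]
      rw [mul_assoc]
    rw [h1, h2]
  refine ⟨fun i => (hp i).1, ho, hs, cen, ?_, ?_⟩
  · intro i x hx
    obtain ⟨x, rfl⟩ := pq_surj x
    have hx' : pq A (f i * x * f i) ≠ 0 := by
      rw [map_mul, map_mul, mul_assoc, ← cen, ← mul_assoc, ← map_mul, hff]; exact hx
    have : ∃ y, ¬ IsNilpotent (f i * x * f i * y) := by
      by_contra hc
      push Not at hc
      exact hx' (pq_zero_of_nil hc)
    obtain ⟨y, hy⟩ := this
    have hy2 : ¬ IsNilpotent (f i * x * f i * y * f i) := by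
      intro h
      apply hy
      have h4 := nil_swap h
      convert h4 using 1
      simp only [← mul_assoc]; rw [hff]
    rcases fitting R (hp i) (x := f i * x * f i * y * f i)
      (by simp only [← mul_assoc]; rw [hff]) (by rw [mul_assoc, hff]) with h | ⟨z, hz, -⟩
    · exact absurd h hy2
    · refine ⟨pq A (f i * y * f i * z), ?_⟩
      rw [← map_mul, ← map_mul]
      refine (congrArg (pq A) ?_).trans (congrArg (pq A) hz)
      simp only [mul_assoc]
  · intro i h
    exact (hp i).2.1 (idem_zero_of_pq (hp i).1 h)

section
variable {A : Type} [Ring A] {K : Type} [Fintype K] {F : K → A}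

lemma BF.idemB (hF : BF F) (i : K) : pq A (F i) * pq A (F i) = pq A (F i) := by
  rw [← map_mul, (hF.idem i).eq]

/-- idempotents modulo the radical -/
lemma BF.idem_decomp (hF : BF F) {e : A} (he : IsIdempotentElem e) :
    ∃ I : Finset K, pq A e = ∑ i ∈ I, pq A (F i) := by
  classical
  refine ⟨Finset.univ.filter (fun i => pq A (F i) * pq A e ≠ 0), ?_⟩
  have hsum : ∑ i, pq A (F i) = 1 := by rw [← map_sum, hF.sum, map_one]
  have he' : pq A e * pq A e = pq A e := by rw [← map_mul, he.eq]
  conv_lhs => rw [← one_mul (pq A e), ← hsum, Finset.sum_mul]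
  rw [← Finset.sum_filter_ne_zero]
  refine Finset.sum_congr rfl fun i hi => ?_
  have hi' : pq A (F i) * pq A e ≠ 0 := by simpa using hi
  obtain ⟨z, hz⟩ := hF.div i _ hi'
  set β := pq A (F i)
  have hβ : β * β = β := hF.idemB i
  have h1 : (β * pq A e) * (β * pq A e) = β * pq A e := by
    rw [mul_assoc, ← mul_assoc _ β, ← hF.cen, mul_assoc, he', ← mul_assoc, hβ]
  calc β * pq A e = β * (pq A e * β) := by rw [← hF.cen i, ← mul_assoc, hβ]
    _ = (β * pq A e) * (β * pq A e * z) := by rw [hz, mul_assoc]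
    _ = (β * pq A e * (β * pq A e)) * z := by simp only [mul_assoc]
    _ = β := by rw [h1, hz]

lemma sum_idem {α : Type} (s : Finset α) (h : α → A) (hi : ∀ i, IsIdempotentElem (h i))
    (ho : ∀ i j, i ≠ j → h i * h j = 0) (i : α) (his : i ∈ s) :
    h i * ∑ j ∈ s, h j = h i ∧ (∑ j ∈ s, h j) * h i = h i := by
  constructor
  · rw [Finset.mul_sum, Finset.sum_eq_single_of_mem i his fun j _ hj => ho i j (Ne.symm hj), (hi i).eq]
  · rw [Finset.sum_mul, Finset.sum_eq_single_of_mem i his fun j _ hj => ho j i hj, (hi i).eq]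

/-- lifting the decomposition -/
lemma BF.lift_decomp [IsArtinianRing A] (hF : BF F) {e : A} (he : IsIdempotentElem e) :
    ∃ (I : Finset K) (h : K → A), (∀ i, IsIdempotentElem (h i)) ∧
      (∀ i j, i ≠ j → h i * h j = 0) ∧ (∀ i, pq A (h i) = pq A (F i)) ∧ ∑ i ∈ I, h i = e := by
  obtain ⟨I, hI⟩ := hF.idem_decomp he
  have hs : IsIdempotentElem (∑ i ∈ I, F i) := by
    change _ * _ = _
    rw [Finset.sum_mul]
    exact Finset.sum_congr rfl fun i hi => (sum_idem I F hF.idem hF.orth i hi).1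
  obtain ⟨u, hu1, hu2⟩ := conj_of_pq he hs (by rw [hI, map_sum])
  have hui : pq A ((u⁻¹ : Aˣ) : A) = 1 := by
    have : pq A (u * (u⁻¹ : Aˣ)) = 1 := by simp
    rwa [map_mul, hu1, one_mul] at this
  refine ⟨I, fun i => u * F i * (u⁻¹ : Aˣ), ?_, ?_, ?_, ?_⟩
  · intro i
    change (u * F i * (u⁻¹ : Aˣ)) * (u * F i * (u⁻¹ : Aˣ)) = _
    simp only [mul_assoc, Units.inv_mul_cancel_left]
    rw [← mul_assoc (F i), (hF.idem i).eq]
  · intro i j hij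
    simp only [mul_assoc, Units.inv_mul_cancel_left]
    rw [← mul_assoc (F i), hF.orth i j hij]; simp
  · intro i
    rw [map_mul, map_mul, hu1, hui]; simp
  · rw [← Finset.sum_mul, ← Finset.mul_sum, ← hu2, mul_assoc, Units.mul_inv, mul_one]

/-- a primitive idempotent is congruent to a member of the family -/
lemma BF.prim [IsArtinianRing A] (hF : BF F) {e : A} (he : IsPrimitiveIdempotent e) :
    ∃ k, pq A e = pq A (F k) := by
  obtain ⟨I, h, hi, ho, hπ, hs⟩ := hF.lift_decomp he.1
  have hne : I.Nonempty := by
    rw [Finset.nonempty_iff_ne_empty]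
    rintro rfl
    exact he.2.1 (by rw [← hs, Finset.sum_empty])
  obtain ⟨k, hk⟩ := hne
  obtain ⟨h1, h2⟩ := sum_idem I h hi ho k hk
  rw [hs] at h1 h2
  refine ⟨k, ?_⟩
  rw [← hπ]
  rcases he.2.2 (h k) (e - h k) (hi k)
    (by
      change (e - h k) * (e - h k) = e - h k
      rw [sub_mul, mul_sub, mul_sub, h1, h2, (hi k).eq, he.1.eq]; abel)
    (by rw [mul_sub, h1, (hi k).eq, sub_self]) (by rw [sub_mul, h2, (hi k).eq, sub_self])
    (by abel) with h0 | h0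
  · exact absurd (by rw [← hπ, h0, map_zero]) (hF.ne k)
  · rw [sub_eq_zero] at h0; rw [h0]

lemma BF.transfer (hF : BF F) {L : Type} [Fintype L] (G : L → A) (σ : L → K)
    (hG : ∀ l, pq A (G l) = pq A (F (σ l))) (hi : ∀ l, IsIdempotentElem (G l))
    (ho : ∀ i j, i ≠ j → G i * G j = 0) (hs : ∑ i, G i = 1) : BF G where
  idem := hi
  orth := ho
  sum := hs
  cen i x := by rw [hG]; exact hF.cen _ x
  div i x := by rw [hG]; exact hF.div _ x
  ne i := by rw [hG]; exact hF.ne _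

lemma BF.bij (hF : BF F) {L : Type} [Fintype L] {G : L → A} (hGG : BF G) (σ : L → K)
    (hG : ∀ l, pq A (G l) = pq A (F (σ l))) : Function.Bijective σ := by
  constructor
  · intro a b hab
    by_contra hne
    have := hGG.orth a b hne
    have h2 : pq A (G a) * pq A (G b) = 0 := by rw [← map_mul, this, map_zero]
    rw [hG a, hG b, hab, hF.idemB] at h2
    exact hF.ne _ h2
  · intro k
    by_contra hk
    push Not at hk
    apply hF.ne k
    have h1 : pq A (F k) = pq A (F k) * ∑ l, pq A (G l) := by
      rw [← map_sum, hGG.sum, map_one, mul_one]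
    rw [h1, Finset.mul_sum]
    refine Finset.sum_eq_zero fun l _ => ?_
    rw [hG, ← map_mul, hF.orth k _ (Ne.symm (hk l)), map_zero]
end
end
end CDR
end

noncomputable section
namespace CDR
open MulOpposite (op unop)

section
variable {A : Type} [Ring A]

instance bqMod (A : Type) [Ring A] : Module Aᵐᵒᵖ (Bq A) := Module.compHom (Bq A) (RingHom.op (pq A))

lemma bq_smul (a : A) (y : Bq A) : op a • y = y * pq A a := rfl

/-- the right ideal of the semisimple quotient given by an idempotent -/
def Qm (b : Bq A) : Submodule Aᵐᵒᵖ (Bq A) where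
  carrier := {y | b * y = y}
  add_mem' {x y} hx hy := by
    change b * x = x at hx
    change b * y = y at hy
    change b * (x + y) = x + y
    rw [mul_add, hx, hy]
  zero_mem' := mul_zero b
  smul_mem' r x hx := by
    change b * x = x at hx
    change b * (x * pq A r.unop) = x * pq A r.unop
    rw [← mul_assoc, hx]

lemma mem_Qm {b y : Bq A} : y ∈ Qm b ↔ b * y = y := Iff.rfl

/-- the projection as a linear map -/
def pqL (A : Type) [Ring A] : A →ₗ[Aᵐᵒᵖ] Bq A where
  toFun := pq A
  map_add' := map_add _
  map_smul' r x := map_mul (pq A) x r.unop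

lemma mem_eRad {e : A} (he : IsIdempotentElem e) {x : A} :
    x ∈ eRad A e ↔ e * x = x ∧ pq A x = 0 := by
  constructor
  · intro h
    induction h using Submodule.span_induction with
    | mem x hx =>
      obtain ⟨y, hy, rfl⟩ := hx
      refine ⟨by simp only [← mul_assoc, he.eq], ?_⟩
      simp only [map_mul, mem_ringRadical.1 hy, mul_zero]
    | zero => simp
    | add x y _ _ hx hy =>
      exact ⟨by rw [mul_add, hx.1, hy.1], by rw [map_add, hx.2, hy.2, add_zero]⟩
    | smul r x _ hx =>
      refine ⟨?_, ?_⟩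
      · change e * (x * r.unop) = x * r.unop
        rw [← mul_assoc, hx.1]
      · change pq A (x * r.unop) = 0
        rw [map_mul, hx.2, zero_mul]
  · rintro ⟨h1, h2⟩
    exact Submodule.subset_span ⟨x, mem_ringRadical.2 h2, h1⟩

/-- the projection on a right ideal -/
def pqR {e : A} (he : IsIdempotentElem e) : rightIdeal A e →ₗ[Aᵐᵒᵖ] Qm (pq A e) :=
  ((pqL A).comp (rightIdeal A e).subtype).codRestrict _ (by
    rintro ⟨x, hx⟩
    change pq A e * pq A x = pq A x
    rw [← map_mul, (mem_rightIdeal he).1 hx])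

lemma pqR_surj {e : A} (he : IsIdempotentElem e) : Function.Surjective (pqR he) := by
  rintro ⟨y, hy⟩
  obtain ⟨x, rfl⟩ := pq_surj y
  refine ⟨⟨e * x, (mem_rightIdeal he).2 (by rw [← mul_assoc, he.eq])⟩, Subtype.ext ?_⟩
  change pq A (e * x) = _
  rw [map_mul]; exact hy

lemma pqR_ker {e : A} (he : IsIdempotentElem e) :
    (eRad A e).comap (rightIdeal A e).subtype = LinearMap.ker (pqR he) := by
  ext x
  rw [Submodule.mem_comap, LinearMap.mem_ker, mem_eRad he]
  have := (mem_rightIdeal he).1 x.2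
  constructor
  · intro h; exact Subtype.ext h.2
  · intro h; exact ⟨this, congrArg Subtype.val h⟩

/-- the module `S_e` as a right ideal of the semisimple quotient -/
def seEquiv {e : A} (he : IsIdempotentElem e) : SeModule A e ≃ₗ[Aᵐᵒᵖ] Qm (pq A e) :=
  (Submodule.quotEquivOfEq _ _ (pqR_ker he)).trans
    ((pqR he).quotKerEquivOfSurjective (pqR_surj he))

/-- modules killed by the radical -/
lemma theta_ex {V : Type} [AddCommGroup V] [Module Aᵐᵒᵖ V]
    (hV : ∀ (a : A) (v : V), pq A a = 0 → op a • v = 0) (v : V) :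
    ∃ θ : Bq A →ₗ[Aᵐᵒᵖ] V, ∀ a, θ (pq A a) = op a • v := by
  let g : A →ₗ[Aᵐᵒᵖ] V := rmul V v
  have hk : LinearMap.ker (pqL A) ≤ LinearMap.ker g := fun a ha => hV a v ha
  refine ⟨((LinearMap.ker (pqL A)).liftQ g hk).comp
    ((pqL A).quotKerEquivOfSurjective pq_surj).symm.toLinearMap, fun a => ?_⟩
  have : ((pqL A).quotKerEquivOfSurjective pq_surj).symm (pq A a) = Submodule.Quotient.mk a := by
    rw [LinearEquiv.symm_apply_eq]; rfl
  change (LinearMap.ker (pqL A)).liftQ g hk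
    (((pqL A).quotKerEquivOfSurjective pq_surj).symm (pq A a)) = _
  rw [this]; rfl

/-- the submodule `Z J` -/
def radM (Z : Type) [AddCommGroup Z] [Module Aᵐᵒᵖ Z] : Submodule Aᵐᵒᵖ Z :=
  Submodule.span Aᵐᵒᵖ {z | ∃ (a : A) (y : Z), pq A a = 0 ∧ z = op a • y}

lemma radM_kill {Z : Type} [AddCommGroup Z] [Module Aᵐᵒᵖ Z] (a : A) (v : Z ⧸ radM (A := A) Z)
    (h : pq A a = 0) : op a • v = 0 := by
  obtain ⟨z, rfl⟩ := Submodule.Quotient.mk_surjective _ v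
  rw [← Submodule.Quotient.mk_smul, Submodule.Quotient.mk_eq_zero]
  exact Submodule.subset_span ⟨a, z, h, rfl⟩

lemma radM_ne [IsArtinianRing A] {Z : Type} [AddCommGroup Z] [Module Aᵐᵒᵖ Z]
    (h : radM (A := A) Z = ⊤) (z : Z) : z = 0 := by
  obtain ⟨n, hn⟩ := jac_nil (A := A)
  -- every element is a sum of `y • j` with `j ∈ J ^ k`
  have key : ∀ k : ℕ, ∀ z : Z, z ∈ AddSubgroup.closure
      {z : Z | ∃ (a : A) (y : Z), a ∈ (Ring.jacobson A) ^ k ∧ z = op a • y} := by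
    intro k
    induction k with
    | zero => exact fun z => AddSubgroup.subset_closure ⟨1, z, by
        simpa using Ideal.pow_mem_pow (zero_mem (Ring.jacobson A)) 0, by simp⟩
    | succ k ih =>
      intro z
      have hz : z ∈ radM (A := A) Z := by rw [h]; trivial
      induction hz using Submodule.span_induction with
      | mem z hz =>
        obtain ⟨a, y, ha, rfl⟩ := hz
        have hy := ih y
        induction hy using AddSubgroup.closure_induction with
        | mem y hy =>
          obtain ⟨b, y, hb, rfl⟩ := hy
          refine AddSubgroup.subset_closure ⟨b * a, y, ?_, op_smul_smul _ _ _⟩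
          rw [Submodule.pow_succ]
          exact Ideal.mul_mem_mul hb (pq_eq_zero.1 ha)
        | zero => rw [smul_zero]; exact zero_mem _
        | add x y _ _ hx hy => rw [smul_add]; exact add_mem hx hy
        | neg x _ hx => rw [smul_neg]; exact neg_mem hx
      | zero => exact zero_mem _
      | add x y _ _ hx hy => exact add_mem hx hy
      | smul r x hxm hx =>
        clear hxm
        induction hx using AddSubgroup.closure_induction with
        | mem y hy =>
          obtain ⟨b, y, hb, rfl⟩ := hy
          refine AddSubgroup.subset_closure ⟨b * r.unop, y, ?_, op_smul_smul _ _ _⟩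
          exact Ideal.mul_mem_right _ _ hb
        | zero => rw [smul_zero]; exact zero_mem _
        | add x y _ _ hx hy => rw [smul_add]; exact add_mem hx hy
        | neg x _ hx => rw [smul_neg]; exact neg_mem hx
  have hz := key n z
  rw [hn] at hz
  induction hz using AddSubgroup.closure_induction with
  | mem y hy =>
    obtain ⟨b, y, hb, rfl⟩ := hy
    have hb' : b = 0 := by simpa using hb
    rw [hb']; simp
  | zero => rfl
  | add x y _ _ hx hy => rw [hx, hy, add_zero]
  | neg x _ hx => rw [hx, neg_zero]

variable {K : Type} [Fintype K] {F : K → A}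

lemma BF.simple (hF : BF F) (i : K) : IsSimpleModule Aᵐᵒᵖ (Qm (pq A (F i))) := by
  rw [isSimpleModule_iff_toSpanSingleton_surjective]
  constructor
  · refine ⟨⟨⟨pq A (F i), hF.idemB i⟩, 0, ?_⟩⟩
    intro h
    exact hF.ne i (congrArg Subtype.val h)
  · rintro ⟨x, hx⟩ hne ⟨y, hy⟩
    have hx' : pq A (F i) * x ≠ 0 := by
      rw [mem_Qm.1 hx]; intro h; exact hne (Subtype.ext h)
    obtain ⟨z, hz⟩ := hF.div i x hx'
    obtain ⟨a, ha⟩ := pq_surj (z * y)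
    refine ⟨op a, Subtype.ext ?_⟩
    change x * pq A a = y
    rw [mem_Qm.1 hx] at hz
    rw [ha, ← mul_assoc, hz, mem_Qm.1 hy]

lemma BF.hom_zero (hF : BF F) {i j : K} (hij : i ≠ j)
    (φ : Qm (pq A (F i)) →ₗ[Aᵐᵒᵖ] Qm (pq A (F j))) : φ = 0 := by
  ext x
  obtain ⟨x, hx⟩ := x
  have h1 : op (F i) • (⟨x, hx⟩ : Qm (pq A (F i))) = ⟨x, hx⟩ := Subtype.ext (by
    change x * pq A (F i) = x
    rw [← hF.cen, mem_Qm.1 hx])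
  rw [← h1, map_smul]
  obtain ⟨y, hy⟩ := φ ⟨x, hx⟩
  change y * pq A (F i) = 0
  rw [← mem_Qm.1 hy, mul_assoc, ← hF.cen i, ← mul_assoc, ← map_mul,
    hF.orth j i (Ne.symm hij), map_zero, zero_mul]

lemma BF.dec (hF : BF F) {V : Type} [AddCommGroup V] [Module Aᵐᵒᵖ V] (v : V) :
    v = ∑ k, op (F k) • v := by
  rw [← Finset.sum_smul]
  have : ∑ k, op (F k) = (1 : Aᵐᵒᵖ) := by
    rw [← MulOpposite.op_one, ← hF.sum]
    exact (map_sum MulOpposite.opAddEquiv F Finset.univ).symm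
  rw [this, one_smul]

lemma BF.theta (hF : BF F) {V : Type} [AddCommGroup V] [Module Aᵐᵒᵖ V]
    (hV : ∀ (a : A) (v : V), pq A a = 0 → op a • v = 0) (v : V) (k : K) :
    ∃ θ : Qm (pq A (F k)) →ₗ[Aᵐᵒᵖ] V, θ ⟨pq A (F k), hF.idemB k⟩ = op (F k) • v := by
  obtain ⟨θ, hθ⟩ := theta_ex hV v
  exact ⟨θ.comp (Submodule.subtype _), hθ _⟩

/-- every simple module is one of the standard ones -/
lemma BF.simple_iso [IsArtinianRing A] (hF : BF F) (T : Type) [AddCommGroup T] [Module Aᵐᵒᵖ T]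
    [IsSimpleModule Aᵐᵒᵖ T] : ∃ k, Nonempty (Qm (pq A (F k)) ≃ₗ[Aᵐᵒᵖ] T) := by
  have : Nontrivial T := IsSimpleModule.nontrivial Aᵐᵒᵖ T
  have hr : radM (A := A) T = ⊥ := by
    rcases eq_bot_or_eq_top (radM (A := A) T) with h | h
    · exact h
    · obtain ⟨t, ht⟩ := exists_ne (0 : T)
      exact absurd (radM_ne h t) ht
  have hV : ∀ (a : A) (v : T), pq A a = 0 → op a • v = 0 := by
    intro a v h
    have : op a • v ∈ radM (A := A) T := Submodule.subset_span ⟨a, v, h, rfl⟩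
    rw [hr] at this
    simpa using this
  obtain ⟨t, ht⟩ := exists_ne (0 : T)
  have : ∃ k, op (F k) • t ≠ 0 := by
    by_contra hc
    push Not at hc
    apply ht
    rw [hF.dec t]
    exact Finset.sum_eq_zero fun k _ => hc k
  obtain ⟨k, hk⟩ := this
  obtain ⟨θ, hθ⟩ := hF.theta hV t k
  have hs := hF.simple k
  have hb : Function.Bijective θ := LinearMap.bijective_of_ne_zero (by
    rintro rfl
    exact hk (by rw [← hθ]; rfl))
  exact ⟨k, ⟨LinearEquiv.ofBijective θ hb⟩⟩

lemma BF.semisimple (hF : BF F) {V : Type} [AddCommGroup V] [Module Aᵐᵒᵖ V]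
    (hV : ∀ (a : A) (v : V), pq A a = 0 → op a • v = 0) : IsSemisimpleModule Aᵐᵒᵖ V := by
  apply IsSemisimpleModule.of_sSup_simples_eq_top
  rw [eq_top_iff]
  intro v _
  rw [hF.dec v]
  refine Submodule.sum_mem _ fun k _ => ?_
  by_cases hk : op (F k) • v = 0
  · rw [hk]; exact zero_mem _
  obtain ⟨θ, hθ⟩ := hF.theta hV v k
  have hs := hF.simple k
  have hinj : Function.Injective θ := by
    rcases LinearMap.injective_or_eq_zero θ with h | h
    · exact h
    · exact absurd (by rw [← hθ, h]; rfl) hk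
  have : IsSimpleModule Aᵐᵒᵖ (LinearMap.range θ) :=
    IsSimpleModule.congr (LinearEquiv.ofInjective θ hinj).symm
  refine Submodule.mem_sSup_of_mem (s := LinearMap.range θ) this ?_
  rw [← hθ]
  exact ⟨_, rfl⟩

/-- nonzero maps into a sum of simples -/
lemma BF.gen [IsArtinianRing A] (hF : BF F) {e : A} (he : IsIdempotentElem e) (I : K → Prop)
    (hI : ∀ k, I k → pq A e * pq A (F k) = pq A (F k))
    (hI' : ∀ k, ¬ I k → (1 - e) * F k = F k)
    (Z : Type) [AddCommGroup Z] [Module Aᵐᵒᵖ Z]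
    (hZ : ∀ z : Z, op (1 - e) • z = 0) (h0 : ∀ φ : Z →ₗ[Aᵐᵒᵖ] SeModule A e, φ = 0) (z : Z) :
    z = 0 := by
  refine radM_ne (A := A) ?_ z
  rw [eq_top_iff]
  intro z _
  by_contra hz
  have hz' : (Submodule.Quotient.mk z : Z ⧸ radM (A := A) Z) ≠ 0 := by
    rwa [Ne, Submodule.Quotient.mk_eq_zero]
  have hss := hF.semisimple (V := Z ⧸ radM (A := A) Z) radM_kill
  have : ∃ k, op (F k) • (Submodule.Quotient.mk z : Z ⧸ radM (A := A) Z) ≠ 0 := by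
    by_contra hc
    push Not at hc
    apply hz'
    rw [hF.dec (Submodule.Quotient.mk z : Z ⧸ radM (A := A) Z)]
    exact Finset.sum_eq_zero fun k _ => hc k
  obtain ⟨k, hk⟩ := this
  have hIk : I k := by
    by_contra hc
    apply hk
    rw [← Submodule.Quotient.mk_smul, ← hI' k hc, ← op_smul_smul, hZ, smul_zero,
      Submodule.Quotient.mk_zero]
  obtain ⟨θ, hθ⟩ := hF.theta radM_kill (Submodule.Quotient.mk z : Z ⧸ radM (A := A) Z) k
  have hs := hF.simple k
  have hinj : Function.Injective θ := by
    rcases LinearMap.injective_or_eq_zero θ with h | h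
    · exact h
    · exact absurd (by rw [← hθ, h]; rfl) hk
  have hle : Qm (pq A (F k)) ≤ Qm (pq A e) := by
    intro y hy
    rw [mem_Qm] at hy ⊢
    rw [← hy, ← mul_assoc, hI k hIk]
  obtain ⟨φ, hφ⟩ := IsSemisimpleModule.extension_property θ hinj
    ((seEquiv he).symm.toLinearMap.comp (Submodule.inclusion hle))
  have h1 := h0 (φ.comp (Submodule.mkQ _))
  have h2 : φ = 0 := by
    ext y
    exact LinearMap.congr_fun h1 y
  have h3 := LinearMap.congr_fun hφ ⟨pq A (F k), hF.idemB k⟩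
  rw [h2] at h3
  have h4 : (seEquiv he).symm (Submodule.inclusion hle ⟨pq A (F k), hF.idemB k⟩) = 0 := h3.symm
  rw [LinearEquiv.map_eq_zero_iff] at h4
  exact hF.ne k (congrArg Subtype.val h4)

lemma BF.kill (hF : BF F) {e : A} (he : IsIdempotentElem e) (s : SeModule A e) :
    op (1 - e) • s = 0 := by
  apply (seEquiv he).injective
  rw [map_smul, map_zero]
  obtain ⟨y, hy⟩ := seEquiv he s
  apply Subtype.ext
  change y * pq A (1 - e) = 0
  obtain ⟨I, hI⟩ := hF.idem_decomp he
  have hc : pq A e * y = y * pq A e := by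
    rw [hI, Finset.sum_mul, Finset.mul_sum]
    exact Finset.sum_congr rfl fun i _ => hF.cen i y
  rw [map_sub, map_one, mul_sub, mul_one, ← hc, mem_Qm.1 hy, sub_self]
end
end CDR
end

noncomputable section
namespace CDR
open MulOpposite (op unop)

/-- the simple modules -/
def SI {A : Type} [Ring A] {K : Type} (F : K → A) (k : K) : ModuleCat.{0} Aᵐᵒᵖ :=
  ModuleCat.of Aᵐᵒᵖ (Qm (pq A (F k)))

section
variable {A : Type} [Ring A] {K : Type} [Fintype K] {F : K → A}

/-- left multiplication by a central element -/
def lmulQ {b c : Bq A} (hbc : ∀ y, c * (c * y) = c * y) : Qm b →ₗ[Aᵐᵒᵖ] Qm c where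
  toFun y := ⟨c * y.1, hbc _⟩
  map_add' x y := Subtype.ext (mul_add _ _ _)
  map_smul' r x := Subtype.ext (by
    change c * (x.1 * pq A r.unop) = c * x.1 * pq A r.unop
    rw [mul_assoc])

lemma BF.lmul_idem (hF : BF F) (i : K) (y : Bq A) :
    pq A (F i) * (pq A (F i) * y) = pq A (F i) * y := by rw [← mul_assoc, hF.idemB]

lemma BF.le_sum (hF : BF F) {ι : Type} [Fintype ι] (σ : ι → K) (hσ : Function.Injective σ)
    (i : ι) : pq A (∑ i, F (σ i)) * pq A (F (σ i)) = pq A (F (σ i)) := by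
  rw [← map_mul, (sum_idem Finset.univ (fun i => F (σ i)) (fun i => hF.idem _)
    (fun i j hij => hF.orth _ _ (fun h => hij (hσ h))) i (Finset.mem_univ _)).2]

/-- the decomposition of `S_e` into simples -/
def BF.ssdec (hF : BF F) {e : A} (he : IsIdempotentElem e) {ι : Type} [Fintype ι] (σ : ι → K)
    (hσ : Function.Injective σ) (hs : ∑ i, F (σ i) = e) : SSDec (Se A e) ι := by
  have hle : ∀ i, Qm (pq A (F (σ i))) ≤ Qm (pq A e) := by
    intro i y hy
    rw [mem_Qm] at hy ⊢
    rw [← hy, ← mul_assoc, ← hs, hF.le_sum σ hσ]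
  let inc : ∀ i, SI F (σ i) ⟶ Se A e := fun i =>
    ModuleCat.ofHom ((seEquiv he).symm.toLinearMap.comp (Submodule.inclusion (hle i)))
  let proj : ∀ i, Se A e ⟶ SI F (σ i) := fun i =>
    ModuleCat.ofHom ((lmulQ (hF.lmul_idem (σ i))).comp (seEquiv he).toLinearMap)
  have inc_proj : ∀ i, inc i ≫ proj i = 𝟙 _ := by
    intro i
    ext y
    obtain ⟨y, hy⟩ := y
    change lmulQ (hF.lmul_idem (σ i)) (seEquiv he ((seEquiv he).symm
      (Submodule.inclusion (hle i) ⟨y, hy⟩))) = _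
    rw [LinearEquiv.apply_symm_apply]
    exact Subtype.ext (mem_Qm.1 hy)
  have sum_proj_inc : ∑ i, proj i ≫ inc i = 𝟙 (Se A e) := by
    apply ModuleCat.hom_ext
    apply LinearMap.ext
    intro s
    rw [ModuleCat.hom_sum, LinearMap.sum_apply]
    apply (seEquiv he).injective
    have h1 : ∀ i, seEquiv he ((proj i ≫ inc i).hom s) =
        Submodule.inclusion (hle i) (lmulQ (hF.lmul_idem (σ i)) (seEquiv he s)) := fun i =>
      (seEquiv he).apply_symm_apply _
    have h2 : seEquiv he (∑ i, (proj i ≫ inc i).hom s) =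
        ∑ i, Submodule.inclusion (hle i) (lmulQ (hF.lmul_idem (σ i)) (seEquiv he s)) := 
      (map_sum (seEquiv he) _ _).trans (Finset.sum_congr rfl fun i _ => h1 i)
    refine h2.trans ?_
    change _ = seEquiv he s
    obtain ⟨y, hy⟩ := seEquiv he s
    apply Subtype.ext
    rw [AddSubmonoidClass.coe_finsetSum]
    change ∑ i, pq A (F (σ i)) * y = y
    rw [← Finset.sum_mul, ← map_sum, hs]
    exact hy
  refine ⟨fun i => SI F (σ i), inc, proj, inc_proj, sum_proj_inc, ?_⟩
  intro i u hu
  have hne : u ≫ proj i ≠ 0 := by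
    intro h0
    apply hu
    rw [← Category.comp_id u, ← sum_proj_inc, Preadditive.comp_sum]
    refine Finset.sum_eq_zero fun j _ => ?_
    by_cases hij : j = i
    · subst hij; rw [← Category.assoc, h0, Limits.zero_comp]
    · have : (u ≫ proj j).hom = 0 := hF.hom_zero (fun h => hij (hσ h).symm) (u ≫ proj j).hom
      have h2 : u ≫ proj j = 0 := ModuleCat.hom_ext this
      rw [← Category.assoc, h2, Limits.zero_comp]
  have hsi := hF.simple (σ i)
  let φ : Qm (pq A (F (σ i))) →ₗ[Aᵐᵒᵖ] Qm (pq A (F (σ i))) := (u ≫ proj i).hom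
  have hφ : φ ≠ 0 := fun h => hne (ModuleCat.hom_ext h)
  have hb' : Function.Bijective φ := LinearMap.bijective_of_ne_zero hφ
  have hb : Function.Bijective (u ≫ proj i).hom := hb'
  have : IsIso (u ≫ proj i) := (ConcreteCategory.isIso_iff_bijective _).2 hb
  exact ⟨proj i ≫ inv (u ≫ proj i), by rw [← Category.assoc, IsIso.hom_inv_id]⟩

@[simp] lemma BF.ssdec_T (hF : BF F) {e : A} (he : IsIdempotentElem e) {ι : Type} [Fintype ι]
    (σ : ι → K) (hσ : Function.Injective σ) (hs : ∑ i, F (σ i) = e) (i : ι) :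
    (hF.ssdec he σ hσ hs).T i = SI F (σ i) := rfl

end
end CDR
end

noncomputable section
namespace CDR
open MulOpposite (op unop)

lemma length_semilinear {S T M N : Type} [Ring S] [Ring T] [AddCommGroup M] [AddCommGroup N]
    [Module S M] [Module T N] (σ : S ≃+* T) (φ : M ≃+ N) (h : ∀ (s : S) m, φ (s • m) = σ s • φ m) :
    Module.length S M = Module.length T N := by
  have : RingHomInvPair (σ : S →+* T) (σ.symm : T →+* S) := RingHomInvPair.of_ringEquiv σ
  have : RingHomInvPair (σ.symm : T →+* S) (σ : S →+* T) := RingHomInvPair.symm _ _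
  let E : M ≃ₛₗ[(σ : S →+* T)] N := { φ with map_smul' := h }
  have h1 := Order.krullDim_eq_of_orderIso (Submodule.orderIsoMapComap E)
  rw [← Module.coe_length, ← Module.coe_length] at h1
  exact_mod_cast h1

section
variable {A : Type} [Ring A]

/-- the length of `M f` over the corner ring -/
def len (f : A) (hf : IsIdempotentElem f) (M : Type) [AddCommGroup M] [Module Aᵐᵒᵖ M] : ℕ∞ :=
  Module.length (CornerRing f hf)ᵐᵒᵖ (cor f M)

variable (f : A) (hf : IsIdempotentElem f)

lemma len_exact {M : Type} [AddCommGroup M] [Module Aᵐᵒᵖ M] (N : Submodule Aᵐᵒᵖ M) :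
    len f hf M = len f hf N + len f hf (M ⧸ N) := by
  refine Module.length_eq_add_of_exact (corMap f hf N.subtype) (corMap f hf N.mkQ) ?_ ?_ ?_
  · intro x y hxy
    have h0 : (corMap f hf N.subtype x).1 = (corMap f hf N.subtype y).1 := by rw [hxy]
    have h1 : x.1.1 = y.1.1 := h0
    exact Subtype.ext (Subtype.ext h1)
  · rintro ⟨q, hq⟩
    obtain ⟨m, rfl⟩ := Submodule.Quotient.mk_surjective _ q
    refine ⟨⟨op f • m, by rw [mem_cor, op_smul_smul, hf.eq]⟩, Subtype.ext ?_⟩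
    exact hq
  · intro x
    constructor
    · intro hx
      have h1 : N.mkQ x.1 = 0 := congrArg Subtype.val hx
      have h2 : x.1 ∈ N := by simpa using h1
      exact ⟨⟨⟨x.1, h2⟩, Subtype.ext x.2⟩, rfl⟩
    · rintro ⟨y, rfl⟩
      apply Subtype.ext
      change N.mkQ y.1.1 = 0
      simp

lemma len_congr {M N : Type} [AddCommGroup M] [Module Aᵐᵒᵖ M] [AddCommGroup N] [Module Aᵐᵒᵖ N]
    (φ : M ≃ₗ[Aᵐᵒᵖ] N) : len f hf M = len f hf N := by
  refine LinearEquiv.length_eq (LinearEquiv.ofLinearMap (corMap f hf φ.toLinearMap)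
    (corMap f hf φ.symm.toLinearMap) ?_ ?_)
  · ext x; exact φ.apply_symm_apply _
  · ext x; exact φ.symm_apply_apply _

lemma len_subsingleton {M : Type} [AddCommGroup M] [Module Aᵐᵒᵖ M] [Subsingleton M] :
    len f hf M = 0 := Module.length_eq_zero

lemma len_conj {f f' : A} [IsArtinianRing A] (hf : IsIdempotentElem f) (hf' : IsIdempotentElem f') (h : pq A f = pq A f') :
    Nonempty (rightIdeal A f' ≃ₗ[Aᵐᵒᵖ] rightIdeal A f) := by
  obtain ⟨u, -, hu⟩ := conj_of_pq hf hf' h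
  have hu' : f' * (u⁻¹ : Aˣ) = (u⁻¹ : Aˣ) * f := by
    have : (u⁻¹ : Aˣ) * (f * u) * (u⁻¹ : Aˣ) = (u⁻¹ : Aˣ) * (u * f') * (u⁻¹ : Aˣ) := by rw [hu]
    simpa [mul_assoc] using this.symm
  refine ⟨rIso hf hf' (f * u) (f' * (u⁻¹ : Aˣ)) (by rw [← mul_assoc, hf.eq])
    (by rw [← mul_assoc, hf'.eq]) ?_ ?_⟩
  · rw [hu']
    simp only [mul_assoc, Units.mul_inv_cancel_left, hf.eq]
  · rw [hu]
    simp only [mul_assoc, Units.inv_mul_cancel_left, hf'.eq]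

/-- Cartan entries -/
def pieceEquiv {f g : A} (hf : IsIdempotentElem f) (hg : IsIdempotentElem g) :
    CornerPiece f g ≃ₗ[(CornerRing g hg)ᵐᵒᵖ] cor g (rightIdeal A f) where
  toFun x := ⟨⟨x.1, (mem_rightIdeal hf).2 x.2.1⟩, Subtype.ext x.2.2⟩
  map_add' x y := rfl
  map_smul' r x := rfl
  invFun x := ⟨x.1.1, (mem_rightIdeal hf).1 x.1.2, congrArg Subtype.val x.2⟩
  left_inv x := rfl
  right_inv x := rfl

lemma cartan_len {n : ℕ} {f : Fin n → A} {hf : ∀ i, IsIdempotentElem (f i)}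
    {C : Matrix (Fin n) (Fin n) ℤ} (h : IsCartanMatrix A f hf C) (i j : Fin n) :
    C i j = ((len (f i) (hf i) (rightIdeal A (f j))).toNat : ℤ) := by
  obtain ⟨s, h1, h2, h3⟩ := h i j
  have := Module.length_compositionSeries s h1 h2
  rw [LinearEquiv.length_eq (pieceEquiv (hf j) (hf i))] at this
  rw [← h3, len, ← this]; rfl

lemma cartan_len_corner {c : A} {hc : IsIdempotentElem c} {n : ℕ} {g : Fin n → CornerRing c hc}
    {hg : ∀ i, IsIdempotentElem (g i)} (hg' : ∀ i, IsIdempotentElem (g i).1)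
    {C : Matrix (Fin n) (Fin n) ℤ} (h : IsCartanMatrix (CornerRing c hc) g hg C) (i j : Fin n) :
    C i j = ((len (g i).1 (hg' i) (rightIdeal A (g j).1)).toNat : ℤ) := by
  obtain ⟨s, h1, h2, h3⟩ := h i j
  have h4 := Module.length_compositionSeries s h1 h2
  have key : ∀ (a b : CornerRing c hc) (x : A), a.1 * x = x → x * b.1 = x →
      c * x = x ∧ x * c = x := by
    intro a b x h1 h2
    constructor
    · rw [← h1, ← mul_assoc, a.2.1]
    · rw [← h2, mul_assoc, b.2.2]
  let σ0 : CornerRing (g i) (hg i) ≃+* CornerRing (g i).1 (hg' i) :=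
    { toFun := fun x => ⟨x.1.1, congrArg Subtype.val x.2.1, congrArg Subtype.val x.2.2⟩
      invFun := fun x => ⟨⟨x.1, key (g i) (g i) x.1 x.2.1 x.2.2⟩, Subtype.ext x.2.1,
        Subtype.ext x.2.2⟩
      left_inv := fun x => rfl
      right_inv := fun x => rfl
      map_mul' := fun x y => rfl
      map_add' := fun x y => rfl }
  let φ : CornerPiece (g j) (g i) ≃+ CornerPiece (g j).1 (g i).1 :=
    { toFun := fun x => ⟨x.1.1, congrArg Subtype.val x.2.1, congrArg Subtype.val x.2.2⟩
      invFun := fun x => ⟨⟨x.1, key (g j) (g i) x.1 x.2.1 x.2.2⟩, Subtype.ext x.2.1,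
        Subtype.ext x.2.2⟩
      left_inv := fun x => rfl
      right_inv := fun x => rfl
      map_add' := fun x y => rfl }
  have h5 := length_semilinear (RingEquiv.op σ0) φ (fun s m => rfl)
  rw [h5, LinearEquiv.length_eq (pieceEquiv (hg' j) (hg' i))] at h4
  rw [← h3, len, ← h4]; rfl
end

section
variable {A : Type} [Ring A] {K : Type} [Fintype K] [DecidableEq K] {F : K → A}

lemma BF.len_simple (hF : BF F) (i j : K) :
    len (F i) (hF.idem i) (Qm (pq A (F j))) = if i = j then 1 else 0 := by
  split_ifs with hij
  · subst hij
    have : IsSimpleModule (CornerRing (F i) (hF.idem i))ᵐᵒᵖ (cor (F i) (Qm (pq A (F i)))) := by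
      rw [isSimpleModule_iff_toSpanSingleton_surjective]
      constructor
      · refine ⟨⟨⟨⟨pq A (F i), hF.idemB i⟩, Subtype.ext (hF.idemB i)⟩, 0, ?_⟩⟩
        intro h
        exact hF.ne i (congrArg (fun z => z.1.1) h)
      · rintro ⟨⟨x, hx⟩, hx2⟩ hne ⟨⟨y, hy⟩, hy2⟩
        have hx' : pq A (F i) * x ≠ 0 := by
          rw [mem_Qm.1 hx]; intro h; exact hne (Subtype.ext (Subtype.ext h))
        have hx3 : x * pq A (F i) = x := congrArg Subtype.val hx2
        have hy3 : y * pq A (F i) = y := congrArg Subtype.val hy2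
        obtain ⟨z, hz⟩ := hF.div i x hx'
        obtain ⟨a, ha⟩ := pq_surj (z * y)
        refine ⟨op ⟨F i * a * F i, by rw [← mul_assoc, ← mul_assoc, (hF.idem i).eq],
          by rw [mul_assoc, (hF.idem i).eq]⟩, Subtype.ext (Subtype.ext ?_)⟩
        change x * pq A (F i * a * F i) = y
        rw [mem_Qm.1 hx] at hz
        rw [map_mul, map_mul, ha, ← mul_assoc, ← mul_assoc, hx3, ← mul_assoc, hz, mul_assoc, hy3,
          mem_Qm.1 hy]
    exact Module.length_eq_one _ _
  · have : Subsingleton (cor (F i) (Qm (pq A (F j)))) := by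
      refine subsingleton_of_forall_eq 0 ?_
      rintro ⟨⟨x, hx⟩, hx2⟩
      have hx3 : x * pq A (F i) = x := congrArg Subtype.val hx2
      apply Subtype.ext
      apply Subtype.ext
      change x = 0
      rw [← hx3, ← mem_Qm.1 hx, mul_assoc, ← hF.cen i, ← mul_assoc, ← map_mul,
        hF.orth j i (Ne.symm hij), map_zero, zero_mul]
    exact Module.length_eq_zero

lemma BF.len_ne_top [IsArtinianRing A] (hF : BF F) (i : K) (M : Type) [AddCommGroup M]
    [Module Aᵐᵒᵖ M] (h : IsFiniteLength Aᵐᵒᵖ M) : len (F i) (hF.idem i) M ≠ ⊤ := by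
  induction h with
  | of_subsingleton => rw [len_subsingleton]; simp
  | @of_simple_quotient M _ _ N hs _ ih =>
    obtain ⟨k, ⟨E⟩⟩ := hF.simple_iso (M ⧸ N)
    rw [len_exact _ _ N, ← len_congr _ _ E, hF.len_simple]
    split_ifs <;> simp [ih]

lemma BF.len_eq [IsArtinianRing A] (hF : BF F) {G : K → A} (hG : BF G)
    (h : ∀ k, pq A (F k) = pq A (G k)) (i : K) (M : Type) [AddCommGroup M]
    [Module Aᵐᵒᵖ M] (hM : IsFiniteLength Aᵐᵒᵖ M) :
    len (F i) (hF.idem i) M = len (G i) (hG.idem i) M := by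
  induction hM with
  | of_subsingleton => rw [len_subsingleton, len_subsingleton]
  | @of_simple_quotient M _ _ N hs _ ih =>
    obtain ⟨k, ⟨E⟩⟩ := hF.simple_iso (M ⧸ N)
    rw [len_exact _ _ N, len_exact _ _ N, ← len_congr _ _ E, ← len_congr _ _ E, hF.len_simple,
      h, hG.len_simple, ih]

end

lemma finLen (R : Type) [CommRing R] [IsArtinianRing R] {A : Type} [Ring A] [Algebra R A]
    [Module.Finite R A] (M : Type) [AddCommGroup M] [Module Aᵐᵒᵖ M] [Module.Finite Aᵐᵒᵖ M] :
    IsFiniteLength Aᵐᵒᵖ M := by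
  have := finite_op R (A := A)
  have h1 : IsArtinian R Aᵐᵒᵖ := inferInstance
  have h2 : IsArtinianRing Aᵐᵒᵖ := isArtinian_of_tower R h1
  have h3 : IsNoetherianRing Aᵐᵒᵖ := noeth_op R
  rw [isFiniteLength_iff_isNoetherian_isArtinian]
  exact ⟨inferInstance, inferInstance⟩

end CDR
end

noncomputable section
namespace CDR
open CategoryTheory.Limits DerivedCategory
open MulOpposite (op unop)
open scoped ModuleCat.Algebra

section ell
universe v
variable (R : Type) [CommRing R] [IsArtinianRing R]

/-- integer-valued length -/
def ell (V : Type v) [AddCommGroup V] [Module R V] : ℤ := ((Module.length R V).toNat : ℤ)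

variable {V W U : Type v} [AddCommGroup V] [Module R V] [AddCommGroup W] [Module R W]
  [AddCommGroup U] [Module R U]

lemma ell_congr (e : V ≃ₗ[R] W) : ell R V = ell R W := by
  rw [ell, ell, e.length_eq]

lemma ell_zero (h : ∀ v : V, v = 0) : ell R V = 0 := by
  have : Subsingleton V := ⟨fun a b => (h a).trans (h b).symm⟩
  rw [ell, Module.length_eq_zero]; simp

lemma ell_pos [Module.Finite R V] (v : V) (h : v ≠ 0) : 0 < ell R V := by
  have : Nontrivial V := ⟨v, 0, h⟩
  have h1 : 0 < Module.length R V := Module.length_pos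
  have h2 : Module.length R V ≠ ⊤ := Module.length_ne_top
  rw [ell]
  lift Module.length R V to ℕ using h2 with n
  simpa using h1

lemma ell_exact [Module.Finite R V] [Module.Finite R U] (f : V →ₗ[R] W) (g : W →ₗ[R] U)
    (hf : Function.Injective f) (hg : Function.Surjective g) (h : Function.Exact f g) :
    ell R W = ell R V + ell R U := by
  rw [ell, ell, ell, Module.length_eq_add_of_exact f g hf hg h]
  have h1 : Module.length R V ≠ ⊤ := Module.length_ne_top
  have h2 : Module.length R U ≠ ⊤ := Module.length_ne_top
  rw [ENat.toNat_add h1 h2]; push_cast; rfl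

lemma ell_rank [Module.Finite R V] [Module.Finite R W] (f : V →ₗ[R] W) :
    ell R V = ell R (LinearMap.ker f) + ell R (LinearMap.range f) :=
  ell_exact R (LinearMap.ker f).subtype f.rangeRestrict (Submodule.injective_subtype _)
    (LinearMap.surjective_rangeRestrict f) (by
      intro y
      simp only [LinearMap.rangeRestrict, Set.mem_range, Subtype.exists, Submodule.subtype_apply]
      constructor
      · intro h
        exact ⟨y, by simpa using congrArg Subtype.val h, rfl⟩
      · rintro ⟨a, ha, rfl⟩
        exact Subtype.ext ha)

lemma ell_pi {β : Type} [Fintype β] (V : β → Type v) [∀ b, AddCommGroup (V b)]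
    [∀ b, Module R (V b)] [∀ b, Module.Finite R (V b)] : ell R (∀ b, V b) = ∑ b, ell R (V b) := by
  rw [ell, Module.length_pi_of_fintype]
  simp only [ell]
  rw [← Nat.cast_sum]
  congr 1
  refine ENat.natCast_inj.1 ?_
  have h (b) : Module.length R (V b) ≠ ⊤ := Module.length_ne_top
  rw [ENat.natCast_toNat, Nat.cast_sum]
  · exact Finset.sum_congr rfl fun b _ => (ENat.natCast_toNat (h b)).symm
  · simp [h]

lemma ell_les (Q M N : ℕ → Type v) [∀ k, AddCommGroup (Q k)] [∀ k, Module R (Q k)]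
    [∀ k, AddCommGroup (M k)] [∀ k, Module R (M k)] [∀ k, AddCommGroup (N k)] [∀ k, Module R (N k)]
    [∀ k, Module.Finite R (Q k)] [∀ k, Module.Finite R (M k)] [∀ k, Module.Finite R (N k)]
    (a : ∀ k, Q k →ₗ[R] M k) (b : ∀ k, M k →ₗ[R] N k) (d : ∀ k, N k →ₗ[R] Q (k + 1))
    (h1 : ∀ k, Function.Exact (a k) (b k)) (h2 : ∀ k, Function.Exact (b k) (d k))
    (h3 : ∀ k, Function.Exact (d k) (a (k + 1))) (h0 : Function.Injective (a 0)) (n : ℕ)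
    (hn : ∀ x : Q n, x = 0) :
    ∑ k ∈ Finset.range n, (-1 : ℤ) ^ k * ell R (M k) =
      ∑ k ∈ Finset.range n, (-1 : ℤ) ^ k * ell R (Q k) +
      ∑ k ∈ Finset.range n, (-1 : ℤ) ^ k * ell R (N k) := by
  have key (k) : ell R (M k) = ell R (Q k) - ell R (LinearMap.ker (a k)) + ell R (N k)
      - ell R (LinearMap.ker (a (k + 1))) := by
    have e1 := ell_rank R (a k)
    have e2 := ell_rank R (b k)
    have e3 := ell_rank R (d k)
    rw [LinearMap.exact_iff.1 (h1 k)] at e2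
    rw [LinearMap.exact_iff.1 (h2 k)] at e3
    rw [LinearMap.exact_iff.1 (h3 k)]
    lia
  have tel : ∀ n, ∑ k ∈ Finset.range n, (-1 : ℤ) ^ k * ell R (M k) =
      ∑ k ∈ Finset.range n, (-1 : ℤ) ^ k * ell R (Q k) +
      ∑ k ∈ Finset.range n, (-1 : ℤ) ^ k * ell R (N k) - ell R (LinearMap.ker (a 0))
      + (-1) ^ n * ell R (LinearMap.ker (a n)) := by
    intro n
    induction n with
    | zero => simp
    | succ n ih =>
      rw [Finset.sum_range_succ, Finset.sum_range_succ, Finset.sum_range_succ, ih, key n]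
      ring
  rw [tel n]
  have e0 : ell R (LinearMap.ker (a 0)) = 0 := by
    apply ell_zero
    rintro ⟨x, hx⟩
    exact Subtype.ext (h0 (by simpa using hx))
  have en : ell R (LinearMap.ker (a n)) = 0 := by
    apply ell_zero
    rintro ⟨x, hx⟩
    exact Subtype.ext (hn x)
  rw [e0, en]; ring

end ell

section chi
variable (R : Type) [CommRing R] [IsArtinianRing R] {A : Type} [Ring A] [Algebra R A]
  [Module.Finite R A] [HasDerivedCategory.{1} (ModuleCat.{0} Aᵐᵒᵖ)]

/-- truncated Euler form -/
def chi (n : ℕ) (Y M : ModuleCat.{0} Aᵐᵒᵖ) : ℤ :=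
  ∑ k ∈ Finset.range n, (-1 : ℤ) ^ k * ell R (stk M ⟶ sstk Y (k : ℤ))

/-- precomposition -/
def preL {X Y : DerivedCategory (ModuleCat.{0} Aᵐᵒᵖ)} (u : X ⟶ Y)
    (Z : DerivedCategory (ModuleCat.{0} Aᵐᵒᵖ)) : (Y ⟶ Z) →ₗ[R] (X ⟶ Z) where
  toFun := fun x => u ≫ x
  map_add' := by intro f g; simp
  map_smul' := by intro r f; simp

/-- connecting map -/
def conL {X1 X3 : DerivedCategory (ModuleCat.{0} Aᵐᵒᵖ)} (δ : X3 ⟶ X1⟦(1 : ℤ)⟧)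
    (Y : ModuleCat.{0} Aᵐᵒᵖ) (a c : ℤ) (h : a + 1 = c) : (X1 ⟶ sstk Y a) →ₗ[R] (X3 ⟶ sstk Y c) where
  toFun := fun x => δ ≫ x⟦(1 : ℤ)⟧' ≫ (sstkShift Y a 1 c h).hom
  map_add' := by intro f g; simp
  map_smul' := by intro r f; simp [Functor.map_smul]

lemma chi_ses {n : ℕ} (hn : ∀ (X Y : ModuleCat.{0} Aᵐᵒᵖ) (k : ℤ), n ≤ k → ∀ x : stk X ⟶ sstk Y k, x = 0)
    (Y : ModuleCat.{0} Aᵐᵒᵖ) (S : ShortComplex (ModuleCat.{0} Aᵐᵒᵖ)) (hS : S.ShortExact)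
    [Module.Finite Aᵐᵒᵖ Y] [Module.Finite Aᵐᵒᵖ S.X₁] [Module.Finite Aᵐᵒᵖ S.X₂]
    [Module.Finite Aᵐᵒᵖ S.X₃] : chi R n Y S.X₂ = chi R n Y S.X₃ + chi R n Y S.X₁ := by
  have hd : Pretriangulated.Triangle.mk _ _ _ ∈ _ := hS.singleTriangle_distinguished
  have f1 (k : ℕ) : Module.Finite R (stk S.X₃ ⟶ sstk Y (k : ℤ)) := finite_ext R _ _ _
  have f2 (k : ℕ) : Module.Finite R (stk S.X₂ ⟶ sstk Y (k : ℤ)) := finite_ext R _ _ _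
  have f3 (k : ℕ) : Module.Finite R (stk S.X₁ ⟶ sstk Y (k : ℤ)) := finite_ext R _ _ _
  refine ell_les R (fun k => stk S.X₃ ⟶ sstk Y (k : ℤ)) (fun k => stk S.X₂ ⟶ sstk Y (k : ℤ))
    (fun k => stk S.X₁ ⟶ sstk Y (k : ℤ))
    (fun k => preL R ((singleFunctor _ 0).map S.g) _) (fun k => preL R ((singleFunctor _ 0).map S.f) _)
    (fun k => conL R hS.singleδ Y k (k + 1 : ℕ) (by push_cast; rfl)) ?_ ?_ ?_ ?_ n ?_
  · intro k x
    constructor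
    · intro hx
      obtain ⟨g, hg⟩ := tri_yo2 hd x hx
      exact ⟨g, hg.symm⟩
    · rintro ⟨y, rfl⟩
      have := tri_comp12 hd
      change _ ≫ _ ≫ _ = _
      rw [← Category.assoc]
      exact (congrArg (· ≫ y) this).trans zero_comp
  · intro k x
    constructor
    · intro hx
      have h1 : hS.singleδ ≫ x⟦(1 : ℤ)⟧' = 0 := by
        rw [← cancel_mono (sstkShift Y k 1 (k + 1 : ℕ) (by push_cast; rfl)).hom, Category.assoc, zero_comp]
        exact hx
      obtain ⟨g, hg⟩ := tri_yo1 hd _ h1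
      obtain ⟨g', rfl⟩ := (shiftFunctor _ (1 : ℤ)).map_surjective g
      refine ⟨g', ?_⟩
      apply (shiftFunctor _ (1 : ℤ)).map_injective
      rw [hg]
      exact CategoryTheory.Functor.map_comp _ _ _
    · rintro ⟨y, rfl⟩
      have := tri_comp31 hd
      change hS.singleδ ≫ ((singleFunctor _ 0).map S.f ≫ y)⟦(1 : ℤ)⟧' ≫ _ = 0
      rw [CategoryTheory.Functor.map_comp]
      simp only [← Category.assoc]
      refine (congrArg (· ≫ _) (congrArg (· ≫ _) this)).trans ?_
      simp
  · intro k x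
    constructor
    · intro hx
      obtain ⟨g, hg⟩ := tri_yo3 hd x hx
      obtain ⟨g', hg'⟩ := (shiftFunctor _ (1 : ℤ)).map_surjective
        (g ≫ (sstkShift Y k 1 (k + 1 : ℕ) (by push_cast; rfl)).inv)
      refine ⟨g', ?_⟩
      change hS.singleδ ≫ g'⟦(1 : ℤ)⟧' ≫ _ = x
      rw [hg', hg, Category.assoc, Iso.inv_hom_id, Category.comp_id]
    · rintro ⟨y, rfl⟩
      have := tri_comp23 hd
      change _ ≫ hS.singleδ ≫ _ = 0
      rw [← Category.assoc]
      exact (congrArg (· ≫ _) this).trans zero_comp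
  · rw [← LinearMap.ker_eq_bot, eq_bot_iff]
    intro x hx
    obtain ⟨g, hg⟩ := tri_yo3 hd x hx
    obtain ⟨g', hg'⟩ := (shiftFunctor _ (1 : ℤ)).map_surjective
        (g ≫ (sstkShift Y (-1) 1 (0 : ℕ) (by simp)).inv)
    have h0 := sstk_neg0 Y S.X₁ (-1) (by simp) g'
    rw [h0, CategoryTheory.Functor.map_zero] at hg'
    have h1 : g = 0 := by
      rw [← cancel_mono (sstkShift Y (-1) 1 (0 : ℕ) (by simp)).inv, ← hg', zero_comp]
    rw [h1] at hg
    rw [Submodule.mem_bot, hg]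
    exact comp_zero
  · exact fun x => hn _ _ _ le_rfl x

lemma chi_congr (n : ℕ) (Y : ModuleCat.{0} Aᵐᵒᵖ) {M N : ModuleCat.{0} Aᵐᵒᵖ} (e : M ≅ N) :
    chi R n Y M = chi R n Y N := by
  refine Finset.sum_congr rfl fun k _ => ?_
  congr 1
  refine ell_congr R (LinearEquiv.ofLinearMap (preL R ((singleFunctor _ 0).map e.inv) _)
    (preL R ((singleFunctor _ 0).map e.hom) _) ?_ ?_)
  · ext x
    change (singleFunctor _ 0).map e.inv ≫ (singleFunctor _ 0).map e.hom ≫ x = x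
    rw [← Category.assoc, ← CategoryTheory.Functor.map_comp, e.inv_hom_id, CategoryTheory.Functor.map_id, Category.id_comp]
  · ext x
    change (singleFunctor _ 0).map e.hom ≫ (singleFunctor _ 0).map e.inv ≫ x = x
    rw [← Category.assoc, ← CategoryTheory.Functor.map_comp, e.hom_inv_id, CategoryTheory.Functor.map_id, Category.id_comp]

lemma chi_zero (n : ℕ) (Y M : ModuleCat.{0} Aᵐᵒᵖ) [Subsingleton M] : chi R n Y M = 0 := by
  refine Finset.sum_eq_zero fun k _ => ?_
  rw [ell_zero, mul_zero]
  intro x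
  have hz : IsZero (stk M) := (singleFunctor _ 0).map_isZero (ModuleCat.isZero_of_subsingleton M)
  exact hz.eq_of_src _ _

lemma chi_len {K : Type} [Fintype K] [DecidableEq K] {F : K → A} (hF : BF F) {n : ℕ}
    (hn : ∀ (X Y : ModuleCat.{0} Aᵐᵒᵖ) (k : ℤ), n ≤ k → ∀ x : stk X ⟶ sstk Y k, x = 0)
    (Y : ModuleCat.{0} Aᵐᵒᵖ) [Module.Finite Aᵐᵒᵖ Y] (M : Type) [AddCommGroup M] [Module Aᵐᵒᵖ M]
    (hM : IsFiniteLength Aᵐᵒᵖ M) :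
    chi R n Y (ModuleCat.of Aᵐᵒᵖ M) =
      ∑ i, ((len (F i) (hF.idem i) M).toNat : ℤ) * chi R n Y (SI F i) := by
  have := artA R A
  induction hM with
  | of_subsingleton =>
    rename_i M _ _ _
    have : Subsingleton (ModuleCat.of Aᵐᵒᵖ M) := ‹_›
    rw [chi_zero]
    symm
    refine Finset.sum_eq_zero fun i _ => ?_
    rw [len_subsingleton]; simp
  | @of_simple_quotient M _ _ N hs hN ih =>
    have := noeth_op R (A := A)
    have fN : Module.Finite Aᵐᵒᵖ N := by
      have := (isFiniteLength_iff_isNoetherian_isArtinian.1 hN).1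
      infer_instance
    have hM : IsFiniteLength Aᵐᵒᵖ M := .of_simple_quotient hN
    have fM : Module.Finite Aᵐᵒᵖ M := by
      have := (isFiniteLength_iff_isNoetherian_isArtinian.1 hM).1
      infer_instance
    have fQ : Module.Finite Aᵐᵒᵖ (M ⧸ N) := inferInstance
    obtain ⟨hc, hS⟩ := ses_of_exact N.subtype N.mkQ (Submodule.injective_subtype _)
      (Submodule.mkQ_surjective _) (LinearMap.exact_subtype_mkQ N)
    have e1 := @chi_ses R _ _ A _ _ _ _ n hn Y _ hS _ fN fM fQ
    obtain ⟨k, ⟨e⟩⟩ := hF.simple_iso (M ⧸ N)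
    have e2 : chi R n Y (ModuleCat.of Aᵐᵒᵖ (M ⧸ N)) = chi R n Y (SI F k) :=
      (chi_congr R n Y e.toModuleIso).symm
    have e3 : chi R n Y (ModuleCat.of Aᵐᵒᵖ M) = chi R n Y (SI F k) + chi R n Y (ModuleCat.of Aᵐᵒᵖ N) := by
      rw [← e2]; exact e1
    rw [e3, ih]
    have e4 (i) : ((len (F i) (hF.idem i) M).toNat : ℤ) =
        (len (F i) (hF.idem i) N).toNat + if i = k then 1 else 0 := by
      rw [len_exact (F i) (hF.idem i) N, ← len_congr (F i) (hF.idem i) e, hF.len_simple,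
        ENat.toNat_add (hF.len_ne_top i N hN) (by split <;> simp)]
      split <;> simp
    simp only [e4, add_mul, Finset.sum_add_distrib, ite_mul, one_mul, zero_mul]
    simp [add_comm]

end chi
end CDR
end

noncomputable section
namespace CDR
open CategoryTheory.Limits DerivedCategory
open MulOpposite (op unop)
open scoped ModuleCat.Algebra

lemma det_const {ι : Type} [Fintype ι] [DecidableEq ι] (b c : Matrix ι ι (Polynomial ℤ)) (d : ι → ℤ)
    (hd : ∀ i, d i ≠ 0) (hbc : b * c = Matrix.diagonal (fun i => Polynomial.C (d i)))
    (c0 c1 : Matrix ι ι ℤ) (h0 : ∀ i j, (c i j).eval 0 = Matrix.diagonal d i j)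
    (h1 : ∀ i j, (c i j).eval (-1) = c1 i j) : c1.det = ∏ i, d i := by
  have e1 : b.det * c.det = Polynomial.C (∏ i, d i) := by
    rw [← Matrix.det_mul, hbc, Matrix.det_diagonal, map_prod]
  have hp : ∏ i, d i ≠ 0 := Finset.prod_ne_zero_iff.2 fun i _ => hd i
  have hdeg : c.det.natDegree = 0 := by
    have h := congrArg Polynomial.natDegree e1
    have hne : b.det * c.det ≠ 0 := by rw [e1]; exact Polynomial.C_ne_zero.2 hp
    rw [Polynomial.natDegree_mul (left_ne_zero_of_mul hne) (right_ne_zero_of_mul hne),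
      Polynomial.natDegree_C] at h
    lia
  obtain ⟨z, hz⟩ := Polynomial.natDegree_eq_zero.1 hdeg
  have ev (t : ℤ) : c.det.eval t = Matrix.det (fun i j => (c i j).eval t) := by
    rw [← Polynomial.coe_evalRingHom, RingHom.map_det]; rfl
  have a0 := ev 0
  have a1 := ev (-1)
  rw [← hz, Polynomial.eval_C] at a0 a1
  have : (fun i j => (c i j).eval 0) = Matrix.diagonal d := by
    ext i j; exact h0 i j
  rw [this, Matrix.det_diagonal] at a0
  have : (fun i j => (c i j).eval (-1)) = c1 := by
    ext i j; exact h1 i j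
  rw [this] at a1
  rw [← a1, a0]

section P
variable (R : Type) [CommRing R] [IsArtinianRing R] {A : Type} [Ring A] [Algebra R A]
  [Module.Finite R A] [HasDerivedCategory.{1} (ModuleCat.{0} Aᵐᵒᵖ)]
variable {S : ModuleCat.{0} Aᵐᵒᵖ} {ι : Type} [Fintype ι] (D : SSDec S ι)

/-- graded dimension polynomial -/
def cpoly (n : ℕ) (X Y : ModuleCat.{0} Aᵐᵒᵖ) : Polynomial ℤ :=
  ∑ k ∈ Finset.range n, Polynomial.monomial k (ell R (stk X ⟶ sstk Y (k : ℤ)))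

lemma cpoly_coeff {n : ℕ}
    (hn : ∀ (X Y : ModuleCat.{0} Aᵐᵒᵖ) (k : ℤ), n ≤ k → ∀ x : stk X ⟶ sstk Y k, x = 0)
    (X Y : ModuleCat.{0} Aᵐᵒᵖ) (k : ℕ) : (cpoly R n X Y).coeff k = ell R (stk X ⟶ sstk Y (k : ℤ)) := by
  rw [cpoly, Polynomial.finsetSum_coeff]
  simp only [Polynomial.coeff_monomial]
  rw [Finset.sum_ite_eq' (Finset.range n) k]
  split_ifs with h
  · rfl
  · rw [ell_zero]
    intro x
    exact hn X Y k (by simpa using h) x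

lemma cpoly_eval (n : ℕ) (X Y : ModuleCat.{0} Aᵐᵒᵖ) : (cpoly R n X Y).eval (-1) = chi R n Y X := by
  rw [cpoly, chi, Polynomial.eval_finsetSum]
  refine Finset.sum_congr rfl fun k _ => ?_
  rw [Polynomial.eval_monomial, mul_comm]

lemma ell_cell {n : ℕ}
    (hn : ∀ (X Y : ModuleCat.{0} Aᵐᵒᵖ) (k : ℤ), n ≤ k → ∀ x : stk X ⟶ sstk Y k, x = 0)
    (X Y : ModuleCat.{0} Aᵐᵒᵖ) (a k : ℕ) :
    ell R (sstk X (a : ℤ) ⟶ sstk Y (k : ℤ)) = (Polynomial.X ^ a * cpoly R n X Y).coeff k := by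
  rw [Polynomial.coeff_X_pow_mul']
  split_ifs with h
  · rw [cpoly_coeff R hn, ← ell_congr R (LinearEquiv.ofBijective _ (shiftHom_bij R X Y a k))]
    have : (k : ℤ) - a = (k - a : ℕ) := by push_cast [h]; rfl
    rw [this]
  · exact ell_zero R fun x => sstk_hom_neg (by lia) x

lemma hom_T_finite {M : DerivedCategory (ModuleCat.{0} Aᵐᵒᵖ)} (i : ι) (k : ℤ)
    (h : Module.Finite R (M ⟶ sstk S k)) : Module.Finite R (M ⟶ sstk (D.T i) k) := by
  let φ : (M ⟶ sstk S k) →ₗ[R] (M ⟶ sstk (D.T i) k) :=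
    { toFun := fun f => f ≫ smap (D.proj i) k
      map_add' := by intro f g; simp
      map_smul' := by intro r f; simp }
  refine Module.Finite.of_surjective φ fun x => ⟨x ≫ smap (D.inc i) k, ?_⟩
  change (x ≫ smap (D.inc i) k) ≫ smap (D.proj i) k = x
  rw [Category.assoc, ← CategoryTheory.Functor.map_comp, ← CategoryTheory.Functor.map_comp, D.inc_proj]
  simp

lemma smap_inc_proj (i : ι) (k : ℤ) : smap (D.inc i) k ≫ smap (D.proj i) k = 𝟙 _ := by
  rw [← CategoryTheory.Functor.map_comp, ← CategoryTheory.Functor.map_comp, D.inc_proj]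
  simp

/-- splitting homs out of a biproduct -/
def biprodHom {α : Type} [Fintype α] (c : α → ι × ℕ) (Z : DerivedCategory (ModuleCat.{0} Aᵐᵒᵖ)) :
    (cellSum D c ⟶ Z) ≃ₗ[R] (∀ a, cell D (c a) ⟶ Z) where
  toFun x a := biproduct.ι (fun a => cell D (c a)) a ≫ x
  invFun y := biproduct.desc y
  left_inv x := by ext a; simp
  right_inv y := by ext a; simp
  map_add' x y := by ext a; simp
  map_smul' r x := by ext a; simp

lemma poly_ex (hA : HasFiniteGlobalDimension A) {n : ℕ}
    (hn : ∀ (X Y : ModuleCat.{0} Aᵐᵒᵖ) (k : ℤ), n ≤ k → ∀ x : stk X ⟶ sstk Y k, x = 0)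
    [Module.Finite Aᵐᵒᵖ S] (hY : HasFiniteGlobalDimension (ExtRing S))
    (M : ModuleCat.{0} Aᵐᵒᵖ) [Module.Finite Aᵐᵒᵖ M] :
    ∃ b : ι → Polynomial ℤ, ∀ (i : ι) (k : ℕ), ell R (stk M ⟶ sstk (D.T i) (k : ℤ)) =
      (∑ l, b l * cpoly R n (D.T l) (D.T i)).coeff k := by
  classical
  refine tower' R hA S D hY (fun M => ∃ b : ι → Polynomial ℤ, ∀ (i : ι) (k : ℕ),
    ell R (M ⟶ sstk (D.T i) (k : ℤ)) =
      (∑ l, b l * cpoly R n (D.T l) (D.T i)).coeff k) ?_ ?_ M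
  · intro N hN
    refine ⟨0, fun i k => ?_⟩
    rw [ell_zero]
    · simp
    · intro x
      rw [← Category.comp_id x, ← smap_inc_proj, ← Category.assoc, hN _ (x ≫ smap (D.inc i) k), zero_comp]
  · intro M M' α _ c v w δ hT hv hM hM' hb
    obtain ⟨b, hb⟩ := hb
    refine ⟨fun l => ∑ a, (if (c a).1 = l then Polynomial.X ^ (c a).2 else 0) - b l, fun i k => ?_⟩
    have f1 := hom_T_finite R D i (k : ℤ) (hM.fin k)
    have f2 := hom_T_finite R D i (k : ℤ) (hM'.fin k)
    have e1 : ell R (cellSum D c ⟶ sstk (D.T i) (k : ℤ)) =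
        ell R (M' ⟶ sstk (D.T i) (k : ℤ)) + ell R (M ⟶ sstk (D.T i) (k : ℤ)) := by
      refine ell_exact R (preL R w _) (preL R v _) ?_ ?_ ?_
      · rw [← LinearMap.ker_eq_bot, eq_bot_iff]
        intro x hx
        have hx' : w ≫ x = 0 := hx
        have h1 := w_cancel hT hv k (x ≫ smap (D.inc i) k) (by
          rw [← Category.assoc, hx', zero_comp])
        rw [Submodule.mem_bot, ← Category.comp_id x, ← smap_inc_proj, ← Category.assoc, h1, zero_comp]
      · intro x
        obtain ⟨y, hy⟩ := hv k (x ≫ smap (D.inc i) k)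
        refine ⟨y ≫ smap (D.proj i) k, ?_⟩
        change v ≫ y ≫ _ = x
        rw [← Category.assoc, ← hy, Category.assoc, smap_inc_proj, Category.comp_id]
      · intro x
        constructor
        · intro hx
          obtain ⟨g, hg⟩ := tri_yo2 hT x hx
          exact ⟨g, hg.symm⟩
        · rintro ⟨y, rfl⟩
          change v ≫ w ≫ y = 0
          rw [← Category.assoc, tri_comp12 hT, zero_comp]
    have e2 : ell R (cellSum D c ⟶ sstk (D.T i) (k : ℤ)) =
        ∑ a, (Polynomial.X ^ (c a).2 * cpoly R n (D.T (c a).1) (D.T i)).coeff k := by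
      have ff (a : α) : Module.Finite R (cell D (c a) ⟶ sstk (D.T i) (k : ℤ)) := by
        have := SSDec.finite D
        exact finite_shift1 R _ _ _ _ (finite_ext R _ _ _)
      rw [ell_congr R (biprodHom R D c _), ell_pi]
      exact Finset.sum_congr rfl fun a _ => ell_cell R hn _ _ _ _
    have e3 : ell R (M ⟶ sstk (D.T i) (k : ℤ)) = _ - _ := eq_sub_of_add_eq' (e1.symm.trans e2)
    rw [e3, hb i k, ← Polynomial.finsetSum_coeff, ← Polynomial.coeff_sub]
    congr 1
    simp only [sub_mul, Finset.sum_sub_distrib, Finset.sum_mul]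
    congr 1
    rw [Finset.sum_comm]
    refine Finset.sum_congr rfl fun a _ => ?_
    simp
end P
end CDR
end

noncomputable section
namespace CDR
open CategoryTheory.Limits DerivedCategory
open MulOpposite (op unop)
open scoped ModuleCat.Algebra Matrix

lemma rightIdeal_proj {A : Type} [Ring A] {e : A} (he : IsIdempotentElem e) :
    Module.Projective Aᵐᵒᵖ (rightIdeal A e) := by
  let i : rightIdeal A e →ₗ[Aᵐᵒᵖ] Aᵐᵒᵖ :=
    { toFun := fun x => op x.1
      map_add' := fun x y => rfl
      map_smul' := fun r x => rfl }
  let s : Aᵐᵒᵖ →ₗ[Aᵐᵒᵖ] rightIdeal A e :=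
    LinearMap.toSpanSingleton Aᵐᵒᵖ (rightIdeal A e) ⟨e, (mem_rightIdeal he).2 he⟩
  refine Module.Projective.of_split i s ?_
  apply LinearMap.ext
  rintro ⟨x, hx⟩
  exact Subtype.ext ((mem_rightIdeal he).1 hx)

lemma rightIdeal_finite {A : Type} [Ring A] (e : A) : Module.Finite Aᵐᵒᵖ (rightIdeal A e) :=
  Module.Finite.span_singleton Aᵐᵒᵖ e

lemma Qm_finite {A : Type} [Ring A] {e : A} (he : IsIdempotentElem e) :
    Module.Finite Aᵐᵒᵖ (Qm (pq A e)) := by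
  have := rightIdeal_finite e
  exact Module.Finite.of_surjective _ (pqR_surj he)

lemma SeModule_finite {A : Type} [Ring A] {e : A} (he : IsIdempotentElem e) :
    Module.Finite Aᵐᵒᵖ (SeModule A e) := by
  have := Qm_finite he
  exact Module.Finite.equiv (seEquiv he).symm

section deg0
variable (R : Type) [CommRing R] [IsArtinianRing R] {A : Type} [Ring A] [Algebra R A]
  [Module.Finite R A] [HasDerivedCategory.{1} (ModuleCat.{0} Aᵐᵒᵖ)]

lemma ell_hom0 (X Y : ModuleCat.{0} Aᵐᵒᵖ) :
    ell R (stk X ⟶ sstk Y ((0 : ℕ) : ℤ)) = ((Module.length R (X ⟶ Y)).toNat : ℤ) := by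
  let φ : (X ⟶ Y) →ₗ[R] (stk X ⟶ sstk Y (0 : ℕ)) :=
    { toFun := fun f => (singleFunctor _ 0).map f ≫ (shiftFunctorZero' _ ((0 : ℕ) : ℤ) rfl).inv.app _
      map_add' := by intro f g; simp
      map_smul' := by intro r f; simp [Functor.map_smul] }
  have hφ : Function.Bijective φ := by
    constructor
    · intro f g hfg
      apply (singleFunctor _ 0).map_injective
      exact (cancel_mono ((shiftFunctorZero' _ ((0 : ℕ) : ℤ) rfl).inv.app _)).1 hfg
    · intro z
      obtain ⟨u, hu⟩ := (singleFunctor _ 0).map_surjective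
        (z ≫ (shiftFunctorZero' _ ((0 : ℕ) : ℤ) rfl).hom.app _)
      refine ⟨u, ?_⟩
      change (singleFunctor _ 0).map u ≫ _ = z
      rw [hu]
      simp
  rw [ell, (LinearEquiv.ofBijective φ hφ).length_eq]

variable {K : Type} [Fintype K] [DecidableEq K] {F : K → A}

/-- the indecomposable projectives -/
def PI (F : K → A) (k : K) : ModuleCat.{0} Aᵐᵒᵖ := ModuleCat.of Aᵐᵒᵖ (rightIdeal A (F k))

/-- endomorphism lengths -/
def dd (F : K → A) (i : K) : ℤ := ell R (stk (SI F i) ⟶ sstk (SI F i) ((0 : ℕ) : ℤ))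

lemma SI_finite (hF : BF F) (i : K) : Module.Finite Aᵐᵒᵖ (SI F i) := Qm_finite (hF.idem i)
lemma PI_finite (i : K) : Module.Finite Aᵐᵒᵖ (PI F i) := rightIdeal_finite _
lemma PI_proj (hF : BF F) (i : K) : Projective (PI F i) := by
  have := rightIdeal_proj (hF.idem i)
  exact (IsProjective.iff_projective _).1 this

lemma SS0 (hF : BF F) (i j : K) : ell R (stk (SI F j) ⟶ sstk (SI F i) ((0 : ℕ) : ℤ)) =
    if j = i then dd R F i else 0 := by
  split_ifs with h
  · subst h; rfl
  · rw [ell_hom0]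
    have : Subsingleton (SI F j ⟶ SI F i) := ⟨fun a b => by
      have h1 (a : SI F j ⟶ SI F i) : a = 0 := ModuleCat.hom_ext (hF.hom_zero h a.hom)
      rw [h1 a, h1 b]⟩
    rw [Module.length_eq_zero]; simp

lemma dd_ne (hF : BF F) (i : K) : dd R F i ≠ 0 := by
  have := SI_finite hF i
  have : Module.Finite R (SI F i ⟶ SI F i) := finite_homs R _ _
  rw [dd, ell_hom0]
  refine (ell_pos R (𝟙 (SI F i)) ?_).ne'
  intro h
  have hs := hF.simple i
  have hn : Nontrivial (Qm (pq A (F i))) := IsSimpleModule.nontrivial Aᵐᵒᵖ _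
  obtain ⟨x, hx⟩ := exists_ne (0 : Qm (pq A (F i)))
  exact hx (congrArg (fun g : SI F i ⟶ SI F i => g.hom x) h)

lemma PS0 (hF : BF F) (i j : K) : ell R (stk (PI F j) ⟶ sstk (SI F i) ((0 : ℕ) : ℤ)) =
    if j = i then dd R F i else 0 := by
  rw [← SS0 R hF i j, ell_hom0, ell_hom0]
  let π : PI F j ⟶ SI F j := ModuleCat.ofHom (pqR (hF.idem j))
  let φ : (SI F j ⟶ SI F i) →ₗ[R] (PI F j ⟶ SI F i) :=
    { toFun := fun g => π ≫ g
      map_add' := by intro f g; simp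
      map_smul' := by intro r f; simp }
  have hπ : Epi π := (ModuleCat.epi_iff_surjective _).2 (pqR_surj (hF.idem j))
  have hφ : Function.Bijective φ := by
    constructor
    · intro f g hfg
      exact (cancel_epi π).1 hfg
    · intro g
      let ψ : rightIdeal A (F j) →ₗ[Aᵐᵒᵖ] Qm (pq A (F i)) := g.hom
      have hk : LinearMap.ker (pqR (hF.idem j)) ≤ LinearMap.ker ψ := by
        rintro ⟨x, hx⟩ hx'
        have h1 : pq A x = 0 := congrArg Subtype.val hx'
        have h2 : (⟨x, hx⟩ : rightIdeal A (F j)) =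
            op x • (⟨F j, (mem_rightIdeal (hF.idem j)).2 (hF.idem j)⟩ : rightIdeal A (F j)) :=
          Subtype.ext ((mem_rightIdeal (hF.idem j)).1 hx).symm
        rw [LinearMap.mem_ker, h2, map_smul]
        apply Subtype.ext
        change _ * pq A x = 0
        rw [h1, mul_zero]
      let t : Qm (pq A (F j)) →ₗ[Aᵐᵒᵖ] Qm (pq A (F i)) :=
        ((LinearMap.ker (pqR (hF.idem j))).liftQ ψ hk).comp
          ((pqR (hF.idem j)).quotKerEquivOfSurjective (pqR_surj (hF.idem j))).symm.toLinearMap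
      have ht : ∀ x : rightIdeal A (F j), t (pqR (hF.idem j) x) = ψ x := by
        intro x
        have : ((pqR (hF.idem j)).quotKerEquivOfSurjective (pqR_surj (hF.idem j))).symm
            (pqR (hF.idem j) x) = Submodule.Quotient.mk x := by
          rw [LinearEquiv.symm_apply_eq]; rfl
        change (LinearMap.ker (pqR (hF.idem j))).liftQ ψ hk
          (((pqR (hF.idem j)).quotKerEquivOfSurjective (pqR_surj (hF.idem j))).symm
            (pqR (hF.idem j) x)) = ψ x
        rw [this]; rfl
      refine ⟨ModuleCat.ofHom t, ModuleCat.hom_ext (LinearMap.ext fun x => ?_)⟩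
      exact ht x
  rw [(LinearEquiv.ofBijective φ hφ).length_eq]

lemma PSk (hF : BF F) (i j : K) (k : ℕ) (hk : k ≠ 0) :
    ell R (stk (PI F j) ⟶ sstk (SI F i) (k : ℤ)) = 0 := by
  have := PI_proj hF j
  exact ell_zero R fun x => proj_van_zero _ _ (-k) (sstk_isLE _ _) (by lia) x

lemma chi_PS (hF : BF F) (n : ℕ) (hn0 : 0 < n) (i j : K) :
    chi R n (SI F i) (PI F j) = if j = i then dd R F i else 0 := by
  rw [chi, Finset.sum_eq_single 0]
  · rw [PS0 R hF]; simp
  · intro k _ hk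
    rw [PSk R hF i j k hk, mul_zero]
  · intro h; simp at h; lia

end deg0

/-- the Cartan matrix in terms of `len` -/
def cm {A : Type} [Ring A] {K : Type} (F : K → A) (hi : ∀ i, IsIdempotentElem (F i)) : Matrix K K ℤ :=
  fun i j => ((len (F i) (hi i) (rightIdeal A (F j))).toNat : ℤ)

theorem det_red (R : Type) [CommRing R] [IsArtinianRing R] {A : Type} [Ring A] [Algebra R A]
    [Module.Finite R A] (hA : HasFiniteGlobalDimension A) {L ι : Type} [Fintype L] [Fintype ι]
    [DecidableEq L] [DecidableEq ι] {F : L ⊕ ι → A} (hF : BF F) {e : A} (he : IsIdempotentElem e)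
    (hs : ∑ i, F (Sum.inr i) = e) (hY : HasFiniteGlobalDimension (YonedaRing A e)) :
    (cm F hF.idem).det = ((cm F hF.idem).toBlocks₁₁).det := by
  let _ := HasDerivedCategory.standard (ModuleCat.{0} Aᵐᵒᵖ)
  obtain ⟨n, hn0, hn⟩ : ∃ n : ℕ, 0 < n ∧ ∀ (X Y : ModuleCat.{0} Aᵐᵒᵖ) (k : ℤ), n ≤ k →
      ∀ x : stk X ⟶ sstk Y k, x = 0 := by
    obtain ⟨n, hn⟩ := id hA
    exact ⟨n + 1, by lia, fun X Y k hk x => hgl_of hn X Y k (by push_cast at hk; lia) x⟩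
  have fS : Module.Finite Aᵐᵒᵖ (Se A e) := SeModule_finite he
  let D := hF.ssdec he Sum.inr Sum.inr_injective hs
  have hb (j : ι) := @poly_ex R _ _ A _ _ _ _ (Se A e) ι _ D hA n hn fS hY (PI F (Sum.inr j))
    (PI_finite _)
  choose b hb using hb
  let X : Matrix (L ⊕ ι) (L ⊕ ι) ℤ := fun i l => chi R n (SI F l) (SI F i)
  -- determinant of the Euler matrix of the simples below e
  have hX : X.toBlocks₂₂.det = ∏ i : ι, dd R F (Sum.inr i) := by
    let bM : Matrix ι ι (Polynomial ℤ) := fun j l => b j l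
    let cM : Matrix ι ι (Polynomial ℤ) := fun l i => cpoly R n (SI F (Sum.inr l)) (SI F (Sum.inr i))
    refine det_const bM cM (fun i => dd R F (Sum.inr i))
      (fun i => dd_ne R hF _) ?_ 0 _ ?_ ?_
    · ext1 j i
      ext k
      have h1 : (bM * cM) j i
        = ∑ l, b j l * cpoly R n (SI F (Sum.inr l)) (SI F (Sum.inr i)) := rfl
      rw [h1]
      refine (hb j i k).symm.trans ?_
      change ell R (stk (PI F (Sum.inr j)) ⟶ sstk (SI F (Sum.inr i)) (k : ℤ)) = _
      by_cases hk : k = 0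
      · subst hk
        rw [PS0 R hF, Matrix.diagonal_apply]
        by_cases hji : j = i
        · subst hji; simp
        · simp [hji]
      · rw [PSk R hF _ _ k hk, Matrix.diagonal_apply]
        by_cases hji : j = i
        · subst hji; rw [if_pos rfl, Polynomial.coeff_C, if_neg hk]
        · simp [hji]
    · intro i j
      change (cpoly R n _ _).eval 0 = _
      rw [← Polynomial.coeff_zero_eq_eval_zero, cpoly_coeff R hn, SS0 R hF, Matrix.diagonal_apply]
      by_cases hji : i = j
      · subst hji; simp
      · simp [hji]
    · intro i j
      exact cpoly_eval R n _ _
  have hmul : (cm F hF.idem)ᵀ * X = Matrix.diagonal (dd R F) := by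
    ext j l
    rw [Matrix.mul_apply, Matrix.diagonal_apply]
    have fP := rightIdeal_finite (F j)
    have h1 := @chi_len R _ _ A _ _ _ _ (L ⊕ ι) _ _ F hF n hn (SI F l) (SI_finite hF l)
      (rightIdeal A (F j)) _ _ (finLen R _)
    have h2 := chi_PS R hF n hn0 l j
    refine (h1.symm.trans h2).trans ?_
    by_cases hji : j = l
    · subst hji; simp
    · simp [hji]
  set C := cm F hF.idem with hC
  have hblk : Cᵀ * Matrix.fromBlocks (1 : Matrix L L ℤ) X.toBlocks₁₂ (0 : Matrix ι L ℤ) X.toBlocks₂₂ =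
      Matrix.fromBlocks (C.toBlocks₁₁)ᵀ 0 (C.toBlocks₁₂)ᵀ (Matrix.diagonal fun i => dd R F (Sum.inr i)) := by
    have hcol (j : L ⊕ ι) (l : ι) : (Cᵀ * X) j (Sum.inr l) =
        (Cᵀ * Matrix.fromBlocks (1 : Matrix L L ℤ) X.toBlocks₁₂ (0 : Matrix ι L ℤ) X.toBlocks₂₂) j (Sum.inr l) := by
      rw [Matrix.mul_apply, Matrix.mul_apply]
      refine Finset.sum_congr rfl fun i _ => ?_
      congr 1
      cases i <;> rfl
    have hcol1 (j : L ⊕ ι) (l : L) : 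
        (Cᵀ * Matrix.fromBlocks (1 : Matrix L L ℤ) X.toBlocks₁₂ (0 : Matrix ι L ℤ) X.toBlocks₂₂) j (Sum.inl l) = C (Sum.inl l) j := by
      rw [Matrix.mul_apply, Fintype.sum_sum_type]
      simp [Matrix.one_apply]
    ext j l
    cases l with
    | inl l => rw [hcol1]; cases j <;> rfl
    | inr l =>
      rw [← hcol, hmul]
      cases j with
      | inl j => simp
      | inr j => simp [Matrix.diagonal_apply]
  have hdet := congrArg Matrix.det hblk
  rw [Matrix.det_mul, Matrix.det_fromBlocks_zero₂₁, Matrix.det_fromBlocks_zero₁₂, Matrix.det_transpose,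
    Matrix.det_transpose, Matrix.det_one, one_mul, hX, Matrix.det_diagonal] at hdet
  exact mul_right_cancel₀ (Finset.prod_ne_zero_iff.2 fun i _ => dd_ne R hF _) hdet

end CDR
end

noncomputable section
namespace CDR
open MulOpposite (op unop)

lemma corner_prim {A : Type} [Ring A] {c : A} {hc : IsIdempotentElem c} (g : CornerRing c hc)
    (hg : IsPrimitiveIdempotent g) : IsPrimitiveIdempotent g.1 := by
  obtain ⟨h1, h2, h3⟩ := hg
  have hgi : g.1 * g.1 = g.1 := congrArg Subtype.val h1
  refine ⟨hgi, fun h => h2 (Subtype.ext h), ?_⟩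
  intro x y hx hy hxy hyx hs
  have key : ∀ z : A, g.1 * z = z → z * g.1 = z → c * z = z ∧ z * c = z := by
    intro z a b
    constructor
    · rw [← a, ← mul_assoc, g.2.1]
    · rw [← b, mul_assoc, g.2.2]
  have cx := key x (by rw [← hs, add_mul, hx.eq, hyx, add_zero]) (by rw [← hs, mul_add, hx.eq, hxy, add_zero])
  have cy := key y (by rw [← hs, add_mul, hy.eq, hxy, zero_add]) (by rw [← hs, mul_add, hy.eq, hyx, zero_add])
  have := h3 ⟨x, cx⟩ ⟨y, cy⟩ (Subtype.ext hx) (Subtype.ext hy) (Subtype.ext hxy) (Subtype.ext hyx)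
    (Subtype.ext hs)
  exact this.imp (congrArg Subtype.val) (congrArg Subtype.val)

lemma corner_sum {A : Type} [Ring A] {c : A} {hc : IsIdempotentElem c} {ι : Type} (s : Finset ι)
    (g : ι → CornerRing c hc) : (∑ i ∈ s, g i).1 = ∑ i ∈ s, (g i).1 := by
  classical
  induction s using Finset.induction_on with
  | empty => simp only [Finset.sum_empty]; rfl
  | insert a s ha ih =>
    rw [Finset.sum_insert ha, Finset.sum_insert ha, ← ih]; rfl

lemma cm_det {A : Type} [Ring A] [IsArtinianRing A] (R : Type) [CommRing R] [IsArtinianRing R]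
    [Algebra R A] [Module.Finite R A] {K L : Type} [Fintype K] [Fintype L] [DecidableEq K]
    [DecidableEq L] {F : K → A} {G : L → A} (hF : BF F) (hG : BF G) (τ : L → K)
    (hτ : ∀ l, pq A (G l) = pq A (F (τ l))) : (cm G hG.idem).det = (cm F hF.idem).det := by
  have hb := hF.bij hG τ hτ
  have hF' : BF (fun l => F (τ l)) := by
    refine hF.transfer _ τ (fun _ => rfl) (fun _ => hF.idem _)
      (fun i j hij => hF.orth _ _ (fun h => hij (hb.1 h))) ?_
    rw [← hF.sum]
    exact Fintype.sum_bijective τ hb _ _ fun _ => rfl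
  rw [← Matrix.det_submatrix_equiv_self (Equiv.ofBijective τ hb) (cm F hF.idem)]
  congr 1
  ext i j
  change ((len (G i) (hG.idem i) (rightIdeal A (G j))).toNat : ℤ) =
    ((len (F (τ i)) (hF.idem _) (rightIdeal A (F (τ j)))).toNat : ℤ)
  obtain ⟨E⟩ := len_conj (hF.idem (τ j)) (hG.idem j) (hτ j).symm
  have := rightIdeal_finite (A := A) (F (τ j))
  have h1 := hG.len_eq hF' hτ i (rightIdeal A (F (τ j))) (finLen R _)
  rw [len_congr _ _ E, h1]

theorem main (R : Type) [CommRing R] [IsArtinianRing R]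
    (A : Type) [Ring A] [Algebra R A] [Module.Finite R A]
    (hbasic : IsBasicRing A)
    (hA : HasFiniteGlobalDimension A)
    (e : A) (he : IsIdempotentElem e)
    (hY : HasFiniteGlobalDimension (YonedaRing A e))
    {n : ℕ} (f : Fin n → A) (hfprim : ∀ i, IsPrimitiveIdempotent (f i))
    (hforth : ∀ i j, i ≠ j → f i * f j = 0) (hfsum : ∑ i, f i = 1)
    (CA : Matrix (Fin n) (Fin n) ℤ) (hCA : IsCartanMatrix A f (fun i => (hfprim i).1) CA)
    {m : ℕ} (g : Fin m → CornerRing (1 - e) he.one_sub)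
    (hgprim : ∀ i, IsPrimitiveIdempotent (g i))
    (hgorth : ∀ i j, i ≠ j → g i * g j = 0) (hgsum : ∑ i, g i = 1)
    (CG : Matrix (Fin m) (Fin m) ℤ)
    (hCG : IsCartanMatrix (CornerRing (1 - e) he.one_sub) g (fun i => (hgprim i).1) CG) :
    CA.det = CG.det ∧ HasFiniteGlobalDimension (CornerRing (1 - e) he.one_sub) := by
  classical
  have := artA R A
  obtain ⟨n0, f0, hp0, ho0, hs0, hi0⟩ := hbasic
  have hF0 : BF f0 := BF.of_basic R f0 hp0 ho0 hs0 hi0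
  -- the given family of idempotents
  choose σf hσf using fun i => hF0.prim (hfprim i)
  have hf : BF f := hF0.transfer f σf hσf (fun i => (hfprim i).1) hforth hfsum
  obtain ⟨I, h, hi, ho, hπ, hs⟩ := hf.lift_decomp he
  have hgp := fun k => corner_prim (g k) (hgprim k)
  choose σg hσg using fun k => hf.prim (hgp k)
  let F : Fin m ⊕ I → A := Sum.elim (fun k => (g k).1) (fun i => h i.1)
  have hsI : ∑ i : I, h i.1 = e := by rw [← hs]; exact Finset.sum_coe_sort I h
  have hee : ∀ i : I, e * h i.1 = h i.1 ∧ h i.1 * e = h i.1 := by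
    intro i
    have := sum_idem I h hi ho i.1 i.2
    rw [hs] at this
    exact ⟨this.2, this.1⟩
  let σ : Fin m ⊕ I → Fin n := Sum.elim σg (fun i => i.1)
  have hσ : ∀ l, pq A (F l) = pq A (f (σ l)) := by
    rintro (k | i)
    · exact hσg k
    · exact hπ i.1
  have hF : BF F := by
    refine hf.transfer F σ hσ ?_ ?_ ?_
    · rintro (k | i)
      · exact (hgp k).1
      · exact hi i.1
    · rintro (k | i) (l | j) hij
      · exact congrArg Subtype.val (hgorth k l (fun h => hij (by rw [h])))
      · change (g k).1 * h j.1 = 0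
        rw [← (g k).2.2, ← (hee j).1, mul_assoc, ← mul_assoc (1 - e), sub_mul, one_mul, he.eq]
        simp
      · change h i.1 * (g l).1 = 0
        rw [← (g l).2.1, ← (hee i).2, mul_assoc, ← mul_assoc e, mul_sub, mul_one, he.eq]
        simp
      · exact ho _ _ (fun h => hij (by rw [Subtype.ext h]))
    · rw [Fintype.sum_sum_type]
      change ∑ k, (g k).1 + ∑ i : I, h i.1 = 1
      rw [hsI, ← corner_sum, hgsum]
      change 1 - e + e = 1
      simp
  have hdet := det_red R hA hF he hsI hY
  have h1 : CA = cm f hf.idem := by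
    ext i j
    exact cartan_len hCA i j
  have h2 : CG = (cm F hF.idem).toBlocks₁₁ := by
    ext i j
    exact cartan_len_corner (fun k => (hgp k).1) hCG i j
  refine ⟨?_, ?_⟩
  · rw [h1, h2, ← hdet, cm_det R hf hF σ hσ]
  · have fS : Module.Finite Aᵐᵒᵖ (Se A e) := SeModule_finite he
    refine gldim_cor R (1 - e) he.one_sub hA (Se A e) (hF.ssdec he Sum.inr Sum.inr_injective hsI) hY
      (fun s => hF.kill he s) ?_
    intro Z _ _ hZ h0 z
    refine hF.gen he (fun l => l.isRight = true) ?_ ?_ Z hZ h0 z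
    · rintro (k | i) hl
      · simp at hl
      · rw [← map_mul]
        exact congrArg _ (hee i).1
    · rintro (k | i) hl
      · exact (g k).2.1
      · simp at hl

end CDR
end

/-- **Proposition.** Let `A` be a basic artin algebra of finite global dimension, `e` an
idempotent of `A` and `Γ = (1-e)A(1-e)`. If the Yoneda ring `Y(e)` has finite global
dimension, then the Cartan determinants of `A` and `Γ` coincide and `Γ` has finite global
dimension. In particular, if the Cartan determinant conjecture holds for `Γ`, then the
Cartan determinant of `A` is `1`. -/
theorem cartan_determinant_reduction
    (R : Type) [CommRing R] [IsArtinianRing R]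
    (A : Type) [Ring A] [Algebra R A] [Module.Finite R A]
    (hbasic : IsBasicRing A)
    (hA : HasFiniteGlobalDimension A)
    (e : A) (he : IsIdempotentElem e)
    (hY : HasFiniteGlobalDimension (YonedaRing A e))
    -- a Cartan matrix for `A`
    {n : ℕ} (f : Fin n → A) (hfprim : ∀ i, IsPrimitiveIdempotent (f i))
    (hforth : ∀ i j, i ≠ j → f i * f j = 0) (hfsum : ∑ i, f i = 1)
    (CA : Matrix (Fin n) (Fin n) ℤ) (hCA : IsCartanMatrix A f (fun i => (hfprim i).1) CA)
    -- a Cartan matrix for `Γ = (1-e)A(1-e)`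
    {m : ℕ} (g : Fin m → CornerRing (1 - e) he.one_sub)
    (hgprim : ∀ i, IsPrimitiveIdempotent (g i))
    (hgorth : ∀ i j, i ≠ j → g i * g j = 0) (hgsum : ∑ i, g i = 1)
    (CG : Matrix (Fin m) (Fin m) ℤ)
    (hCG : IsCartanMatrix (CornerRing (1 - e) he.one_sub) g (fun i => (hgprim i).1) CG) :
    CA.det = CG.det ∧
      HasFiniteGlobalDimension (CornerRing (1 - e) he.one_sub) ∧
      ((HasFiniteGlobalDimension (CornerRing (1 - e) he.one_sub) → CG.det = 1) →
        CA.det = 1) := by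
  obtain ⟨h1, h2⟩ := CDR.main R A hbasic hA e he hY f hfprim hforth hfsum CA hCA g hgprim hgorth
    hgsum CG hCG
  exact ⟨h1, h2, fun h => h1.trans (h h2)⟩
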